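/- There exists a set P in the Euclidean plane ℝ² such that: P is compact, equals the closure of its interior, and is homeomorphic to the closed unit disk; no tiling of the plane by isometric copies of P is invariant under a nonzero translation; and there is an uncountable family of tilings of the plane by isometric copies of P, no two of which are congruent — that is, for distinct tilings S₁, S₂ in the family there is no isometry f of ℝ² with {f(g(P)) : g ∈ S₁} = {h(P) : h ∈ S₂}. -/

import Mathlib

noncomputable section

/-- The Euclidean plane. -/
abbrev Plane : Type := EuclideanSpace ℝ (Fin 2)

/-- `S` is a tiling of the plane by the prototile `P`: the images `g '' P` for
`g ∈ S` cover the plane and have pairwise disjoint interiors. -/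
def IsTiling (P : Set Plane) (S : Set (Plane ≃ᵢ Plane)) : Prop :=
  (⋃ g ∈ S, g '' P) = Set.univ ∧
  S.Pairwise fun g h => Disjoint (interior (g '' P)) (interior (h '' P))

/-- The tiling `S` of the plane by `P` is invariant under translation by `v`. -/
def TilingTransInvariant (P : Set Plane) (S : Set (Plane ≃ᵢ Plane)) (v : Plane) : Prop :=
  (fun A => (fun x => v + x) '' A) '' ((fun g : Plane ≃ᵢ Plane => g '' P) '' S) =
    (fun g : Plane ≃ᵢ Plane => g '' P) '' S

/-- Two tilings of the plane by `P` are congruent if some isometry of the plane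
carries the set of tiles of the first onto the set of tiles of the second. -/
def TilingsCongruent (P : Set Plane) (S₁ S₂ : Set (Plane ≃ᵢ Plane)) : Prop :=
  ∃ f : Plane ≃ᵢ Plane,
    (fun A => f '' A) '' ((fun g : Plane ≃ᵢ Plane => g '' P) '' S₁) =
      (fun g : Plane ≃ᵢ Plane => g '' P) '' S₂

namespace HatTiling

section

/-- Eisenstein integers `x + y ζ` with `ζ = exp (iπ/3)`, as pairs of coordinates. -/
abbrev Eis : Type := ℤ × ℤ

/-- Rotation by `π/3`. -/
def rot (x : Eis) : Eis := (-x.2, x.1 + x.2)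

/-- Rotation by `kπ/3`. -/
def rotn (k : Fin 6) (x : Eis) : Eis := rot^[k.val] x

theorem rotn_add_apply (j k : Fin 6) (x : Eis) : rotn (j + k) x = rotn j (rotn k x) := by
  fin_cases j <;> fin_cases k <;> ext <;> simp [rotn, rot] 

@[simp] theorem rotn_zero (x : Eis) : rotn 0 x = x := rfl

theorem rotn_add (k : Fin 6) (x y : Eis) : rotn k (x + y) = rotn k x + rotn k y := by
  fin_cases k <;> ext <;> simp [rotn, rot] <;> ring

theorem rotn_neg (k : Fin 6) (x : Eis) : rotn k (-x) = -rotn k x := by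
  fin_cases k <;> ext <;> simp [rotn, rot] <;> ring

theorem rotn_sub (k : Fin 6) (x y : Eis) : rotn k (x - y) = rotn k x - rotn k y := by
  rw [sub_eq_add_neg, rotn_add, rotn_neg, sub_eq_add_neg]

@[simp] theorem rotn_apply_zero (k : Fin 6) : rotn k 0 = 0 := by
  have := rotn_add k 0 0; simpa using this

@[simp] theorem rotn_neg_rotn (k : Fin 6) (x : Eis) : rotn (-k) (rotn k x) = x := by
  rw [← rotn_add_apply, neg_add_cancel, rotn_zero]

@[simp] theorem rotn_rotn_neg (k : Fin 6) (x : Eis) : rotn k (rotn (-k) x) = x := by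
  rw [← rotn_add_apply, add_neg_cancel, rotn_zero]

/-- A lattice path up to backtracking on edges: the signed count of its directed edges, and its
displacement. -/
@[ext] structure LPath where
  c : Eis → Eis → ℤ
  d : Eis

namespace LPath

instance : Mul LPath := ⟨fun P Q => ⟨fun p q => P.c p q + Q.c (p - P.d) (q - P.d), P.d + Q.d⟩⟩
instance : One LPath := ⟨⟨fun _ _ => 0, 0⟩⟩
instance : Inv LPath := ⟨fun P => ⟨fun p q => -P.c (p + P.d) (q + P.d), -P.d⟩⟩

theorem mul_c (P Q : LPath) (p q : Eis) :
    (P * Q).c p q = P.c p q + Q.c (p - P.d) (q - P.d) := rfl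
@[simp] theorem mul_d (P Q : LPath) : (P * Q).d = P.d + Q.d := rfl
@[simp] theorem one_c (p q : Eis) : (1 : LPath).c p q = 0 := rfl
@[simp] theorem one_d : (1 : LPath).d = 0 := rfl
theorem inv_c (P : LPath) (p q : Eis) : (P⁻¹).c p q = -P.c (p + P.d) (q + P.d) := rfl
@[simp] theorem inv_d (P : LPath) : (P⁻¹).d = -P.d := rfl

instance : Group LPath := Group.ofLeftAxioms
  (fun P Q R => by
    ext p q
    · simp only [mul_c, mul_d, add_assoc, sub_sub]
    · simp [add_assoc]
    · simp [add_assoc])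
  (fun P => by ext <;> simp [mul_c])
  (fun P => by ext <;> simp [mul_c, inv_c])

/-- The loop based at `0` with given signed count of edges. -/
def loop (c : Eis → Eis → ℤ) : LPath := ⟨c, 0⟩

theorem loop_mul (c c' : Eis → Eis → ℤ) : loop c * loop c' = loop (c + c') := by
  ext <;> simp [loop, mul_c]

theorem conj_loop (P : LPath) (c : Eis → Eis → ℤ) :
    P * loop c * P⁻¹ = loop (fun p q => c (p - P.d) (q - P.d)) := by
  ext <;> simp [loop, mul_c, inv_c]

/-- A single step. -/
def step (s : Eis) : LPath :=
  ⟨fun p q => (if p = 0 ∧ q = s then 1 else 0) - (if p = s ∧ q = 0 then 1 else 0), s⟩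

theorem step_neg (s : Eis) : step (-s) = (step s)⁻¹ := by
  ext p q
  · simp only [step, inv_c, add_eq_zero_iff_eq_neg, add_eq_right, neg_sub]
    
  · rfl
  · rfl

/-- Rotation of paths. -/
def rotP (k : Fin 6) : LPath →* LPath where
  toFun P := ⟨fun p q => P.c (rotn (-k) p) (rotn (-k) q), rotn k P.d⟩
  map_one' := by ext <;> simp
  map_mul' P Q := by ext <;> simp [mul_c, rotn_sub, rotn_add]

theorem rotP_d (k : Fin 6) (P : LPath) : (rotP k P).d = rotn k P.d := rfl

theorem rotP_loop (k : Fin 6) (c : Eis → Eis → ℤ) :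
    rotP k (loop c) = loop (fun p q => c (rotn (-k) p) (rotn (-k) q)) := by
  ext <;> simp [loop, rotP]

theorem rotP_add (j k : Fin 6) (P : LPath) : rotP (j + k) P = rotP j (rotP k P) := by
  ext p q
  · change P.c _ _ = P.c _ _
    rw [← rotn_add_apply, ← rotn_add_apply, neg_add_rev]
  · simp [rotP, rotn_add_apply]
  · simp [rotP, rotn_add_apply]

theorem rotP_step (k : Fin 6) (s : Eis) : rotP k (step s) = step (rotn k s) := by
  have h : ∀ p q : Eis, rotn (-k) p = q ↔ p = rotn k q := fun p q =>
    ⟨fun h => by rw [← h, rotn_rotn_neg], fun h => by rw [h, rotn_neg_rotn]⟩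
  ext p q
  · simp [rotP, step, h]
  · rfl
  · rfl

end LPath

/-- Generators of path words: unit steps `a`, steps `b` of length `√3`, and the pieces `y`, `z`, `w`
of the boundaries of supertiles. -/
inductive Gen | a | b | y | z | w
  deriving DecidableEq

/-- Words in rotated generators. -/
abbrev Word : Type := FreeGroup (Gen × Fin 6)

namespace Word

/-- Rotation of words. -/
def rotW (k : Fin 6) : Word →* Word := FreeGroup.map fun x => (x.1, k + x.2)

def a (r : Fin 6) : Word := FreeGroup.of (Gen.a, r)
def b (r : Fin 6) : Word := FreeGroup.of (Gen.b, r)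
def y (r : Fin 6) : Word := FreeGroup.of (Gen.y, r)
def z (r : Fin 6) : Word := FreeGroup.of (Gen.z, r)
def w (r : Fin 6) : Word := FreeGroup.of (Gen.w, r)
def v (r : Fin 6) : Word := (y (r + 5))⁻¹ * w (r + 1)
def u (r : Fin 6) : Word := (y (r + 5))⁻¹ * w (r + 1) * (w (r + 3))⁻¹ * w (r + 5)
def e (r : Fin 6) : Word :=
  w r * (w (r + 4))⁻¹ * y (r + 2) * (z (r + 3))⁻¹ * (y (r + 3))⁻¹ * w (r + 5)

/-- The substitution rule expressing pieces of one level in those of the preceding level. -/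
def subGen : Gen → Word
  | .a => a 0
  | .b => b 0
  | .y => (w 2)⁻¹ * y 0
  | .z => z 0
  | .w => (w 2)⁻¹ * y 0 * z 0 * (y 5)⁻¹ * w 1 * (w 3)⁻¹

def sub : Word →* Word := FreeGroup.lift fun x => rotW x.2 (subGen x.1)

/-- The boundary of a supertile, of either of the two kinds. -/
def bdry : Bool → Word
  | true => z 2 * (y 1)⁻¹ * w 3 * (w 5)⁻¹ * y 3 * z 3 * u 3 * (v 5)⁻¹ * z 4 * v 4 * (w 1)⁻¹ * y 5 *
      z 5 * (y 4)⁻¹ * w 0 * (w 2)⁻¹ * w 0 * (w 4)⁻¹ * y 2 * (z 3)⁻¹ * (z 4)⁻¹ * (y 4)⁻¹ * w 0 *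
      (w 4)⁻¹ * y 2
  | false => z 2 * (y 1)⁻¹ * w 3 * (w 5)⁻¹ * e 3 * (w 0)⁻¹ * y 4 * z 4 * (y 3)⁻¹ * w 5 * (w 1)⁻¹ *
      y 5 * z 5 * (y 4)⁻¹ * w 0 * (w 2)⁻¹ * y 0 * z 0 * (y 5)⁻¹ * w 1 * (v 4)⁻¹ * (z 4)⁻¹ * v 5 *
      (u 3)⁻¹

/-- Elimination of three of the rotations of `z`. -/
def elim : Word →* Word := FreeGroup.lift fun x =>
  if x.1 = Gen.z ∧ 3 ≤ x.2 then rotW (x.2 - 3) ((y 3)⁻¹ * w 3 * (w 1)⁻¹ * y 5 * (z 0)⁻¹ * (y 0)⁻¹ *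
      w 0 * (w 4)⁻¹ * y 2)
  else FreeGroup.of x

end Word

open Word

/-- The seven children of a supertile. -/
inductive Child | A | B | C | D | E | F | G
  deriving DecidableEq

/-- The orientation of a child. -/
def Child.rot : Child → Fin 6
  | .A => 5
  | .B => 2
  | .C => 1
  | .D => 0
  | .E => 4
  | .F => 0
  | .G => 0

/-- Whether the child is a full supertile. -/
def Child.full : Child → Bool
  | .G => false
  | _ => true

/-- A path to the base point of a child. -/
def Child.path : Child → Word
  | .A =>
    z 2 * (y 1)⁻¹ * w 3 * (w 5)⁻¹ * y 3 * z 3 * (y 2)⁻¹ * w 4 * (w 0)⁻¹ * w 4 * (w 2)⁻¹ * y 0 *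
      (z 1)⁻¹
  | .B =>
    z 2 * (y 1)⁻¹ * w 3 * (w 5)⁻¹ * y 3 * z 3 * (y 2)⁻¹ * w 4 * (w 0)⁻¹ * y 2 * z 2 * (y 1)⁻¹ *
      w 3 * (w 5)⁻¹ * w 1 * (w 5)⁻¹ * y 3 * z 3 * (y 2)⁻¹ * w 4 * (w 0)⁻¹ * y 4 * z 4 * (y 3)⁻¹ *
      w 5 * (w 1)⁻¹ * w 3 * (w 1)⁻¹ * y 5 * (z 0)⁻¹ * (y 0)⁻¹ * w 2 * (w 4)⁻¹ * y 2 * z 2 *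
      (y 1)⁻¹ * w 3 * (w 5)⁻¹ * y 3 * z 3 * (y 2)⁻¹ * w 4 * (w 0)⁻¹ * w 2 * (w 0)⁻¹ * y 4 * z 4 *
      (y 3)⁻¹ * w 5 * (w 1)⁻¹ * y 5 * z 5 * (y 4)⁻¹ * w 0 * (w 2)⁻¹ * y 4 * z 4 * (y 3)⁻¹ * w 5 *
      (w 1)⁻¹ * w 3 * (w 1)⁻¹ * y 5 * z 5 * (y 4)⁻¹ * w 0 * (w 2)⁻¹ * y 0 * z 0 * (y 5)⁻¹ * w 1 *
      (w 3)⁻¹ * w 1 * (w 5)⁻¹ * y 3 * (z 4)⁻¹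
  | .C =>
    z 2 * (y 1)⁻¹ * w 3 * (w 5)⁻¹ * y 3 * z 3 * (y 2)⁻¹ * w 4 * (w 0)⁻¹ * y 2 * z 2 * (y 1)⁻¹ *
      w 3 * (w 5)⁻¹ * w 1 * (w 5)⁻¹ * y 3 * z 3 * (y 2)⁻¹ * w 4 * (w 0)⁻¹ * y 4 * z 4 * (y 3)⁻¹ *
      w 5 * (w 1)⁻¹ * w 3 * (w 1)⁻¹ * y 5 * (z 0)⁻¹ * (y 0)⁻¹ * w 2 * (w 4)⁻¹ * y 2 * z 2 *
      (y 1)⁻¹ * w 3 * (w 5)⁻¹ * y 3 * z 3 * (y 2)⁻¹ * w 4 * (w 0)⁻¹ * w 2 * (w 0)⁻¹ * y 4 * z 4 *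
      (y 3)⁻¹ * w 5 * (w 1)⁻¹ * y 5 * z 5 * (y 4)⁻¹ * w 0 * (w 2)⁻¹ * w 0 * (w 4)⁻¹ * y 2 *
      (z 3)⁻¹
  | .D =>
    z 2 * (y 1)⁻¹ * w 3 * (w 5)⁻¹ * y 3 * z 3 * (y 2)⁻¹ * w 4 * (w 0)⁻¹ * y 2 * z 2 * (y 1)⁻¹ *
      w 3 * (w 5)⁻¹ * w 1 * (w 5)⁻¹ * y 3 * z 3 * (y 2)⁻¹ * w 4 * (w 0)⁻¹ * y 4 * z 4 * (y 3)⁻¹ *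
      w 5 * (w 1)⁻¹ * w 3 * (w 1)⁻¹ * y 5 * (z 0)⁻¹ * (y 0)⁻¹ * w 2 * (w 0)⁻¹ * y 4 * z 4 * z 3 *
      (y 2)⁻¹ * w 4 * (w 0)⁻¹ * w 2 * (w 0)⁻¹ * y 4 * (z 5)⁻¹ * (y 5)⁻¹ * w 1 * (w 5)⁻¹ * y 3 *
      (z 4)⁻¹ * (y 4)⁻¹ * w 0 * (w 2)⁻¹ * w 0 * (w 4)⁻¹ * y 2 * (z 3)⁻¹ * (y 3)⁻¹ * w 5 *
      (w 3)⁻¹ * y 1 * (z 2)⁻¹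
  | .E =>
    (y 2)⁻¹ * w 4 * (w 0)⁻¹ * w 4 * (w 2)⁻¹ * y 0 * (z 1)⁻¹ * (y 1)⁻¹ * w 3 * (w 1)⁻¹ * y 5 *
      (z 0)⁻¹
  | .F =>
    z 2 * (y 1)⁻¹ * w 3 * (w 5)⁻¹ * y 3 * z 3 * (y 2)⁻¹ * w 4 * (w 0)⁻¹ * y 2 * z 2 * (y 1)⁻¹ *
      w 3 * (w 5)⁻¹ * w 1 * (w 5)⁻¹ * y 3 * z 3 * (y 2)⁻¹ * w 4 * (w 0)⁻¹ * y 4 * z 4 * (y 3)⁻¹ *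
      w 5 * (w 1)⁻¹ * w 3 * (w 1)⁻¹ * y 5 * (z 0)⁻¹ * (y 0)⁻¹ * w 2 * (w 4)⁻¹ * y 2 * z 2 *
      (y 1)⁻¹ * w 3 * (w 5)⁻¹ * y 3 * z 3 * (y 2)⁻¹ * w 4 * (w 0)⁻¹ * w 2 * (w 0)⁻¹ * y 4 * z 4 *
      (y 3)⁻¹ * w 5 * (w 1)⁻¹ * y 5 * z 5 * (y 4)⁻¹ * w 0 * (w 2)⁻¹ * y 4 * z 4 * (y 3)⁻¹ * w 5 *
      (w 1)⁻¹ * w 3 * (w 1)⁻¹ * y 5 * z 5 * (y 4)⁻¹ * w 0 * (w 2)⁻¹ * y 0 * z 0 * (y 5)⁻¹ * w 1 *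
      (w 3)⁻¹ * y 5 * z 5 * (y 4)⁻¹ * w 0 * (w 2)⁻¹ * w 4 * (w 2)⁻¹ * y 0 * z 0 * (y 5)⁻¹ * w 1 *
      (w 3)⁻¹ * y 1 * z 1 * (y 0)⁻¹ * w 2 * (w 4)⁻¹ * w 2 * (w 0)⁻¹ * y 4 * (z 5)⁻¹ * (y 5)⁻¹ *
      w 1 * (w 5)⁻¹ * y 3 * (z 4)⁻¹ * (y 4)⁻¹ * w 0 * (w 2)⁻¹ * w 0 * (w 4)⁻¹ * y 2 * (z 3)⁻¹ *
      (y 3)⁻¹ * w 5 * (w 3)⁻¹ * y 1 * (z 2)⁻¹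
  | .G =>
    z 2 * (y 1)⁻¹ * w 3 * (w 5)⁻¹ * y 3 * z 3 * (y 2)⁻¹ * w 4 * (w 0)⁻¹ * y 2 * z 2 * (y 1)⁻¹ *
      w 3 * (w 5)⁻¹ * w 1 * (w 5)⁻¹ * y 3 * z 3 * (y 2)⁻¹ * w 4 * (w 0)⁻¹ * y 4 * z 4 * (y 3)⁻¹ *
      w 5 * (w 1)⁻¹ * w 5 * (w 3)⁻¹ * y 1 * (z 2)⁻¹

def Child.conj (k : Child) : Word := k.path * rotW k.rot (bdry k.full) * k.path⁻¹

/-- The children of a supertile. -/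
def children : Bool → List Child
  | true => [.F, .B, .C, .D, .G, .A, .E]
  | false => [.B, .C, .D, .G, .A, .E]

theorem elim_sub_bdry (t : Bool) :
    elim (sub (bdry t)) = elim ((children t).map Child.conj).prod := by
  cases t <;> decide +kernel

/-- The pieces at the lowest level, in unit steps. -/
def baseGen : Gen → Word
  | .a => a 0
  | .b => b 0
  | .y => b 5
  | .z => b 2 * b 3 * a 2 * a 3
  | .w => b 3 * a 2

def base : Word →* Word := FreeGroup.lift fun x => rotW x.2 (baseGen x.1)

/-- Normalization of the directions of steps. -/
def normalForm : Word →* Word := FreeGroup.lift fun x =>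
  if 3 ≤ x.2 then (FreeGroup.of (x.1, x.2 - 3))⁻¹ else FreeGroup.of x

/-- The boundary of the kite with centre `0` and axis along `1`. -/
def kiteBdry : Word := b 5 * a 1 * a 2 * b 3

/-- The boundaries of the hat and of its mirror image. -/
def hatBdry : Bool → Word
  | false =>
    (b 0)⁻¹ * (a 2)⁻¹ * a 0 * a 0 * a 1 * (b 2)⁻¹ * b 0 * a 2 * (a 0)⁻¹ * b 1 * b 2 * (a 1)⁻¹ *
      (a 0)⁻¹ * (b 1)⁻¹
  | true =>
    (b 1)⁻¹ * a 0 * (a 2)⁻¹ * b 0 * b 1 * a 0 * a 1 * b 2 * (b 0)⁻¹ * a 2 * (a 0)⁻¹ * (a 0)⁻¹ *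
      (a 1)⁻¹ * (b 2)⁻¹

/-- Paths to the kites of the hat, and their orientations. -/
def hatPaths : Bool → List (Word × Fin 6)
  | false => [
    ((b 0)⁻¹ * (a 2)⁻¹ * a 0 * a 0 * a 1 * (b 2)⁻¹ * b 0 * a 2 * (a 0)⁻¹ * b 1 * b 2 * (a 1)⁻¹ *
      (a 2)⁻¹ * (b 0)⁻¹, 1),
    (1, 4),
    (1, 5),
    (1, 0),
    (b 0 * (a 2)⁻¹ * (a 1)⁻¹ * (b 2)⁻¹, 1),
    (b 0 * (a 2)⁻¹ * a 0 * (b 1)⁻¹, 2),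
    (b 0 * (a 2)⁻¹ * a 0 * b 1, 3),
    (b 0 * b 0, 4)]
  | true => [
    (1, 5),
    ((b 2)⁻¹ * (a 1)⁻¹ * (a 2)⁻¹ * b 0 * b 1 * a 0 * a 1 * b 2 * (b 0)⁻¹ * a 2 * (a 0)⁻¹ *
      (b 1)⁻¹, 2),
    ((b 2)⁻¹ * (a 1)⁻¹ * (a 2)⁻¹ * b 0 * b 1 * a 0 * a 1 * b 2 * (b 0)⁻¹ * (b 0)⁻¹, 1),
    (1, 0),
    (b 0 * (a 2)⁻¹ * (a 1)⁻¹ * (a 1)⁻¹ * (a 2)⁻¹ * b 0 * b 1 * b 1, 5),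
    (b 0 * b 0, 4),
    (b 0 * b 0 * (b 1)⁻¹ * (a 0)⁻¹ * (a 1)⁻¹ * (b 2)⁻¹, 3),
    (b 0 * b 0 * (b 1)⁻¹ * (b 1)⁻¹, 2)]

theorem normalForm_hatBdry (m : Bool) : normalForm (hatBdry m) =
    normalForm ((hatPaths m).map fun x => x.1 * rotW x.2 kiteBdry * x.1⁻¹).prod := by
  cases m <;> decide +kernel

/-- Paths to the hats of a supertile of lowest level, and their orientations. -/
def basePaths : Bool → List (Word × Fin 6 × Bool)
  | true => [
    (a 0 * (a 2)⁻¹ * b 0 * (b 2)⁻¹ * (a 1)⁻¹ * (a 2)⁻¹ * (b 0)⁻¹, 2, true),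
    (a 0 * (a 2)⁻¹ * b 0 * (b 2)⁻¹ * (a 1)⁻¹ * (a 2)⁻¹ * (a 2)⁻¹ * a 0 * (b 1)⁻¹, 3, true),
    (a 0 * (a 2)⁻¹ * b 0 * (b 2)⁻¹ * (a 1)⁻¹ * (a 2)⁻¹ * b 0, 0, false),
    (a 0 * (a 2)⁻¹ * b 0 * (b 2)⁻¹ * (a 1)⁻¹ * (a 2)⁻¹ * b 0 * b 1 * a 0 * a 1 * (b 2)⁻¹ *
      (b 1)⁻¹ * a 0 * (a 2)⁻¹ * (a 2)⁻¹ * (a 1)⁻¹ * (a 1)⁻¹ * (a 0)⁻¹ * (b 1)⁻¹ * (b 0)⁻¹ * a 2 *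
      a 1 * b 2 * b 1 * a 0 * a 1 * (b 2)⁻¹, 4, true),
    (a 0 * (a 2)⁻¹ * b 0 * (b 2)⁻¹ * (a 1)⁻¹ * (a 2)⁻¹ * b 0 * b 1 * a 0 * a 1 * (b 2)⁻¹ *
      (b 1)⁻¹ * a 0 * (a 2)⁻¹ * (a 2)⁻¹ * (a 1)⁻¹ * (b 2)⁻¹, 4, true),
    (a 0 * (a 2)⁻¹ * b 0 * (b 2)⁻¹ * (a 1)⁻¹ * (a 2)⁻¹ * b 0 * b 1 * a 0 * a 1 * (b 2)⁻¹ *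
      (b 1)⁻¹ * a 0 * (a 2)⁻¹ * b 0, 5, true),
    (a 0 * (a 2)⁻¹ * b 0 * (b 2)⁻¹ * (a 1)⁻¹ * (a 2)⁻¹ * b 0 * b 1 * a 0 * a 1 * a 1 * a 0 * a 0 *
      (a 2)⁻¹ * b 0 * (b 2)⁻¹ * (a 1)⁻¹ * (a 0)⁻¹ * (b 1)⁻¹ * (b 0)⁻¹ * a 2 * (a 0)⁻¹ *
      b 1, 0, true),
    (a 0 * (a 2)⁻¹ * b 0 * b 1 * a 0 * a 1 * (b 2)⁻¹, 4, true)]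
  | false => [
    ((b 1)⁻¹ * (b 2)⁻¹ * (a 1)⁻¹ * (a 2)⁻¹ * (a 2)⁻¹ * (a 1)⁻¹ * (b 2)⁻¹ * b 0 * (a 2)⁻¹ * a 0 *
      a 0 * (a 2)⁻¹ * b 0 * (b 2)⁻¹ * (a 1)⁻¹ * (a 2)⁻¹ * b 0 * b 1 * a 0 * a 1 * a 1 * a 0 *
      b 1 * b 2 * a 1 * a 2 * a 2 * a 1 * b 2 * (b 0)⁻¹ * a 2 * (a 0)⁻¹ * (a 0)⁻¹ * (a 1)⁻¹ *
      (b 2)⁻¹ * (b 1)⁻¹ * a 0 * (a 2)⁻¹ * (b 0)⁻¹ * b 2 * (a 1)⁻¹ * (a 0)⁻¹ * (a 0)⁻¹ * a 2 *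
      b 0, 0, false),
    (a 0 * (a 2)⁻¹ * b 0 * (b 2)⁻¹ * (a 1)⁻¹ * (a 2)⁻¹ * (b 0)⁻¹, 2, true),
    (a 0 * (a 2)⁻¹ * b 0 * (b 2)⁻¹ * (a 1)⁻¹ * (a 2)⁻¹ * (a 2)⁻¹ * a 0 * (b 1)⁻¹, 3, true),
    (a 0 * (a 2)⁻¹ * b 0 * (b 2)⁻¹ * (a 1)⁻¹ * (a 2)⁻¹ * (a 2)⁻¹ * a 0 * (b 1)⁻¹ * (b 2)⁻¹ *
      (a 1)⁻¹ * (a 2)⁻¹ * b 0 * (b 2)⁻¹ * (a 1)⁻¹ * (a 2)⁻¹ * b 0 * b 1 * a 0 * a 1 * a 1 * a 0 *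
      b 1 * b 2 * a 1 * a 2 * a 2 * (a 0)⁻¹ * (b 1)⁻¹ * (b 0)⁻¹ * a 2 * (a 0)⁻¹ * b 1, 0, true),
    (a 0 * (a 2)⁻¹ * b 0 * (b 2)⁻¹ * (a 1)⁻¹ * (a 2)⁻¹ * (a 2)⁻¹ * a 0 * a 0 * a 1 *
      (b 2)⁻¹, 4, true),
    (a 0 * (a 2)⁻¹ * b 0 * (b 2)⁻¹ * (a 1)⁻¹ * (a 2)⁻¹ * (a 2)⁻¹ * a 0 * a 0 * a 1 * (b 2)⁻¹ *
      b 0 * b 0, 5, true),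
    (a 0 * (a 2)⁻¹ * b 0 * (b 2)⁻¹ * (a 1)⁻¹ * (a 2)⁻¹ * (a 2)⁻¹ * a 0 * a 0 * a 1 * (b 2)⁻¹ *
      b 0 * b 0 * b 1 * a 0 * (a 2)⁻¹ * (a 2)⁻¹ * (a 1)⁻¹ * (b 2)⁻¹ * (b 1)⁻¹ * (a 0)⁻¹ *
      (a 1)⁻¹ * (a 1)⁻¹ * (a 0)⁻¹ * (b 1)⁻¹ * (b 0)⁻¹ * a 2 * a 1 * b 2 * b 1 * a 0 * a 1 *
      (b 2)⁻¹, 4, true)]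

theorem normalForm_base_bdry (t : Bool) : normalForm (base (bdry t)) =
    normalForm ((basePaths t).map fun x => x.1 * rotW x.2.1 (hatBdry x.2.2) * x.1⁻¹).prod := by
  cases t <;> decide +kernel

def relator : Word :=
  y 0 * z 0 * (y 5)⁻¹ * w 1 * (w 3)⁻¹ * rotW 3 (y 0 * z 0 * (y 5)⁻¹ * w 1 * (w 3)⁻¹)

theorem normalForm_base_relator : normalForm (base relator) = 1 := by decide +kernel

theorem sub_relator : ∃ c : Word, sub relator = c * rotW 1 relator * c⁻¹ := 
  ⟨(w 2)⁻¹ * y 0 * z 0 * (y 5)⁻¹ * w 1 * (w 3)⁻¹, by decide +kernel⟩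

/-- Evaluation of words, given paths for the unrotated generators. -/
def evG (G : Gen → LPath) : Word →* LPath := FreeGroup.lift fun x => LPath.rotP x.2 (G x.1)

theorem evG_of (G : Gen → LPath) (x : Gen × Fin 6) :
    evG G (FreeGroup.of x) = LPath.rotP x.2 (G x.1) := FreeGroup.lift_apply_of

theorem evG_rotW (G : Gen → LPath) (k : Fin 6) (x : Word) :
    evG G (rotW k x) = LPath.rotP k (evG G x) := by
  have : (evG G).comp (rotW k) = (LPath.rotP k).comp (evG G) := by
    ext1 x
    simp [rotW, evG_of, LPath.rotP_add]
  exact DFunLike.congr_fun this x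

/-- The paths of unit steps. -/
def stepG : Gen → LPath
  | .a => LPath.step (1, 0)
  | .b => LPath.step (1, 1)
  | _ => 1

/-- The paths of the pieces of boundary of all levels. -/
def pieceG : ℕ → Gen → LPath
  | 0, g => evG stepG (baseGen g)
  | n + 1, g => evG (pieceG n) (subGen g)

theorem evG_succ (n : ℕ) (x : Word) : evG (pieceG (n + 1)) x = evG (pieceG n) (sub x) := by
  have : evG (pieceG (n + 1)) = (evG (pieceG n)).comp sub := by
    ext1 x
    simp only [evG_of, MonoidHom.comp_apply, sub, FreeGroup.lift_apply_of, evG_rotW]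
    rfl
  exact DFunLike.congr_fun this x

theorem evG_base (x : Word) : evG (pieceG 0) x = evG stepG (base x) := by
  have : evG (pieceG 0) = (evG stepG).comp base := by
    ext1 x
    simp only [evG_of, MonoidHom.comp_apply, base, FreeGroup.lift_apply_of, evG_rotW]
    rfl
  exact DFunLike.congr_fun this x

theorem evG_norm (x : Word) : evG stepG (normalForm x) = evG stepG x := by
  have : (evG stepG).comp normalForm = evG stepG := by
    ext1 x
    obtain ⟨g, r⟩ := x
    simp only [MonoidHom.comp_apply, normalForm, FreeGroup.lift_apply_of]
    split_ifs with h
    · rw [map_inv, evG_of, evG_of]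
      have h3 : ∀ s : Eis, rotn r s = - rotn (r - 3) s := by
        intro s
        revert h
        fin_cases r <;> simp [rotn, rot] <;> ring_nf <;> simp [Prod.ext_iff]
      cases g <;> simp [stepG, LPath.rotP_step, h3, LPath.step_neg]
    · rfl
  exact DFunLike.congr_fun this x

theorem evG_relator (n : ℕ) : evG (pieceG n) relator = 1 := by
  induction n with
  | zero => rw [evG_base, ← evG_norm, normalForm_base_relator, map_one]
  | succ n ih =>
    obtain ⟨c, hc⟩ := sub_relator
    rw [evG_succ, hc]
    simp [evG_rotW, ih]

theorem evG_elim (n : ℕ) (x : Word) : evG (pieceG n) (elim x) = evG (pieceG n) x := by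
  have hz : evG (pieceG n) ((y 3)⁻¹ * w 3 * (w 1)⁻¹ * y 5 * (z 0)⁻¹ * (y 0)⁻¹ *
      w 0 * (w 4)⁻¹ * y 2) = evG (pieceG n) (z 3) := by
    have h := evG_relator n
    have : (y 3)⁻¹ * w 3 * (w 1)⁻¹ * y 5 * (z 0)⁻¹ * (y 0)⁻¹ * w 0 * (w 4)⁻¹ * y 2 =
      (y 3)⁻¹ * (y 0 * z 0 * (y 5)⁻¹ * w 1 * (w 3)⁻¹)⁻¹ * relator⁻¹ *
        (y 0 * z 0 * (y 5)⁻¹ * w 1 * (w 3)⁻¹) * y 3 * z 3 := by decide +kernel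
    rw [this]
    simp only [map_mul, map_inv, h]
    group
  have : (evG (pieceG n)).comp elim = evG (pieceG n) := by
    ext1 x
    obtain ⟨g, r⟩ := x
    simp only [MonoidHom.comp_apply, elim, FreeGroup.lift_apply_of]
    split_ifs with h
    · rw [evG_rotW, hz, ← evG_rotW, z, rotW, FreeGroup.map.of]
      simp [h.1]
    · rfl
  exact DFunLike.congr_fun this x

/-- Kites of the grid: the centre of the hexagon, and the direction of the axis. -/
abbrev Kite : Type := Eis × Fin 6

/-- The action of direct isometries on kites. -/
def Kite.act (p : Eis) (r : Fin 6) (κ : Kite) : Kite := (p + rotn r κ.1, r + κ.2)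

/-- The signed count of the edges of the boundary of a kite. -/
def Kite.chain (κ : Kite) (p q : Eis) : ℤ :=
  (evG stepG kiteBdry).c (rotn (-κ.2) (p - κ.1)) (rotn (-κ.2) (q - κ.1))

def kitesChain (L : List Kite) : Eis → Eis → ℤ := (L.map Kite.chain).sum

theorem Kite.chain_act (s : Eis) (r : Fin 6) (κ : Kite) (p q : Eis) :
    (κ.act s r).chain p q = κ.chain (rotn (-r) (p - s)) (rotn (-r) (q - s)) := by
  have h : ∀ x, rotn (-(r + κ.2)) (x - (s + rotn r κ.1)) =
      rotn (-κ.2) (rotn (-r) (x - s) - κ.1) := by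
    intro x
    rw [neg_add_rev, rotn_add_apply, ← sub_sub, rotn_sub (-r), rotn_neg_rotn]
  simp only [Kite.chain, Kite.act, h]

theorem kitesChain_cons (κ : Kite) (L : List Kite) :
    kitesChain (κ :: L) = κ.chain + kitesChain L := by simp [kitesChain]

theorem kitesChain_append (L L' : List Kite) :
    kitesChain (L ++ L') = kitesChain L + kitesChain L' := by simp [kitesChain]

theorem kitesChain_act (s : Eis) (r : Fin 6) (L : List Kite) (p q : Eis) :
    kitesChain (L.map (Kite.act s r)) p q =
      kitesChain L (rotn (-r) (p - s)) (rotn (-r) (q - s)) := by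
  induction L with
  | nil => rfl
  | cons κ L ih => 
    rw [List.map_cons, kitesChain_cons, kitesChain_cons, Pi.add_apply, Pi.add_apply, ih,
      Pi.add_apply, Pi.add_apply, Kite.chain_act]

theorem evG_conj {G : Gen → LPath} {x : Word} {L : List Kite}
    (h : evG G x = LPath.loop (kitesChain L)) (P : Word) (k : Fin 6) :
    evG G (P * rotW k x * P⁻¹) = LPath.loop (kitesChain (L.map (Kite.act (evG G P).d k))) := by
  rw [map_mul, map_mul, map_inv, evG_rotW, h, LPath.rotP_loop, LPath.conj_loop]
  congr 1
  ext p q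
  rw [kitesChain_act]

theorem evG_prod {ι : Type*} {G : Gen → LPath} (l : List ι) (x : ι → Word) (L : ι → List Kite)
    (h : ∀ i, evG G (x i) = LPath.loop (kitesChain (L i))) :
    evG G (l.map x).prod = LPath.loop (kitesChain (l.flatMap L)) := by
  induction l with
  | nil => rfl
  | cons i l ih =>
    rw [List.map_cons, List.prod_cons, map_mul, ih, h, LPath.loop_mul, List.flatMap_cons,
      kitesChain_append]

/-- Hats: the position, the orientation, and whether it is reflected. -/
abbrev Hat : Type := Eis × Fin 6 × Bool

/-- The kites of the hat and of its mirror image. -/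
def hatKites : Bool → List Kite
  | false => [((0, 0), 1), ((0, 0), 4), ((0, 0), 5), ((0, 0), 0), ((4, -2), 1), ((4, -2), 2),
      ((2, 2), 3), ((2, 2), 4)]
  | true => [((0, 0), 5), ((0, 0), 2), ((0, 0), 1), ((0, 0), 0), ((2, 2), 5), ((2, 2), 4),
      ((4, -2), 3), ((4, -2), 2)]

def Hat.kites (t : Hat) : List Kite := (hatKites t.2.2).map (Kite.act t.1 t.2.1)

def Hat.act (p : Eis) (r : Fin 6) (t : Hat) : Hat := (p + rotn r t.1, r + t.2.1, t.2.2)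

theorem Kite.act_act (p p' : Eis) (r r' : Fin 6) (κ : Kite) :
    (κ.act p' r').act p r = κ.act (p + rotn r p') (r + r') := by
  simp [Kite.act, rotn_add, rotn_add_apply, add_assoc]

theorem Hat.kites_act (p : Eis) (r : Fin 6) (t : Hat) :
    (t.act p r).kites = t.kites.map (Kite.act p r) := by
  simp [Hat.act, Hat.kites, Function.comp_def, Kite.act_act]

theorem evG_kiteBdry : evG stepG kiteBdry = LPath.loop (kitesChain [((0, 0), 0)]) := by
  ext p q
  · simp [kitesChain, Kite.chain, LPath.loop, ← Prod.zero_eq_mk]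
  · decide +kernel
  · decide +kernel

theorem evG_hatBdry (m : Bool) :
    evG stepG (hatBdry m) = LPath.loop (kitesChain (hatKites m)) := by
  rw [← evG_norm, normalForm_hatBdry, evG_norm,
    evG_prod (L := fun x => [((evG stepG x.1).d, x.2)])]
  · congr 2
    cases m <;> decide +kernel
  · intro x
    rw [evG_conj evG_kiteBdry]
    simp [Kite.act, ← Prod.zero_eq_mk]

/-- A path to a child of a supertile. -/
def Child.pos (n : ℕ) (k : Child) : Eis := (evG (pieceG n) k.path).d

/-- The hats of a supertile. -/
def hats : ℕ → Bool → List Hat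
  | 0, t => (basePaths t).map fun x => ((evG stepG x.1).d, x.2)
  | n + 1, t => (children t).flatMap fun k => (hats n k.full).map (Hat.act (k.pos n) k.rot)

def kites (n : ℕ) (t : Bool) : List Kite := (hats n t).flatMap Hat.kites

theorem kites_succ (n : ℕ) (t : Bool) : kites (n + 1) t =
    (children t).flatMap fun k => (kites n k.full).map (Kite.act (k.pos n) k.rot) := by
  simp only [kites, hats, List.flatMap_assoc, List.map_flatMap, List.flatMap_map, Hat.kites_act]

theorem evG_bdry (n : ℕ) (t : Bool) :
    evG (pieceG n) (bdry t) = LPath.loop (kitesChain (kites n t)) := by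
  induction n generalizing t with
  | zero =>
    rw [evG_base, ← evG_norm, normalForm_base_bdry, evG_norm,
      evG_prod (L := fun x => Hat.kites ((evG stepG x.1).d, x.2))]
    · simp only [kites, hats, List.flatMap_map]
    · exact fun x => evG_conj (evG_hatBdry _) _ _
  | succ n ih =>
    rw [evG_succ, ← evG_elim, elim_sub_bdry, evG_elim, kites_succ]
    exact evG_prod _ _ _ fun k => evG_conj (ih _) _ _

/-- Every other Fibonacci number, with its successor. -/
def fib2 : ℕ → ℤ × ℤ
  | 0 => (1, 0)
  | n + 1 => ((fib2 n).1 + (fib2 n).2, (fib2 n).1 + 2 * (fib2 n).2)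

/-- Sequences `fib2 n • (A, B) + C`. -/
abbrev Lin (M : Type) : Type := M × M × M

namespace Lin
variable {M N : Type} [AddCommGroup M] [AddCommGroup N]

def eval (n : ℕ) (t : Lin M) : M := (fib2 n).1 • t.1 + (fib2 n).2 • t.2.1 + t.2.2

def map (f : M → N) (t : Lin M) : Lin N := (f t.1, f t.2.1, f t.2.2)

/-- The shifted sequence. -/
def next (t : Lin M) : Lin M := (t.1 + t.2.1, t.1 + t.2.1 + t.2.1, t.2.2)

theorem eval_next (n : ℕ) (t : Lin M) : eval n t.next = eval (n + 1) t := by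
  simp only [eval, next, fib2]
  module

theorem eval_add (n : ℕ) (t s : Lin M) : eval n (t + s) = eval n t + eval n s := by
  simp only [eval, Prod.fst_add, Prod.snd_add]
  module

theorem eval_neg (n : ℕ) (t : Lin M) : eval n (-t) = -eval n t := by
  simp only [eval, Prod.fst_neg, Prod.snd_neg]
  module

theorem eval_sub (n : ℕ) (t s : Lin M) : eval n (t - s) = eval n t - eval n s := by
  rw [sub_eq_add_neg, eval_add, eval_neg, sub_eq_add_neg]

@[simp] theorem eval_zero (n : ℕ) : eval n (0 : Lin M) = 0 := by
  simp [eval]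

theorem eval_map (n : ℕ) (f : M →+ N) (t : Lin M) : eval n (map f t) = f (eval n t) := by
  simp [eval, map]

/-- A criterion for eventual nonnegativity. -/
def NonnegFrom (m : ℕ) (t : Lin ℤ) : Prop :=
  0 ≤ eval m t ∧ eval m t ≤ eval (m + 1) t ∧
    eval (m + 1) t - eval m t ≤ eval (m + 2) t - eval (m + 1) t

instance (m : ℕ) (t : Lin ℤ) : Decidable (NonnegFrom m t) := by
  unfold NonnegFrom; infer_instance

theorem NonnegFrom.eval_nonneg {m n : ℕ} {t : Lin ℤ} (h : NonnegFrom m t) (hn : m ≤ n) :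
    0 ≤ eval n t := by
  have key : NonnegFrom n t := by
    induction n, hn using Nat.le_induction with
    | base => exact h
    | succ n _ ih =>
      have h3 : eval (n + 3) t - t.2.2 = 3 * (eval (n + 2) t - t.2.2) - (eval (n + 1) t - t.2.2) := by
        simp only [eval, fib2, smul_eq_mul]; ring
      have h2 : eval (n + 2) t - t.2.2 = 3 * (eval (n + 1) t - t.2.2) - (eval n t - t.2.2) := by
        simp only [eval, fib2, smul_eq_mul]; ring
      obtain ⟨h0, h1, h4⟩ := ih
      refine ⟨by omega, ?_, ?_⟩
      · show eval (n + 1) t ≤ eval (n + 2) t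
        omega
      show eval (n + 2) t - eval (n + 1) t ≤ eval (n + 3) t - eval (n + 2) t
      omega
  exact key.1

end Lin

/-- Rotation as a homomorphism. -/
def rotHom (k : Fin 6) : Eis →+ Eis := ⟨⟨rotn k, rotn_apply_zero k⟩, rotn_add k⟩

/-- Six linear forms. -/
def ell (j : Fin 6) : Eis →+ ℤ :=
  (AddMonoidHom.fst ℤ ℤ + AddMonoidHom.snd ℤ ℤ).comp (rotHom (-j))

theorem ell_rotn (j k : Fin 6) (x : Eis) : ell j (rotn k x) = ell (j - k) x := by
  simp only [ell, AddMonoidHom.comp_apply]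
  congr 1
  change rotn (-j) (rotn k x) = rotn (-(j - k)) x
  rw [← rotn_add_apply]
  congr 1
  abel

theorem rotn_neg_apply (j : Fin 6) (x : Eis) :
    rotn (-j) x = ![x, (x.1 + x.2, -x.1), (x.2, -(x.1 + x.2)), (-x.1, -x.2), (-(x.1 + x.2), x.1),
      (-x.2, x.1 + x.2)] j := by
  match j with
  | 0 => rfl
  | 1 => change rotn 5 x = _; simp [rotn, rot]; abel
  | 2 => change rotn 4 x = _; simp [rotn, rot]; abel
  | 3 => change rotn 3 x = _; simp [rotn, rot]
  | 4 => change rotn 2 x = _; simp [rotn, rot]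
  | 5 => change rotn 1 x = _; simp [rotn, rot]

theorem ell_apply (j : Fin 6) (x : Eis) :
    ell j x = ![x.1 + x.2, x.2, -x.1, -(x.1 + x.2), -x.2, x.1] j := by
  change (rotn (-j) x).1 + (rotn (-j) x).2 = _
  rw [rotn_neg_apply]
  fin_cases j <;> simp ; abel

theorem abs_ell_le (j : Fin 6) (x : Eis) : |ell j x| ≤ |x.1| + |x.2| := by
  rw [ell_apply]
  have h := abs_add_le x.1 x.2
  have h1 := abs_nonneg x.1
  have h2 := abs_nonneg x.2
  fin_cases j <;> simp only [Fin.reduceFinMk, Matrix.cons_val, abs_neg] <;> omega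

/-- Letters of words. -/
abbrev Letter : Type := (Gen × Fin 6) × Bool

def letterDisp (D : Gen → Lin Eis) (x : Letter) : Lin Eis :=
  if x.2 then Lin.map (rotHom x.1.2) (D x.1.1) else -Lin.map (rotHom x.1.2) (D x.1.1)

def listDisp (D : Gen → Lin Eis) (l : List Letter) : Lin Eis := (l.map (letterDisp D)).sum

/-- The letters of a word together with their starting points. -/
def positions (D : Gen → Lin Eis) : List Letter → Lin Eis → List (Letter × Lin Eis)
  | [], _ => []
  | x :: l, p => (x, p) :: positions D l (p + letterDisp D x)

def letterPath (G : Gen → LPath) (x : Letter) : LPath :=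
  if x.2 then LPath.rotP x.1.2 (G x.1.1) else (LPath.rotP x.1.2 (G x.1.1))⁻¹

theorem evG_eq_prod (G : Gen → LPath) (x : Word) :
    evG G x = (x.toWord.map (letterPath G)).prod := by
  conv_lhs => rw [← FreeGroup.mk_toWord (x := x)]
  rw [evG, FreeGroup.lift_mk]
  congr 1
  refine List.map_congr_left fun x _ => ?_
  cases h : x.2 <;> simp [letterPath, h]

/-- An upper bound for the linear forms on the edges of a letter. -/
def letterBound (D : Gen → Lin Eis) (H : Gen → Fin 6 → Lin ℤ) (x : Letter) (j : Fin 6) : Lin ℤ :=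
  H x.1.1 (j - x.1.2) -
    if x.2 then 0 else Lin.map (ell j) (Lin.map (rotHom x.1.2) (D x.1.1))

section Bounds
variable {G : Gen → LPath} {D : Gen → Lin Eis} {n : ℕ} (hD : ∀ g, (G g).d = Lin.eval n (D g))
include hD

theorem letterPath_d (x : Letter) : (letterPath G x).d = Lin.eval n (letterDisp D x) := by
  unfold letterPath letterDisp
  split_ifs
  · rw [Lin.eval_map, LPath.rotP_d, hD]; rfl
  · rw [Lin.eval_neg, Lin.eval_map, LPath.inv_d, LPath.rotP_d, hD]; rfl

theorem evG_d (x : Word) : (evG G x).d = Lin.eval n (listDisp D x.toWord) := by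
  rw [evG_eq_prod]
  induction x.toWord with
  | nil => simp [listDisp]
  | cons y l ih =>
    simp only [listDisp, List.map_cons, List.sum_cons, List.prod_cons, LPath.mul_d] at ih ⊢
    rw [ih, Lin.eval_add, letterPath_d hD]

theorem exists_position_of_c_ne_zero (l : List Letter) (P : Lin Eis) (p q : Eis)
    (h : (l.map (letterPath G)).prod.c (p - Lin.eval n P) (q - Lin.eval n P) ≠ 0) :
    ∃ y ∈ positions D l P,
      (letterPath G y.1).c (p - Lin.eval n y.2) (q - Lin.eval n y.2) ≠ 0 := by
  induction l generalizing P with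
  | nil => simp at h
  | cons x l ih =>
    rw [List.map_cons, List.prod_cons, LPath.mul_c, letterPath_d hD, sub_sub, sub_sub,
      ← Lin.eval_add] at h
    by_cases h0 : (letterPath G x).c (p - Lin.eval n P) (q - Lin.eval n P) = 0
    · rw [h0, zero_add] at h
      obtain ⟨y, hy, h1⟩ := ih _ h
      exact ⟨y, List.mem_cons_of_mem _ hy, h1⟩
    · exact ⟨(x, P), List.mem_cons_self, h0⟩

theorem ell_le_letterBound {H : Gen → Fin 6 → Lin ℤ}
    (hH : ∀ g p q, (G g).c p q ≠ 0 → ∀ j, ell j p ≤ Lin.eval n (H g j))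
    (x : Letter) {p q : Eis} (h : (letterPath G x).c p q ≠ 0) (j : Fin 6) :
    ell j p ≤ Lin.eval n (letterBound D H x j) := by
  have key : ∀ p q, (LPath.rotP x.1.2 (G x.1.1)).c p q ≠ 0 →
      ell j p ≤ Lin.eval n (H x.1.1 (j - x.1.2)) := by
    intro p q h
    have := hH _ _ _ h (j - x.1.2)
    rwa [← ell_rotn, rotn_rotn_neg] at this
  unfold letterPath at h
  unfold letterBound
  split_ifs at h ⊢ with h2
  · simpa using key _ _ h
  · rw [Lin.eval_sub, Lin.eval_map, Lin.eval_map, ← hD]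
    rw [LPath.inv_c, neg_ne_zero, LPath.rotP_d] at h
    have := key _ _ h
    rw [map_add] at this
    change _ ≤ _ - ell j (rotn x.1.2 (G x.1.1).d)
    omega

theorem exists_position_ell_le {H : Gen → Fin 6 → Lin ℤ}
    (hH : ∀ g p q, (G g).c p q ≠ 0 → ∀ j, ell j p ≤ Lin.eval n (H g j))
    (x : Word) {p q : Eis} (h : (evG G x).c p q ≠ 0) :
    ∃ y ∈ positions D x.toWord 0, ∀ j,
      ell j p ≤ Lin.eval n (Lin.map (ell j) y.2 + letterBound D H y.1 j) := by
  rw [evG_eq_prod] at h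
  obtain ⟨y, hy, h1⟩ := exists_position_of_c_ne_zero hD x.toWord 0 p q (by simpa using h)
  refine ⟨y, hy, fun j => ?_⟩
  have := ell_le_letterBound hD hH y.1 h1 j
  rw [map_sub] at this
  rw [Lin.eval_add, Lin.eval_map]
  omega

end Bounds

/-- Displacements of the pieces. -/
def pieceD : Gen → Lin Eis
  | .a => (0, 0, (1, 0))
  | .b => (0, 0, (1, 1))
  | .y => ((-2, 4), (-2, 2), (4, -5))
  | .z => (0, 0, (-5, 1))
  | .w => ((-2, 0), (-6, 2), 0)

def stepD : Gen → Lin Eis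
  | .a => (0, 0, (1, 0))
  | .b => (0, 0, (1, 1))
  | _ => 0

theorem stepG_d (g : Gen) : (stepG g).d = Lin.eval 0 (stepD g) := by
  cases g <;> decide

theorem pieceG_d (n : ℕ) (g : Gen) : (pieceG n g).d = Lin.eval n (pieceD g) := by
  induction n generalizing g with
  | zero => 
    rw [pieceG, evG_d stepG_d]
    cases g <;> decide +kernel
  | succ n ih =>
    rw [pieceG, evG_d ih, ← Lin.eval_next]
    congr 1
    cases g <;> decide +kernel

/-- Upper bounds for the linear forms on the pieces. -/
def pieceH : Gen → Fin 6 → Lin ℤ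
  | .a => ![(0, 0, 1), (0, 0, 0), (0, 0, 0), (0, 0, 0), (0, 0, 0), (0, 0, 1)]
  | .b => ![(0, 0, 2), (0, 0, 1), (0, 0, 0), (0, 0, 0), (0, 0, 0), (0, 0, 1)]
  | .y => ![(2, 0, -1), (4, 2, -4), (2, 2, -2), (0, 1, 0), (2, -1, 0), (2, -1, 0)]
  | .z => ![(0, 0, 0), (0, 0, 1), (0, 0, 5), (0, 0, 4), (0, 0, 0), (0, 0, 0)]
  | .w => ![(2, 0, -1), (4, 2, -2), (6, 4, 0), (6, 2, -1), (2, -1, 0), (2, -1, 0)]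

def stepH : Gen → Fin 6 → Lin ℤ
  | .a => ![(0, 0, 1), (0, 0, 0), (0, 0, 0), (0, 0, 0), (0, 0, 0), (0, 0, 1)]
  | .b => ![(0, 0, 2), (0, 0, 1), (0, 0, 0), (0, 0, 0), (0, 0, 0), (0, 0, 1)]
  | _ => 0

theorem step_c_ne_zero {s p q : Eis} (h : (LPath.step s).c p q ≠ 0) : p = 0 ∨ p = s := by
  by_contra! h'
  exact h (by simp [LPath.step, h'])

theorem ell_le_stepH (g : Gen) (p q : Eis) (h : (stepG g).c p q ≠ 0) (j : Fin 6) :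
    ell j p ≤ Lin.eval 0 (stepH g j) := by
  cases g
  case a => rcases step_c_ne_zero h with rfl | rfl <;> revert j <;> decide +kernel
  case b => rcases step_c_ne_zero h with rfl | rfl <;> revert j <;> decide +kernel
  all_goals simp [stepG] at h

theorem ell_le_pieceH {n : ℕ} (hn : 2 ≤ n) (g : Gen) (p q : Eis) (h : (pieceG n g).c p q ≠ 0)
    (j : Fin 6) : ell j p ≤ Lin.eval n (pieceH g j) := by
  induction n, hn using Nat.le_induction generalizing g p q j with
  | base =>
    rw [pieceG, evG_succ, evG_base] at h
    obtain ⟨y, hy, h1⟩ := exists_position_ell_le stepG_d ell_le_stepH _ h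
    refine (h1 j).trans ?_
    have : ∀ g, ∀ y ∈ positions stepD (base (sub (subGen g))).toWord 0, ∀ j,
      Lin.eval 0 (Lin.map (ell j) y.2 + letterBound stepD stepH y.1 j) ≤
        Lin.eval 2 (pieceH g j) := by
      intro g; cases g <;> decide +kernel
    exact this g y hy j
  | succ n hn ih =>
    rw [pieceG] at h
    obtain ⟨y, hy, h1⟩ := exists_position_ell_le (pieceG_d n) ih _ h
    refine (h1 j).trans ?_
    rw [← Lin.eval_next, ← sub_nonneg, ← Lin.eval_sub]
    have : ∀ g, ∀ y ∈ positions pieceD (subGen g).toWord 0, ∀ j,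
      Lin.NonnegFrom 2 ((pieceH g j).next -
        (Lin.map (ell j) y.2 + letterBound pieceD pieceH y.1 j)) := by
      intro g; cases g <;> decide +kernel
    exact (this g y hy j).eval_nonneg hn

/-- Twice the approximate position of a point deep inside a supertile. -/
def deepD : Lin Eis := ((12, 0), (20, -4), (-2, -8))

theorem bdry_c_eq_zero {n : ℕ} (hn : 2 ≤ n) {p : Eis} (q : Eis)
    (hp : ∀ j, Lin.eval n (Lin.map (ell j) deepD) < 2 * ell j p + (fib2 n).2) :
    (evG (pieceG n) (bdry true)).c p q = 0 := by
  by_contra h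
  obtain ⟨y, hy, h1⟩ := exists_position_ell_le (pieceG_d n) (ell_le_pieceH hn) _ h
  have : ∀ y ∈ positions pieceD (bdry true).toWord 0, ∃ j,
      Lin.NonnegFrom 2 (Lin.map (ell j) deepD -
        (Lin.map (ell j) y.2 + letterBound pieceD pieceH y.1 j) -
        (Lin.map (ell j) y.2 + letterBound pieceD pieceH y.1 j) - (0, 1, 0)) := by
    decide +kernel
  obtain ⟨j, hj⟩ := this y hy
  have h2 := hj.eval_nonneg hn
  have h3 := hp j
  have h4 := h1 j
  simp only [Lin.eval_sub] at h2
  have h5 : Lin.eval n ((0, 1, 0) : Lin ℤ) = (fib2 n).2 := by simp [Lin.eval]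
  omega

/-- Displacements of children. -/
def childD : Child → Lin Eis
  | .A => ((10, 4), (18, 6), (4, -5))
  | .B => ((40, -2), (62, -4), (-6, -3))
  | .C => ((42, -12), (66, -18), (-5, 1))
  | .D => ((34, -14), (56, -22), 0)
  | .E => ((8, 14), (14, 20), (3, -9))
  | .F => ((10, 4), (18, 6), 0)
  | .G => ((20, -4), (32, -4), 0)

theorem Child.pos_eq (n : ℕ) (k : Child) : k.pos n = Lin.eval n (childD k) := by
  rw [Child.pos, evG_d (pieceG_d n)]
  congr 1
  cases k <;> decide +kernel

/-- A point on the axis of a kite. -/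
def Kite.pt (κ : Kite) : Eis := κ.1 + rotn κ.2 (1, 0)

theorem Kite.pt_act (p : Eis) (r : Fin 6) (κ : Kite) : (κ.act p r).pt = p + rotn r κ.pt := by
  simp [Kite.pt, Kite.act, rotn_add, rotn_add_apply, add_assoc]

theorem Kite.ell_pt_act (p : Eis) (r : Fin 6) (κ : Kite) (j : Fin 6) :
    ell j (κ.act p r).pt = ell j p + ell (j - r) κ.pt := by
  rw [Kite.pt_act, map_add, ell_rotn]

/-- Bounds for the linear forms on supertiles. -/
def hull : Fin 6 → Lin ℤ :=
  ![(22, 30, -9), (10, 10, -8), (0, 0, -1), (0, 0, 1), (8, 14, 2), (22, 34, -5)]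

theorem ell_pt_le_hull {n : ℕ} {t : Bool} {κ : Kite} (hκ : κ ∈ kites n t) (j : Fin 6) :
    ell j κ.pt ≤ Lin.eval n (hull j) := by
  induction n generalizing t κ j with
  | zero =>
    have : ∀ t, ∀ κ ∈ kites 0 t, ∀ j, ell j κ.pt ≤ Lin.eval 0 (hull j) := by
      decide +kernel
    exact this t κ hκ j
  | succ n ih =>
    rw [kites_succ] at hκ
    simp only [List.mem_flatMap, List.mem_map] at hκ
    obtain ⟨k, -, κ', hκ', rfl⟩ := hκ
    have h1 := ih hκ' (j - k.rot)
    have h2 : Lin.NonnegFrom 0 ((hull j).next -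
        (Lin.map (ell j) (childD k) + hull (j - k.rot))) := by
      clear h1
      revert j
      cases k <;> decide +kernel
    have h3 := h2.eval_nonneg n.zero_le
    rw [Lin.eval_sub, Lin.eval_next, Lin.eval_add, Lin.eval_map] at h3
    rw [Kite.ell_pt_act, Child.pos_eq]
    omega

/-- A kite deep inside a full supertile. -/
def deepKite : ℕ → Kite
  | 0 => ((5, -4), 1)
  | n + 1 => (deepKite n).act (Child.A.pos n) Child.A.rot

theorem abs_ell_deepKite_sub_le (n : ℕ) (j : Fin 6) :
    |2 * ell j (deepKite n).pt - ell j (Lin.eval n deepD)| ≤ 2 := by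
  induction n generalizing j with
  | zero => revert j; decide +kernel
  | succ n ih =>
    have h1 : deepD.next = childD .A + childD .A + Lin.map (rotHom Child.A.rot) deepD := by
      decide +kernel
    rw [← Lin.eval_next, h1, Lin.eval_add, Lin.eval_add, Lin.eval_map, ← Child.pos_eq, deepKite,
      Kite.ell_pt_act, map_add, map_add]
    have h2 := ell_rotn j Child.A.rot (Lin.eval n deepD)
    change ell j (rotHom Child.A.rot (Lin.eval n deepD)) = _ at h2
    rw [h2]
    have := ih (j - Child.A.rot)
    rw [abs_le] at this ⊢
    omega

theorem Kite.act_injective (p : Eis) (r : Fin 6) : Function.Injective (Kite.act p r) := by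
  intro κ κ' h
  have h2 : ∀ κ : Kite, (κ.act p r).act (-rotn (-r) p) (-r) = κ := fun κ => by
    simp [Kite.act, rotn_add]
  rw [← h2 κ, ← h2 κ', h]

theorem count_map_act_deepKite (n : ℕ) {k : Child} (hk : k ≠ .A) :
    ((kites n k.full).map (Kite.act (k.pos n) k.rot)).count (deepKite (n + 1)) = 0 := by
  rw [List.count_eq_zero]
  intro h
  obtain ⟨κ, hκ, h⟩ := List.mem_map.1 h
  have h1 : ∃ j, Lin.NonnegFrom 0 (Lin.map (ell j) deepD.next -
      (Lin.map (ell j) (childD k) + hull (j - k.rot)) -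
      (Lin.map (ell j) (childD k) + hull (j - k.rot)) - (0, 0, 3)) := by
    cases k <;> first | exact absurd rfl hk | decide +kernel
  obtain ⟨j, hj⟩ := h1
  have h2 := hj.eval_nonneg n.zero_le
  have h3 := abs_ell_deepKite_sub_le (n + 1) j
  have h4 := ell_pt_le_hull hκ (j - k.rot)
  rw [← h, Kite.ell_pt_act, Child.pos_eq, abs_le] at h3
  have h5 : Lin.eval n ((0, 0, 3) : Lin ℤ) = 3 := by simp [Lin.eval]
  rw [Lin.eval_sub, Lin.eval_sub, Lin.eval_sub, Lin.eval_add, Lin.eval_map, Lin.eval_map,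
    Lin.eval_next, h5] at h2
  omega

theorem count_deepKite (n : ℕ) : (kites n true).count (deepKite n) = 1 := by
  induction n with
  | zero => decide +kernel
  | succ n ih =>
    have hA : ((kites n Child.A.full).map (Kite.act (Child.A.pos n) Child.A.rot)).count
        (deepKite (n + 1)) = 1 := by
      rw [deepKite, List.count_map_of_injective _ _ (Kite.act_injective _ _)]
      exact ih
    rw [kites_succ]
    simp only [children, List.flatMap_cons, List.flatMap_nil, List.count_append, List.count_nil, hA]
    simp only [count_map_act_deepKite n (k := .F) (by decide),
      count_map_act_deepKite n (k := .B) (by decide),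
      count_map_act_deepKite n (k := .C) (by decide),
      count_map_act_deepKite n (k := .D) (by decide),
      count_map_act_deepKite n (k := .G) (by decide),
      count_map_act_deepKite n (k := .E) (by decide)]

/-- The lattice of centres of hexagons. -/
def latHom : Eis →+ Eis where
  toFun u := (2 * u.1 - 2 * u.2, 2 * u.1 + 4 * u.2)
  map_zero' := rfl
  map_add' u v := by ext <;> simp <;> ring

theorem latHom_rotn (k : Fin 6) (u : Eis) : latHom (rotn k u) = rotn k (latHom u) := by
  fin_cases k <;> ext <;> simp [latHom, rotn, rot] <;> ring

theorem latHom_injective : Function.Injective latHom := by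
  intro u v h
  simp only [latHom, AddMonoidHom.coe_mk, ZeroHom.coe_mk, Prod.mk.injEq] at h
  ext <;> omega

def IsLat (x : Eis) : Prop := 2 ∣ x.1 ∧ 6 ∣ x.2 - x.1

instance (x : Eis) : Decidable (IsLat x) := by unfold IsLat; infer_instance

theorem isLat_iff (x : Eis) : IsLat x ↔ x ∈ latHom.range := by
  constructor
  · rintro ⟨⟨i, hi⟩, j, hj⟩
    refine ⟨(i + j, j), ?_⟩
    ext <;> simp [latHom] <;> omega
  · rintro ⟨u, rfl⟩
    simp only [IsLat, latHom, AddMonoidHom.coe_mk, ZeroHom.coe_mk]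
    omega

theorem isLat_rotn {x : Eis} (h : IsLat x) (k : Fin 6) : IsLat (rotn k x) := by
  rw [isLat_iff] at h ⊢
  obtain ⟨u, rfl⟩ := h
  exact ⟨rotn k u, latHom_rotn k u⟩

theorem isLat_add {x y : Eis} (h : IsLat x) (h' : IsLat y) : IsLat (x + y) := by
  rw [isLat_iff] at *
  exact add_mem h h'

theorem isLat_eval (n : ℕ) {t : Lin Eis} (h : IsLat t.1 ∧ IsLat t.2.1 ∧ IsLat t.2.2) :
    IsLat (Lin.eval n t) := by
  simp only [isLat_iff] at *
  exact add_mem (add_mem (zsmul_mem h.1 _) (zsmul_mem h.2.1 _)) h.2.2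

/-- The positions of the tiles modulo the lattice. -/
def offset : Lin Eis := ((12, 0), (20, -4), (-5, -2))

theorem isLat_sub_offset {n : ℕ} {t : Bool} {h : Hat} (hh : h ∈ hats n t) :
    IsLat (h.1 - Lin.eval n offset) := by
  induction n generalizing t h with
  | zero =>
    have : ∀ t, ∀ h ∈ hats 0 t, IsLat (h.1 - Lin.eval 0 offset) := by decide +kernel
    exact this t h hh
  | succ n ih =>
    simp only [hats, List.mem_flatMap, List.mem_map] at hh
    obtain ⟨k, -, h', hh', rfl⟩ := hh
    have h1 : IsLat (Lin.eval n (childD k + Lin.map (rotHom k.rot) offset - offset.next)) := by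
      apply isLat_eval
      cases k <;> decide +kernel
    have h2 := isLat_add h1 (isLat_rotn (ih hh') k.rot)
    convert h2 using 1
    rw [Lin.eval_sub, Lin.eval_next, Lin.eval_add, Lin.eval_map, ← Child.pos_eq, rotn_sub]
    change _ = _ + rotn _ _ - _ + _
    simp only [Hat.act]
    abel

theorem evG_kiteBdry_eq : evG stepG kiteBdry =
    LPath.step (2, -1) * LPath.step (0, 1) * LPath.step (-1, 1) * LPath.step (-1, -1) := by
  simp only [kiteBdry, map_mul, a, b, evG_of, stepG, LPath.rotP_step]
  rfl

theorem kiteBdry_c_ne_zero {p q : Eis} (h : (evG stepG kiteBdry).c p q ≠ 0) :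
    p ∈ ([(0, 0), (2, -1), (2, 0), (1, 1)] : List Eis) := by
  by_contra h'
  simp only [List.mem_cons, List.not_mem_nil, or_false, not_or] at h'
  apply h
  have key : ∀ s t : Eis, p ≠ t → p ≠ t + s → (LPath.step s).c (p - t) (q - t) = 0 := by
    intro s t h1 h2
    by_contra h3
    rcases step_c_ne_zero h3 with h4 | h4
    · exact h1 (sub_eq_zero.1 h4)
    · exact h2 (by rw [← h4]; abel)
  rw [evG_kiteBdry_eq, LPath.mul_c, LPath.mul_c, LPath.mul_c, key _ _ ?_ ?_, key _ _ ?_ ?_,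
    key _ _ ?_ ?_]
  · have := key (2, -1) 0 h'.1 (by simpa using h'.2.1)
    simpa using this
  all_goals simp [LPath.step]; tauto

/-- The midpoint of an edge of a hexagon. -/
def mid (k : Fin 6) : Eis := rotn k (1, 1)

/-- The vertex of a hexagon. -/
def vert (k : Fin 6) : Eis := rotn k (2, 0)

theorem Kite.chain_add (s : Eis) (κ : Kite) (p q : Eis) :
    Kite.chain (s + κ.1, κ.2) (s + p) (s + q) = κ.chain p q := by
  simp only [Kite.chain]
  congr 2 <;> abel

theorem chain_of_table {p q : Eis} {κ₁ κ₂ : Kite}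
    (h : ∀ k, ∀ s ∈ ([(0, 0), (2, -1), (2, 0), (1, 1)] : List Eis),
      IsLat (p - rotn k s) → Kite.chain (p - rotn k s, k) p q ≠ 0 →
        (p - rotn k s, k) = κ₁ ∨ (p - rotn k s, k) = κ₂)
    (h₁ : κ₁.chain p q = 1) (h₂ : κ₂.chain p q = -1) {κ : Kite} (hκ : IsLat κ.1) :
    κ.chain p q = (if κ = κ₁ then 1 else 0) - (if κ = κ₂ then 1 else 0) := by
  by_cases e₁ : κ = κ₁
  · have : κ₁ ≠ κ₂ := by rintro rfl; omega
    rw [e₁, h₁, if_pos rfl, if_neg this]; rfl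
  by_cases e₂ : κ = κ₂
  · rw [if_neg e₁, e₂, h₂, if_pos rfl]; rfl
  rw [if_neg e₁, if_neg e₂, sub_zero]
  by_contra h0
  have hs := kiteBdry_c_ne_zero h0
  have h1 := h κ.2 _ hs
  rw [rotn_rotn_neg, sub_sub_cancel] at h1
  rcases h1 hκ h0 with h2 | h2
  · exact e₁ h2
  · exact e₂ h2

theorem chain_radial (k : Fin 6) {κ : Kite} (hκ : IsLat κ.1) : κ.chain 0 (mid k) =
    (if κ = (0, k + 1) then 1 else 0) - (if κ = (0, k) then 1 else 0) := by
  apply chain_of_table _ _ _ hκ <;> revert k <;> decide +kernel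

theorem chain_outer (k : Fin 6) {κ : Kite} (hκ : IsLat κ.1) :
    κ.chain (mid (k - 1)) (vert k) =
    (if κ = (0, k) then 1 else 0) - (if κ = (latHom (rotn (k - 1) (1, 0)), k + 2) then 1 else 0) := by
  apply chain_of_table _ _ _ hκ <;> revert k <;> decide +kernel

theorem kitesChain_eq_count {L : List Kite} {p q : Eis} {κ₁ κ₂ : Kite}
    (h : ∀ κ ∈ L, κ.chain p q = (if κ = κ₁ then 1 else 0) - (if κ = κ₂ then 1 else 0)) :
    kitesChain L p q = L.count κ₁ - L.count κ₂ := by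
  induction L with
  | nil => rfl
  | cons κ L ih =>
    rw [kitesChain_cons, Pi.add_apply, Pi.add_apply, h κ (by simp),
      ih fun κ' hκ' => h κ' (by simp [hκ']), List.count_cons, List.count_cons]
    push_cast
    simp only [beq_iff_eq]
    ring

/-- Cells: the kites, indexed by lattice coordinates. -/
abbrev Cell : Type := Eis × Fin 6

/-- The cells of the hat and of its mirror image. -/
def hatCells : Bool → List Cell
  | false => [((0, 0), 1), ((0, 0), 4), ((0, 0), 5), ((0, 0), 0), ((1, -1), 1), ((1, -1), 2),
      ((1, 0), 3), ((1, 0), 4)]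
  | true => [((0, 0), 5), ((0, 0), 2), ((0, 0), 1), ((0, 0), 0), ((1, 0), 5), ((1, 0), 4),
      ((1, -1), 3), ((1, -1), 2)]

/-- The cells of a tile, indexed by lattice coordinates, orientation and reflection. -/
def cells (t : Eis × Fin 6 × Bool) : List Cell := (hatCells t.2.2).map (Kite.act t.1 t.2.1)

/-- The kite corresponding to a cell, for a given origin. -/
def toKite (c : Eis) (x : Cell) : Kite := (c + latHom x.1, x.2)

def toHat (c : Eis) (t : Eis × Fin 6 × Bool) : Hat := (c + latHom t.1, t.2)

theorem toKite_injective (c : Eis) : Function.Injective (toKite c) := by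
  intro x y h
  simp only [toKite, Prod.mk.injEq, add_right_inj] at h
  exact Prod.ext (latHom_injective h.1) h.2

theorem kites_toHat (c : Eis) (t : Eis × Fin 6 × Bool) :
    (toHat c t).kites = (cells t).map (toKite c) := by
  have : ∀ m, hatKites m = (hatCells m).map (toKite 0) := by decide
  simp only [Hat.kites, cells, toHat, this, List.map_map]
  congr 1
  ext1 x
  simp [Kite.act, toKite, latHom_rotn, add_assoc]

theorem isLat_sub_offset_of_mem_kites {n : ℕ} {t : Bool} {κ : Kite} (hκ : κ ∈ kites n t) :
    IsLat (κ.1 - Lin.eval n offset) := by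
  simp only [kites, List.mem_flatMap] at hκ
  obtain ⟨h, hh, hκ⟩ := hκ
  obtain ⟨κ', hκ', rfl⟩ := List.mem_map.1 hκ
  have h1 : ∀ m, ∀ κ ∈ hatKites m, IsLat κ.1 := by decide +kernel
  have h2 := isLat_add (isLat_sub_offset hh) (isLat_rotn (h1 _ _ hκ') h.2.1)
  convert h2 using 1
  simp only [Kite.act]
  abel

theorem isLat_sub {x y : Eis} (h : IsLat x) (h' : IsLat y) : IsLat (x - y) := by
  rw [isLat_iff] at *
  exact sub_mem h h'

theorem isLat_sub_of_mem_kites {n : ℕ} {t : Bool} {κ : Kite} (hκ : κ ∈ kites n t) {c : Eis}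
    (hc : IsLat (c - Lin.eval n offset)) : IsLat (κ.1 - c) := by
  have := isLat_sub (isLat_sub_offset_of_mem_kites hκ) hc
  rwa [sub_sub_sub_cancel_right] at this

theorem count_eq_of_bdry_c_eq_zero {n : ℕ} {c p q : Eis} (hc : IsLat (c - Lin.eval n offset))
    (h0 : (evG (pieceG n) (bdry true)).c (c + p) (c + q) = 0) {κ₁ κ₂ : Kite}
    (h : ∀ κ : Kite, IsLat κ.1 →
      κ.chain p q = (if κ = κ₁ then 1 else 0) - (if κ = κ₂ then 1 else 0)) :
    (kites n true).count (c + κ₁.1, κ₁.2) = (kites n true).count (c + κ₂.1, κ₂.2) := by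
  rw [evG_bdry] at h0
  change kitesChain (kites n true) (c + p) (c + q) = 0 at h0
  rw [kitesChain_eq_count (κ₁ := (c + κ₁.1, κ₁.2)) (κ₂ := (c + κ₂.1, κ₂.2))] at h0
  · omega
  · intro κ hκ
    have h1 := h (κ.1 - c, κ.2) (isLat_sub_of_mem_kites hκ hc)
    rw [← Kite.chain_add c] at h1
    simp only [add_sub_cancel] at h1
    rw [h1]
    simp only [Prod.ext_iff, sub_eq_iff_eq_add']

theorem le_fib2 (n : ℕ) : 1 ≤ (fib2 n).1 ∧ (n : ℤ) ≤ (fib2 n).2 := by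
  induction n with
  | zero => decide
  | succ n ih =>
    simp only [fib2]
    push_cast
    omega

/-- The vertices near a deep kite are inside the supertile. -/
theorem bdry_c_eq_zero_near {n M : ℕ} (hn : 24 * M + 40 ≤ n) {u s : Eis} (q : Eis)
    (hu : |u.1| ≤ M ∧ |u.2| ≤ M) (hs : |s.1| ≤ 2 ∧ |s.2| ≤ 2) :
    (evG (pieceG n) (bdry true)).c ((deepKite n).1 + latHom u + s) q = 0 := by
  apply bdry_c_eq_zero (by omega)
  intro j
  have h1 := abs_ell_deepKite_sub_le n j
  rw [Lin.eval_map]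
  have h2 := (le_fib2 n).2
  have h3 : |ell j (rotn (deepKite n).2 (1, 0))| ≤ 1 := by
    have : ∀ j k, |ell j (rotn k (1, 0))| ≤ 1 := by decide
    exact this _ _
  rw [Kite.pt, map_add] at h1
  rw [map_add, map_add]
  have h4 := abs_ell_le j s
  have h5 := abs_ell_le j (latHom u)
  simp only [latHom, AddMonoidHom.coe_mk, ZeroHom.coe_mk] at h5
  have hu1 := abs_le.1 hu.1
  have hu2 := abs_le.1 hu.2
  have h6 : |2 * u.1 - 2 * u.2| ≤ 4 * M := by rw [abs_le]; omega
  have h7 : |2 * u.1 + 4 * u.2| ≤ 6 * M := by rw [abs_le]; omega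
  have h8 : ((24 * M + 40 : ℕ) : ℤ) ≤ n := by exact_mod_cast hn
  have h9 := abs_le.1 h1
  have h10 := abs_le.1 h3
  have h11 := neg_abs_le (ell j s)
  have h12 := neg_abs_le (ell j (latHom u))
  simp only [latHom, AddMonoidHom.coe_mk, ZeroHom.coe_mk] at h12 ⊢
  push_cast at h8
  omega

theorem count_near {n M : ℕ} (hn : 24 * M + 40 ≤ n) {u : Eis} (hu : |u.1| ≤ M ∧ |u.2| ≤ M)
    (k : Fin 6) : (kites n true).count (toKite (deepKite n).1 (u, k)) = 1 := by
  have hdeep : deepKite n ∈ kites n true := by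
    rw [← List.count_pos_iff, count_deepKite]; exact one_pos
  have hc (u : Eis) : IsLat ((deepKite n).1 + latHom u - Lin.eval n offset) := by
    rw [add_sub_right_comm]
    exact isLat_add (isLat_sub_offset_of_mem_kites hdeep) ((isLat_iff _).2 ⟨u, rfl⟩)
  set F : Cell → ℕ := fun x => (kites n true).count (toKite (deepKite n).1 x) with hF
  have radial (u : Eis) (hu : |u.1| ≤ M ∧ |u.2| ≤ M) (k : Fin 6) : F (u, k + 1) = F (u, k) := by
    have h0 := bdry_c_eq_zero_near hn ((deepKite n).1 + latHom u + mid k) hu (s := 0) (by simp)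
    have := count_eq_of_bdry_c_eq_zero (hc u) h0 fun κ => chain_radial k
    simpa [hF, toKite] using this
  have radial' (u : Eis) (hu : |u.1| ≤ M ∧ |u.2| ≤ M) (k : Fin 6) : F (u, k) = F (u, 0) := by
    have h0 := radial u hu 0
    have h1 := radial u hu 1
    have h2 := radial u hu 2
    have h3 := radial u hu 3
    have h4 := radial u hu 4
    simp only [Fin.reduceAdd] at h0 h1 h2 h3 h4
    fin_cases k <;> simp <;> omega
  have outer (u : Eis) (hu : |u.1| ≤ M ∧ |u.2| ≤ M) (k : Fin 6) :
      F (u, k) = F (u + rotn (k - 1) (1, 0), k + 2) := by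
    have hs : ∀ k, |(mid (k - 1)).1| ≤ 2 ∧ |(mid (k - 1)).2| ≤ 2 := by decide
    have h0 := bdry_c_eq_zero_near hn ((deepKite n).1 + latHom u + vert k) hu (hs k)
    have := count_eq_of_bdry_c_eq_zero (hc u) h0 fun κ => chain_outer k
    simpa [hF, toKite, add_assoc] using this
  have nbr (u : Eis) (hu : |u.1| ≤ M ∧ |u.2| ≤ M) (r : Fin 6)
      (hu' : |(u + rotn r (1, 0)).1| ≤ M ∧ |(u + rotn r (1, 0)).2| ≤ M) :
      F (u, 0) = F (u + rotn r (1, 0), 0) := by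
    have h := outer u hu (r + 1)
    rw [radial' u hu, add_sub_cancel_right, radial' _ hu'] at h
    exact h
  have hstep1 (i j : ℤ) (hj : |j| ≤ M) (hi : |i| ≤ M) (hi' : |i + 1| ≤ M) :
      F ((i, j), 0) = F ((i + 1, j), 0) := by
    have h : ((i, j) : Eis) + rotn 0 (1, 0) = (i + 1, j) := by simp
    have := nbr (i, j) ⟨hi, hj⟩ 0 (by rw [h]; exact ⟨hi', hj⟩)
    rwa [h] at this
  have hstep2 (i j : ℤ) (hi : |i| ≤ M) (hj : |j| ≤ M) (hj' : |j + 1| ≤ M) :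
      F ((i, j), 0) = F ((i, j + 1), 0) := by
    have h : ((i, j) : Eis) + rotn 1 (1, 0) = (i, j + 1) := by simp [rotn, rot]
    have := nbr (i, j) ⟨hi, hj⟩ 1 (by rw [h]; exact ⟨hi, hj'⟩)
    rwa [h] at this
  have line (f : ℤ → ℕ) (hf : ∀ i : ℤ, |i| ≤ M → |i + 1| ≤ M → f i = f (i + 1)) (i : ℤ)
      (hi : |i| ≤ M) : f i = f 0 := by
    induction i with
    | zero => rfl
    | succ i ih =>
      have := abs_le.1 hi
      rw [← hf i (by rw [abs_le]; omega) (by rw [abs_le]; omega)]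
      exact ih (by rw [abs_le]; omega)
    | pred i ih =>
      have := abs_le.1 hi
      rw [hf (-i - 1) (by rw [abs_le]; omega) (by rw [abs_le]; omega), sub_add_cancel]
      exact ih (by rw [abs_le]; omega)
  obtain ⟨i, j⟩ := u
  have e1 := line (fun i => F ((i, j), 0)) (fun i h h' => hstep1 i j hu.2 h h') i hu.1
  have e2 := line (fun j => F ((0, j), 0)) (fun j h h' => hstep2 0 j (by simp) h h') j hu.2
  have e3 : F (0, (deepKite n).2) = 1 := by
    simpa [hF, toKite] using count_deepKite n
  rw [radial' 0 (by simp)] at e3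
  exact (radial' (i, j) hu k).trans (e1.trans (e2.trans e3))

/-- Arbitrarily large parts of the plane can be tiled. -/
theorem exists_patch (M : ℕ) : ∃ L : List (Eis × Fin 6 × Bool), ∀ u : Eis, |u.1| ≤ M ∧ |u.2| ≤ M →
    ∀ k, (L.flatMap cells).count (u, k) = 1 := by
  set n := 24 * M + 40 with hn
  set c := (deepKite n).1 with hc
  have hdeep : deepKite n ∈ kites n true := by
    rw [← List.count_pos_iff, count_deepKite]; exact one_pos
  have h1 : hats n true ∈ Set.range (List.map (toHat c)) := by
    rw [Set.range_list_map]
    intro h hh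
    have h2 := isLat_sub (isLat_sub_offset hh) (isLat_sub_offset_of_mem_kites hdeep)
    rw [sub_sub_sub_cancel_right, isLat_iff] at h2
    obtain ⟨u, hu⟩ := h2
    exact ⟨(u, h.2), by simp [toHat, hu, hc]⟩
  obtain ⟨L, hL⟩ := h1
  refine ⟨L, fun u hu k => ?_⟩
  have := count_near hn.ge hu k
  rw [kites, ← hL, List.flatMap_map] at this
  simp only [kites_toHat, ← List.map_flatMap] at this
  rwa [List.count_map_of_injective _ _ (toKite_injective c)] at this

end

section

/-- Tiles: the position in lattice coordinates, the orientation, and whether it is reflected. -/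
abbrev Tile : Type := Eis × Fin 6 × Bool

/-- Sets of tiles covering every cell exactly once. -/
def ExactCover (S : Set Tile) : Prop := ∀ x : Cell, ∃! t, t ∈ S ∧ x ∈ cells t

def Tile.shift (v : Eis) (t : Tile) : Tile := (v + t.1, t.2)

theorem mem_cells_iff {t : Tile} {x : Cell} :
    x ∈ cells t ↔ ∃ y ∈ hatCells t.2.2, Kite.act t.1 t.2.1 y = x := List.mem_map

theorem mem_cells_shift {v : Eis} {t : Tile} {x : Cell} :
    x ∈ cells (t.shift v) ↔ (x.1 - v, x.2) ∈ cells t := by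
  obtain ⟨p, k⟩ := x
  simp only [mem_cells_iff, Tile.shift, Kite.act, Prod.mk.injEq, add_assoc, eq_sub_iff_add_eq']

theorem finite_setOf_mem_cells (x : Cell) : {t : Tile | x ∈ cells t}.Finite := by
  let A : Finset (Bool × Fin 6 × Cell) :=
    Finset.univ ×ˢ Finset.univ ×ˢ ((hatCells false).toFinset ∪ (hatCells true).toFinset)
  refine (A.image fun a => ((x.1 - rotn a.2.1 a.2.2.1, a.2.1, a.1) : Tile)).finite_toSet.subset ?_
  intro t ht
  obtain ⟨y, hy, hx⟩ := mem_cells_iff.1 ht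
  simp only [Finset.coe_image, Set.mem_image]
  refine ⟨(t.2.2, t.2.1, y), ?_, ?_⟩
  · simp only [A, Finset.coe_product, Set.mem_prod, Finset.coe_univ, Set.mem_univ, true_and,
      Finset.coe_union, Set.mem_union, Finset.mem_coe, List.mem_toFinset]
    cases h : t.2.2 <;> rw [h] at hy <;> simp [hy]
  · rw [← hx]
    simp [Kite.act]

open Topology

/-- The space of sets of tiles. -/
abbrev Config : Type := Tile → Bool

def Config.tiles (s : Config) : Set Tile := {t | s t = true}

theorem isClosed_setOf_existsUnique (x : Cell) :
    IsClosed {s : Config | ∃! t, t ∈ s.tiles ∧ x ∈ cells t} := by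
  have : Finite {t : Tile | x ∈ cells t} := finite_setOf_mem_cells x
  have h : {s : Config | ∃! t, t ∈ s.tiles ∧ x ∈ cells t} =
      (fun (s : Config) (t : {t : Tile | x ∈ cells t}) => s t) ⁻¹' {s | ∃! t, s t = true} := by
    ext s
    constructor
    · rintro ⟨t, ⟨ht, hx⟩, hu⟩
      exact ⟨⟨t, hx⟩, ht, fun t' ht' => Subtype.ext (hu t' ⟨ht', t'.2⟩)⟩
    · rintro ⟨⟨t, hx⟩, ht, hu⟩
      exact ⟨t, ⟨ht, hx⟩, fun t' ht' => congrArg Subtype.val (hu ⟨t', ht'.2⟩ ht'.1)⟩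
  rw [h]
  exact (isClosed_discrete _).preimage (by fun_prop)

def coverings : Set Config := {s | ExactCover s.tiles}

theorem isClosed_coverings : IsClosed coverings := by
  have : coverings = ⋂ x, {s : Config | ∃! t, t ∈ s.tiles ∧ x ∈ cells t} := by
    ext s; simp [coverings, ExactCover]
  rw [this]
  exact isClosed_iInter isClosed_setOf_existsUnique

theorem eq_of_count_flatMap_eq_one {α β : Type*} [BEq β] [LawfulBEq β] {L : List α} {f : α → List β}
    {x : β} (h : (L.flatMap f).count x = 1) {s t : α} (hs : s ∈ L) (ht : t ∈ L) (hs' : x ∈ f s)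
    (ht' : x ∈ f t) : s = t := by
  induction L with
  | nil => simp at hs
  | cons a L ih =>
    rw [List.flatMap_cons, List.count_append] at h
    have key {t} (ht : t ∈ L) (ht' : x ∈ f t) : 0 < (L.flatMap f).count x :=
      List.count_pos_iff.2 (List.mem_flatMap.2 ⟨t, ht, ht'⟩)
    have key' {t} (e : t = a) (ht' : x ∈ f t) : 0 < (f a).count x :=
      List.count_pos_iff.2 (e ▸ ht')
    rcases List.mem_cons.1 hs with e | hs <;> rcases List.mem_cons.1 ht with e' | ht
    · rw [e, e']
    · have := key ht ht'; have := key' e hs'; omega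
    · have := key hs hs'; have := key' e' ht'; omega
    · exact ih (by have := key hs hs'; omega) hs ht

theorem nonempty_coverings : coverings.Nonempty := by
  classical
  let K (M : ℕ) : Set Config := ⋂ x : Cell, ⋂ _ : |x.1.1| ≤ M ∧ |x.1.2| ≤ M,
    {s : Config | ∃! t, t ∈ s.tiles ∧ x ∈ cells t}
  have hK (M : ℕ) : IsClosed (K M) :=
    isClosed_iInter fun x => isClosed_iInter fun _ => isClosed_setOf_existsUnique x
  have hne (M : ℕ) : (K M).Nonempty := by
    obtain ⟨L, hL⟩ := exists_patch M
    refine ⟨fun t => decide (t ∈ L), ?_⟩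
    simp only [K, Set.mem_iInter]
    intro x hx
    have h := hL x.1 hx x.2
    obtain ⟨t, ht, hxt⟩ := List.mem_flatMap.1 (List.count_pos_iff.1 (h ▸ one_pos))
    exact ⟨t, ⟨by simpa [Config.tiles] using ht, hxt⟩, fun t' ⟨ht', hxt'⟩ =>
      eq_of_count_flatMap_eq_one h (by simpa [Config.tiles] using ht') ht hxt' hxt⟩
  obtain ⟨s, hs⟩ := IsCompact.nonempty_iInter_of_sequence_nonempty_isCompact_isClosed K
    (fun M => by
      intro s hs
      simp only [K, Set.mem_iInter] at hs ⊢
      intro x hx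
      exact hs x ⟨hx.1.trans (by push_cast; omega), hx.2.trans (by push_cast; omega)⟩)
    hne (hK 0).isCompact hK
  refine ⟨s, fun x => ?_⟩
  have h := Set.mem_iInter.1 hs (x.1.1.natAbs + x.1.2.natAbs)
  simp only [K, Set.mem_iInter] at h
  exact h x ⟨by push_cast; simp, by push_cast; simp⟩

/-- A nonempty compact set with a free action of an infinite group is uncountable. -/
theorem not_countable_of_free {G Ω : Type*} [AddGroup G] [Infinite G] [TopologicalSpace Ω]
    [T2Space Ω] (T : G → Ω → Ω) (hT : ∀ g, Continuous (T g)) (hadd : ∀ g h x, T (g + h) x = T g (T h x))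
    (h0 : ∀ x, T 0 x = x) {X : Set Ω} (hX : IsCompact X) (hne : X.Nonempty)
    (hinv : ∀ g, ∀ x ∈ X, T g x ∈ X) (hfree : ∀ g, ∀ x ∈ X, T g x = x → g = 0) :
    ¬ X.Countable := by
  intro hc
  let F : Set (Set Ω) := {Y | IsClosed Y ∧ Y ⊆ X ∧ Y.Nonempty ∧ ∀ g, ∀ x ∈ Y, T g x ∈ Y}
  obtain ⟨Y, hYX, hY⟩ := zorn_superset_nonempty F (fun C hC hchain hCne => by
    refine ⟨⋂₀ C, ⟨isClosed_sInter fun Y hY => (hC hY).1, ?_, ?_, ?_⟩, fun Y => Set.sInter_subset_of_mem⟩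
    · obtain ⟨Y, hY⟩ := hCne
      exact (Set.sInter_subset_of_mem hY).trans (hC hY).2.1
    · have : Nonempty C := hCne.to_subtype
      exact IsCompact.nonempty_sInter_of_directed_nonempty_isCompact_isClosed (fun A hA B hB => (hchain.total hA hB).elim
          (fun h => ⟨A, hA, subset_rfl, h⟩) fun h => ⟨B, hB, h, subset_rfl⟩)
        (fun Y hY => (hC hY).2.2.1) (fun Y hY => hX.of_isClosed_subset (hC hY).1 (hC hY).2.1)
        (fun Y hY => (hC hY).1)
    · intro g x hx Y hY
      exact (hC hY).2.2.2 g x (hx Y hY)) X ⟨hX.isClosed, subset_rfl, hne, hinv⟩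
  obtain ⟨⟨hYc, -, hYne, hYinv⟩, hmin⟩ := hY
  have hYk : IsCompact Y := hX.of_isClosed_subset hYc hYX
  have : CompactSpace Y := isCompact_iff_compactSpace.1 hYk
  have : Nonempty Y := hYne.to_subtype
  have : Countable Y := (hc.mono hYX).to_subtype
  obtain ⟨y, hy⟩ := nonempty_interior_of_iUnion_of_closed (f := fun y : Y => {y})
    (fun _ => isClosed_singleton) (Set.iUnion_of_singleton _)
  have hy : IsOpen ({y} : Set Y) := by
    rw [← interior_eq_iff_isOpen]
    exact interior_subset.antisymm (by
      obtain ⟨z, hz⟩ := hy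
      have := interior_subset hz
      rw [Set.mem_singleton_iff] at this
      simpa [← this] using hz)
  obtain ⟨U, hU, hUy⟩ := isOpen_induced_iff.1 hy
  have hU1 (z : Ω) (hz : z ∈ Y) : z ∈ U ↔ z = y := by
    have := Set.ext_iff.1 hUy ⟨z, hz⟩
    simpa [Subtype.ext_iff] using this
  have hcov : Y ⊆ ⋃ g, T g ⁻¹' U := by
    by_contra hnot
    have hF : Y \ ⋃ g, T g ⁻¹' U ∈ F := by
      refine ⟨hYc.sdiff (isOpen_iUnion fun g => hU.preimage (hT g)),
        Set.sdiff_subset.trans hYX, Set.sdiff_nonempty.2 hnot, ?_⟩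
      rintro g x ⟨hx, hx'⟩
      refine ⟨hYinv g x hx, fun h => hx' ?_⟩
      obtain ⟨h, hh⟩ := Set.mem_iUnion.1 h
      refine Set.mem_iUnion.2 ⟨h + g, ?_⟩
      rwa [Set.mem_preimage, hadd]
    have h1 := hmin hF Set.sdiff_subset y.2
    refine h1.2 (Set.mem_iUnion.2 ⟨0, ?_⟩)
    rw [Set.mem_preimage, h0]
    exact (hU1 _ y.2).2 rfl
  obtain ⟨A, hA⟩ := hYk.elim_finite_subcover _ (fun g => hU.preimage (hT g)) hcov
  have hfin : Y.Finite := by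
    refine (A.finite_toSet.image fun g => T (-g) y).subset fun z hz => ?_
    have hz' := hA hz
    simp only [Set.mem_iUnion] at hz'
    obtain ⟨g, hg, hgz⟩ := hz'
    refine ⟨g, hg, ?_⟩
    have := (hU1 _ (hYinv g z hz)).1 hgz
    simp only
    rw [← this, ← hadd, neg_add_cancel, h0]
  have : Finite Y := hfin
  obtain ⟨g, h, hgh, he⟩ := Finite.exists_ne_map_eq_of_infinite
    (fun g : G => (⟨T g y, hYinv g y y.2⟩ : Y))
  simp only [Subtype.mk.injEq] at he
  have h1 := hfree (-h + g) y (hYX y.2) (by rw [hadd, he, ← hadd, neg_add_cancel, h0])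
  exact hgh (neg_add_eq_zero.1 h1).symm

/-- Translation of configurations. -/
def Config.shift (v : Eis) (s : Config) : Config := fun t => s (t.shift (-v))

theorem Tile.shift_shift (v w : Eis) (t : Tile) : (t.shift w).shift v = t.shift (v + w) := by
  simp [Tile.shift, add_assoc]

@[simp] theorem Tile.shift_zero (t : Tile) : t.shift 0 = t := by simp [Tile.shift]

theorem Config.mem_tiles_shift (v : Eis) (s : Config) (t : Tile) :
    t ∈ (s.shift v).tiles ↔ t.shift (-v) ∈ s.tiles := Iff.rfl

theorem shift_mem_coverings (v : Eis) {s : Config} (hs : s ∈ coverings) :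
    s.shift v ∈ coverings := by
  intro x
  obtain ⟨t, ⟨ht, hx⟩, hu⟩ := hs (x.1 - v, x.2)
  refine ⟨t.shift v, ⟨?_, mem_cells_shift.2 hx⟩, fun t' ⟨ht', hx'⟩ => ?_⟩
  · simpa [Config.mem_tiles_shift, Tile.shift_shift] using ht
  · have := hu (t'.shift (-v)) ⟨ht', mem_cells_shift.2 (by simpa using hx')⟩
    rw [← this, Tile.shift_shift, add_neg_cancel, Tile.shift_zero]

theorem not_countable_coverings
    (h : ∀ v : Eis, ∀ s ∈ coverings, s.shift v = s → v = 0) : ¬ coverings.Countable := by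
  refine not_countable_of_free Config.shift (fun v => ?_) (fun v w s => ?_) (fun s => ?_)
    isClosed_coverings.isCompact nonempty_coverings (fun v s => shift_mem_coverings v) h
  · unfold Config.shift
    fun_prop
  · funext t
    simp [Config.shift, Tile.shift_shift]
  · funext t
    simp [Config.shift]

end

section

open Finset

/-- Functions on the lattice of period `N` in both directions. -/
def BiPeriodic {α : Type*} (N : ℕ) (F : Eis → α) : Prop :=
  ∀ u, F (u + ((N : ℤ), 0)) = F u ∧ F (u + (0, (N : ℤ))) = F u

/-- The sum over a fundamental square. -/
def boxSum (N : ℕ) (F : Eis → ℤ) : ℤ := ∑ i ∈ range N, ∑ j ∈ range N, F (i, j)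

theorem sum_range_shift {N : ℕ} {f : ℤ → ℤ} (h : ∀ i, f (i + N) = f i) (d : ℤ) :
    ∑ i ∈ range N, f (i + d) = ∑ i ∈ range N, f i := by
  have step (d : ℤ) : ∑ i ∈ range N, f (i + (d + 1)) = ∑ i ∈ range N, f (i + d) := by
    have := Finset.sum_range_succ' (fun i : ℕ => f (i + d)) N
    rw [Finset.sum_range_succ] at this
    have h' := h d
    rw [add_comm] at h'
    push_cast at this
    rw [h', zero_add] at this
    rw [add_right_cancel this]
    exact Finset.sum_congr rfl fun i _ => by congr 1; ring
  induction d using Int.induction_on with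
  | zero => simp
  | succ d ih => rw [step, ih]
  | pred d ih => rw [← ih, ← step]; simp

theorem boxSum_shift {N : ℕ} {F : Eis → ℤ} (h : BiPeriodic N F) (d : Eis) :
    boxSum N (fun u => F (u + d)) = boxSum N F := by
  have h1 (i : ℤ) : ∑ j ∈ range N, F (i, j + d.2) = ∑ j ∈ range N, F (i, j) :=
    sum_range_shift (f := fun j => F (i, j)) (fun j => by simpa using (h (i, j)).2) d.2
  have h2 := sum_range_shift (N := N) (f := fun i => ∑ j ∈ range N, F (i, j))
    (fun i => Finset.sum_congr rfl fun j _ => by simpa using (h (i, j)).1) d.1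
  rw [boxSum, boxSum, ← h2]
  exact Finset.sum_congr rfl fun i _ => h1 (i + d.1)

theorem boxSum_add (N : ℕ) (F G : Eis → ℤ) :
    boxSum N (fun u => F u + G u) = boxSum N F + boxSum N G := by
  simp [boxSum, Finset.sum_add_distrib]

theorem boxSum_sub (N : ℕ) (F G : Eis → ℤ) :
    boxSum N (fun u => F u - G u) = boxSum N F - boxSum N G := by
  simp [boxSum, Finset.sum_sub_distrib]

theorem boxSum_sum {ι : Type*} (s : Finset ι) (N : ℕ) (F : ι → Eis → ℤ) :
    boxSum N (fun u => ∑ i ∈ s, F i u) = ∑ i ∈ s, boxSum N (F i) := by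
  simp only [boxSum]
  calc _ = ∑ i ∈ range N, ∑ k ∈ s, ∑ j ∈ range N, F k (i, j) :=
        Finset.sum_congr rfl fun i _ => Finset.sum_comm
    _ = _ := Finset.sum_comm

theorem boxSum_mul (N : ℕ) (F : Eis → ℤ) (c : ℤ) :
    boxSum N (fun u => F u * c) = boxSum N F * c := by
  simp [boxSum, Finset.sum_mul]

/-- The determinant of two integer vectors. -/
def wedge (a b : ℤ × ℤ) : ℤ := a.1 * b.2 - a.2 * b.1

theorem wedge_sum_right {ι : Type*} (s : Finset ι) (a : ℤ × ℤ) (f : ι → ℤ × ℤ) :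
    ∑ i ∈ s, wedge a (f i) = wedge a (∑ i ∈ s, f i) := by
  simp [wedge, Finset.sum_sub_distrib, Finset.mul_sum, Prod.fst_sum, Prod.snd_sum]

/-- The area of a closed polygonal torus, computed from its periods. -/
theorem boxSum_wedge {N : ℕ} {h₁ h₂ : Eis → ℤ × ℤ} (p₁ : BiPeriodic N h₁) (p₂ : BiPeriodic N h₂)
    (hc : ∀ u, h₁ u + h₂ (u + (1, 0)) = h₂ u + h₁ (u + (0, 1))) :
    boxSum N (fun u => wedge (h₁ u) (h₂ u) + wedge (h₁ (u + (0, 1))) (h₂ (u + (1, 0)))) =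
      2 * wedge (∑ i ∈ range N, h₁ (i, 0)) (∑ j ∈ range N, h₂ (0, j)) := by
  set s := ∑ i ∈ range N, h₁ (i, 0)
  set t := ∑ j ∈ range N, h₂ (0, j)
  let φ (i j : ℕ) : ℤ × ℤ := ∑ i' ∈ range i, h₁ (i', 0) + ∑ j' ∈ range j, h₂ (i, j')
  have hφ₂ (i j : ℕ) : φ i (j + 1) = φ i j + h₂ (i, j) := by
    simp only [φ, Finset.sum_range_succ, add_assoc]
  have hφ₁ (i j : ℕ) : φ (i + 1) j = φ i j + h₁ (i, j) := by
    induction j with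
    | zero => simp [φ, Finset.sum_range_succ]
    | succ j ih =>
      have := hc (i, j)
      simp only [Prod.mk_add_mk, add_zero] at this
      rw [hφ₂, hφ₂, ih, add_assoc, add_assoc (φ i j)]
      push_cast
      rw [this]
  have hN₁ (j : ℕ) : φ N j = s + φ 0 j := by
    simp only [φ, s, Finset.range_zero, Finset.sum_empty, zero_add]
    congr 1
    refine Finset.sum_congr rfl fun j' _ => ?_
    simpa using (p₂ (0, j')).1
  have hN₂ (i : ℕ) : φ i N = t + φ i 0 := by
    induction i with
    | zero => simp [φ, t]
    | succ i ih =>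
      have := (p₁ (i, 0)).2
      simp only [Prod.mk_add_mk, add_zero, zero_add] at this
      rw [hφ₁, hφ₁, ih, this]
      simp [add_assoc]
  let A (i j : ℕ) : ℤ := wedge (φ i j) (h₁ (i, j))
  let B (i j : ℕ) : ℤ := wedge (φ i j) (h₂ (i, j))
  have key (i j : ℕ) : wedge (h₁ (i, j)) (h₂ (i, j)) + 
      wedge (h₁ (((i, j) : Eis) + (0, 1))) (h₂ (((i, j) : Eis) + (1, 0))) = (B (i + 1) j - B i j) - (A i (j + 1) - A i j) := by
    have e := hc (i, j)
    simp only [A, B, hφ₁, hφ₂]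
    simp only [Prod.mk_add_mk, add_zero, Nat.cast_add, Nat.cast_one] at e ⊢
    have e1 := congrArg Prod.fst e
    have e2 := congrArg Prod.snd e
    simp only [Prod.fst_add, Prod.snd_add] at e1 e2
    simp only [wedge, Prod.fst_add, Prod.snd_add]
    have e1' : (h₁ (i, j + 1)).1 = (h₁ (i, j)).1 + (h₂ (i + 1, j)).1 - (h₂ (i, j)).1 := by linarith
    have e2' : (h₁ (i, j + 1)).2 = (h₁ (i, j)).2 + (h₂ (i + 1, j)).2 - (h₂ (i, j)).2 := by linarith
    rw [e1', e2']
    ring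
  simp only [boxSum, key, Finset.sum_sub_distrib]
  rw [Finset.sum_comm]
  have hB (j : ℕ) : ∑ i ∈ range N, B (i + 1) j - ∑ i ∈ range N, B i j = wedge s (h₂ (0, j)) := by
    rw [← Finset.sum_sub_distrib, Finset.sum_range_sub (fun i => B i j)]
    have := (p₂ (0, j)).1
    simp only [Prod.mk_add_mk, add_zero, zero_add] at this
    simp only [B, hN₁, this, wedge, Prod.fst_add, Prod.snd_add, Nat.cast_zero]
    ring
  have hA (i : ℕ) : ∑ j ∈ range N, A i (j + 1) - ∑ j ∈ range N, A i j = wedge t (h₁ (i, 0)) := by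
    rw [← Finset.sum_sub_distrib, Finset.sum_range_sub (fun j => A i j)]
    have := (p₁ (i, 0)).2
    simp only [Prod.mk_add_mk, add_zero, zero_add] at this
    simp only [A, hN₂, this, wedge, Prod.fst_add, Prod.snd_add, Nat.cast_zero]
    ring
  rw [Finset.sum_comm (f := fun i j => B i j)]
  simp only [← Finset.sum_sub_distrib]
  simp only [Finset.sum_sub_distrib]
  rw [← Finset.sum_sub_distrib, Finset.sum_congr rfl fun j _ => hB j, ← Finset.sum_sub_distrib,
    Finset.sum_congr rfl fun i _ => hA i, wedge_sum_right, wedge_sum_right]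
  change wedge s t - wedge t s = _
  simp only [wedge]
  ring

/-- The total signed area of the images of all kites, in terms of the differences `X u k` from the
center to the midpoint and `B u k` from the center to the vertex. -/
theorem boxSum_area {N : ℕ} {X B : Eis → Fin 6 → ℤ × ℤ} (pX : BiPeriodic N X) (pB : BiPeriodic N B)
    (h : ∀ u k, X u (k - 1) - B u k =
      X (u + rotn (k - 1) (1, 0)) (k + 2) - B (u + rotn (k - 1) (1, 0)) (k + 2)) :
    boxSum N (fun u => ∑ k, (wedge (X u (k - 1)) (B u k) + wedge (B u k) (X u k))) =
      2 * wedge (∑ i ∈ range N, (X ((i, 0) : Eis) 0 - X (((i, 0) : Eis) + (1, 0)) 3))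
        (∑ j ∈ range N, (X ((0, j) : Eis) 1 - X (((0, j) : Eis) + (0, 1)) 4)) := by
  have shift {α : Type} {F : Eis → α} (pF : BiPeriodic N F) (d : Eis) :
      BiPeriodic N fun u => F (u + d) := fun u => by
    have := pF (u + d)
    rwa [add_right_comm, add_right_comm _ d] at this
  have papp {F : Eis → Fin 6 → ℤ × ℤ} (pF : BiPeriodic N F) (k : Fin 6) :
      BiPeriodic N fun u => F u k := fun u => by
    simp only [(pF u).1, (pF u).2, and_self]
  let h₁ (u : Eis) := X u 0 - X (u + (1, 0)) 3
  let h₂ (u : Eis) := X u 1 - X (u + (0, 1)) 4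
  let h₃ (u : Eis) := X u 2 - X (u + (-1, 1)) 5
  have p₁ : BiPeriodic N h₁ := fun u => by
    have := papp (shift pX (1, 0)) 3 u
    simp only [h₁, this.1, this.2, (pX u).1, (pX u).2, and_self]
  have p₂ : BiPeriodic N h₂ := fun u => by
    have := papp (shift pX (0, 1)) 4 u
    simp only [h₂, this.1, this.2, (pX u).1, (pX u).2, and_self]
  have p₃ : BiPeriodic N h₃ := fun u => by
    have := papp (shift pX (-1, 1)) 5 u
    simp only [h₃, this.1, this.2, (pX u).1, (pX u).2, and_self]
  have pw {F G : Eis → ℤ × ℤ} (pF : BiPeriodic N F) (pG : BiPeriodic N G) :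
      BiPeriodic N fun u => wedge (F u) (G u) := fun u => by
    simp only [(pF u).1, (pF u).2, (pG u).1, (pG u).2, and_self]
  let A (u : Eis) (k : Fin 6) : ℤ := wedge (X u (k - 1)) (B u k) + wedge (B u k) (X u k)
  have pA (k : Fin 6) : BiPeriodic N fun u => A u k := fun u => by
    simp only [A, (pX u).1, (pX u).2, (pB u).1, (pB u).2, and_self]
  have e (u : Eis) : (u + (1, 0)) + (-1, 1) = u + (0, 1) := by ext <;> simp
  have e' (u : Eis) : (u + (1, 1)) + (-1, 0) = u + (0, 1) := by ext <;> simp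
  have e₁ (u : Eis) : (u + (1, 0)) + (0, 1) = u + (1, 1) := by ext <;> simp
  have e₂ (u : Eis) : (u + (0, 1)) + (1, 0) = u + (1, 1) := by ext <;> simp
  have e₃ (u : Eis) : (u + (0, 1)) + (1, -1) = u + (1, 0) := by ext <;> simp
  have e₄ (u : Eis) : (u + (0, 1)) + (0, -1) = u := by ext <;> simp
  have hup (u : Eis) : A u 1 + A (u + (1, 0)) 3 + A (u + (0, 1)) 5 = wedge (h₁ u) (h₂ u) +
      wedge (X u 0) (h₁ u) - wedge (X u 1) (h₂ u) + wedge (X (u + (1, 0)) 2) (h₃ (u + (1, 0))) := by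
    have r1 := h u 1
    have r3 := h (u + (1, 0)) 3
    have r5 := h (u + (0, 1)) 5
    simp only [show (3 - 1 : Fin 6) = 2 from rfl, show (5 - 1 : Fin 6) = 4 from rfl,
      show (1 - 1 : Fin 6) = 0 from rfl, show (1 + 2 : Fin 6) = 3 from rfl,
      show (3 + 2 : Fin 6) = 5 from rfl, show (5 + 2 : Fin 6) = 1 from rfl,
      show rotn 2 (1, 0) = (-1, 1) from rfl, show rotn 0 (1, 0) = (1, 0) from rfl,
      show rotn 4 (1, 0) = (0, -1) from rfl, e, e₄] at r1 r3 r5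
    have x3 : X (u + (1, 0)) 3 = X u 0 - B u 1 + B (u + (1, 0)) 3 := by rw [r1]; abel
    have x5 : X (u + (0, 1)) 5 = X (u + (1, 0)) 2 - B (u + (1, 0)) 3 + B (u + (0, 1)) 5 := by
      rw [r3]; abel
    have x4 : X (u + (0, 1)) 4 = X u 1 - B u 1 + B (u + (0, 1)) 5 := by rw [← r5]; abel
    simp only [A, h₁, h₂, h₃, e, show (3 - 1 : Fin 6) = 2 from rfl,
      show (5 - 1 : Fin 6) = 4 from rfl, show (1 - 1 : Fin 6) = 0 from rfl, x3, x4, x5, wedge,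
      Prod.fst_add, Prod.snd_add, Prod.fst_sub, Prod.snd_sub]
    ring
  have hdown (u : Eis) : A (u + (1, 0)) 2 + A (u + (1, 1)) 4 + A (u + (0, 1)) 0 =
      wedge (h₁ (u + (0, 1))) (h₂ (u + (1, 0))) + wedge (X (u + (1, 0)) 1) (h₂ (u + (1, 0))) -
      wedge (X (u + (0, 1)) 0) (h₁ (u + (0, 1))) -
      wedge (X (u + (1, 0)) 2) (h₃ (u + (1, 0))) := by
    have r2 := h (u + (1, 0)) 2
    have r4 := h (u + (1, 1)) 4
    have r0 := h (u + (0, 1)) 0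
    simp only [show (2 - 1 : Fin 6) = 1 from rfl, show (4 - 1 : Fin 6) = 3 from rfl,
      show (0 - 1 : Fin 6) = 5 from rfl, show (2 + 2 : Fin 6) = 4 from rfl,
      show (4 + 2 : Fin 6) = 0 from rfl, show (0 + 2 : Fin 6) = 2 from rfl,
      show rotn 1 (1, 0) = (0, 1) from rfl, show rotn 3 (1, 0) = (-1, 0) from rfl,
      show rotn 5 (1, 0) = (1, -1) from rfl, e', e₁, e₃] at r2 r4 r0
    have x4 : X (u + (1, 1)) 4 = X (u + (1, 0)) 1 - B (u + (1, 0)) 2 + B (u + (1, 1)) 4 := by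
      rw [r2]; abel
    have x3 : X (u + (1, 1)) 3 = X (u + (0, 1)) 0 - B (u + (0, 1)) 0 + B (u + (1, 1)) 4 := by
      rw [← r4]; abel
    have x5 : X (u + (0, 1)) 5 = X (u + (1, 0)) 2 - B (u + (1, 0)) 2 + B (u + (0, 1)) 0 := by
      rw [← r0]; abel
    simp only [A, h₁, h₂, h₃, e, e₁, e₂, show (2 - 1 : Fin 6) = 1 from rfl,
      show (4 - 1 : Fin 6) = 3 from rfl, show (0 - 1 : Fin 6) = 5 from rfl, x3, x4, x5, wedge,
      Prod.fst_add, Prod.snd_add, Prod.fst_sub, Prod.snd_sub]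
    ring
  have hc (u : Eis) : h₁ u + h₂ (u + (1, 0)) = h₂ u + h₁ (u + (0, 1)) := by
    have r1 := h u 1
    have r5 := h (u + (0, 1)) 5
    have r2 := h (u + (1, 0)) 2
    have r4 := h (u + (1, 1)) 4
    have r3 := h (u + (1, 0)) 3
    have r0 := h (u + (0, 1)) 0
    simp only [show (5 - 1 : Fin 6) = 4 from rfl, show (3 - 1 : Fin 6) = 2 from rfl,
      show (1 - 1 : Fin 6) = 0 from rfl, show (1 + 2 : Fin 6) = 3 from rfl,
      show (5 + 2 : Fin 6) = 1 from rfl, show (3 + 2 : Fin 6) = 5 from rfl,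
      show (0 - 1 : Fin 6) = 5 from rfl, show (0 + 2 : Fin 6) = 2 from rfl,
      show rotn 2 (1, 0) = (-1, 1) from rfl, show rotn 5 (1, 0) = (1, -1) from rfl,
      show rotn 0 (1, 0) = (1, 0) from rfl, show rotn 4 (1, 0) = (0, -1) from rfl, e₄,
      show (2 - 1 : Fin 6) = 1 from rfl, show (4 - 1 : Fin 6) = 3 from rfl,
      show (2 + 2 : Fin 6) = 4 from rfl, show (4 + 2 : Fin 6) = 0 from rfl,
      show rotn 1 (1, 0) = (0, 1) from rfl, show rotn 3 (1, 0) = (-1, 0) from rfl, e, e₃, e', e₁]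
      at r1 r5 r2 r4 r3 r0
    simp only [h₁, h₂, e₁, e₂]
    rw [← sub_eq_zero] at r1 r5 r2 r4 r3 r0 ⊢
    have : X u 0 - X (u + (1, 0)) 3 + (X (u + (1, 0)) 1 - X (u + (1, 1)) 4) - (X u 1 -
      X (u + (0, 1)) 4 + (X (u + (0, 1)) 0 - X (u + (1, 1)) 3)) =
      (X u 0 - B u 1 - (X (u + (1, 0)) 3 - B (u + (1, 0)) 3)) +
      (X (u + (0, 1)) 4 - B (u + (0, 1)) 5 - (X u 1 - B u 1)) +
      (X (u + (1, 0)) 1 - B (u + (1, 0)) 2 - (X (u + (1, 1)) 4 - B (u + (1, 1)) 4)) +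
      (X (u + (1, 1)) 3 - B (u + (1, 1)) 4 - (X (u + (0, 1)) 0 - B (u + (0, 1)) 0)) +
      (X (u + (1, 0)) 2 - B (u + (1, 0)) 3 - (X (u + (0, 1)) 5 - B (u + (0, 1)) 5)) +
      (X (u + (0, 1)) 5 - B (u + (0, 1)) 0 - (X (u + (1, 0)) 2 - B (u + (1, 0)) 2)) := by abel
    rw [this, r1, r5, r2, r4, r3, r0]
    simp
  rw [← boxSum_wedge p₁ p₂ hc]
  let G₀ (u : Eis) := wedge (X u 0) (h₁ u)
  let G₁ (u : Eis) := wedge (X u 1) (h₂ u)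
  have g₀ : BiPeriodic N G₀ := pw (papp pX 0) p₁
  have g₁ : BiPeriodic N G₁ := pw (papp pX 1) p₂
  have s₀ := boxSum_shift g₀ (0, 1)
  have s₁ := boxSum_shift g₁ (1, 0)
  have total : boxSum N (fun u => ∑ k, A u k) = boxSum N (fun u =>
      (A u 1 + A (u + (1, 0)) 3 + A (u + (0, 1)) 5) +
      (A (u + (1, 0)) 2 + A (u + (1, 1)) 4 + A (u + (0, 1)) 0)) := by
    simp only [Fin.sum_univ_six, boxSum_add]
    rw [boxSum_shift (pA 3), boxSum_shift (pA 5), boxSum_shift (pA 2), boxSum_shift (pA 4),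
      boxSum_shift (pA 0)]
    ring
  change boxSum N (fun u => ∑ k, A u k) = _
  rw [total]
  have : (fun u => (A u 1 + A (u + (1, 0)) 3 + A (u + (0, 1)) 5) +
      (A (u + (1, 0)) 2 + A (u + (1, 1)) 4 + A (u + (0, 1)) 0)) = fun u =>
      (wedge (h₁ u) (h₂ u) + wedge (h₁ (u + (0, 1))) (h₂ (u + (1, 0)))) +
      ((G₀ u - G₀ (u + (0, 1))) + (G₁ (u + (1, 0)) - G₁ u)) := by
    funext u
    rw [hup, hdown]
    simp only [G₀, G₁]
    ring
  rw [this, boxSum_add N (fun u => wedge (h₁ u) (h₂ u) + wedge (h₁ (u + (0, 1))) (h₂ (u + (1, 0)))),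
    boxSum_add N (fun u => G₀ u - G₀ (u + (0, 1))), boxSum_sub, boxSum_sub, s₀, s₁]
  ring

/-- The form `x² + xy + y²` is never twice a square, even after multiplication by `9`. -/
theorem two_mul_sq_ne {n : ℕ} (hn : 0 < n) (a b : ℤ) :
    2 * (n : ℤ) ^ 2 ≠ 9 * (a ^ 2 + a * b + b ^ 2) := by
  induction n using Nat.strong_induction_on generalizing a b with
  | _ n ih =>
    intro h
    have h2 : (2 : ℤ) ∣ a ^ 2 + a * b + b ^ 2 := by omega
    have hab : (2 : ℤ) ∣ a ∧ (2 : ℤ) ∣ b := by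
      rcases Int.even_or_odd' a with ⟨x, rfl | rfl⟩ <;> rcases Int.even_or_odd' b with ⟨y, rfl | rfl⟩
      · simp
      all_goals
        exfalso
        ring_nf at h2
        have hx : x * y * 4 = 2 * (x * y * 2) := by ring
        omega
    obtain ⟨⟨x, rfl⟩, y, rfl⟩ := hab
    have h3 : (n : ℤ) ^ 2 = 2 * (9 * (x ^ 2 + x * y + y ^ 2)) := by linarith
    have h4 : (2 : ℤ) ∣ n := Int.prime_two.dvd_of_dvd_pow (Dvd.intro _ h3.symm)
    obtain ⟨m, rfl⟩ : 2 ∣ n := by exact_mod_cast h4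
    push_cast at h3
    exact ih m (by omega) (by omega) x y (by linarith)

/-- The position of a cell within a tile: orientation and reflection of the tile, and the index of
the cell in the tile. -/
abbrev Slot : Type := (Fin 6 × Bool) × Fin 8

def Slot.cell (s : Slot) : Cell := Kite.act 0 s.1.1 ((hatCells s.1.2).getD s.2 0)

theorem mem_cells_iff_slot {t : Tile} {x : Cell} :
    x ∈ cells t ↔ ∃ i, t.1 + (Slot.cell (t.2, i)).1 = x.1 ∧ (Slot.cell (t.2, i)).2 = x.2 := by
  have h : ∀ m, ∀ y : Cell, y ∈ hatCells m ↔ ∃ i : Fin 8, (hatCells m).getD i 0 = y := by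
    intro m y
    rw [List.mem_iff_getElem]
    have hl : (hatCells m).length = 8 := by cases m <;> rfl
    constructor
    · rintro ⟨i, hi, rfl⟩
      exact ⟨⟨i, by omega⟩, by simp [hi]⟩
    · rintro ⟨i, rfl⟩
      exact ⟨i, by omega, by simp [hl]⟩
  rw [mem_cells_iff]
  simp only [h]
  constructor
  · rintro ⟨_, ⟨i, rfl⟩, rfl⟩
    exact ⟨i, by simp [Slot.cell, Kite.act]⟩
  · rintro ⟨i, h1, h2⟩
    exact ⟨_, ⟨i, rfl⟩, by ext1 <;> simp [Slot.cell, Kite.act, ← h1, ← h2]⟩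

theorem Slot.cell_injective (t : Fin 6 × Bool) : Function.Injective fun i => Slot.cell (t, i) := by
  have : ∀ t, ∀ i j : Fin 8, Slot.cell (t, i) = Slot.cell (t, j) → i = j := by decide +kernel
  exact this t

theorem ExactCover.exists_slot {S : Set Tile} (hS : ExactCover S) :
    ∃ f : Cell → Slot, ∀ x s, f x = s ↔ s.cell.2 = x.2 ∧ (x.1 - s.cell.1, s.1) ∈ S := by
  have h (x : Cell) : ∃ s₀ : Slot, ∀ s : Slot,
      s₀ = s ↔ s.cell.2 = x.2 ∧ (x.1 - s.cell.1, s.1) ∈ S := by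
    obtain ⟨t, ⟨htS, htx⟩, hu⟩ := hS x
    obtain ⟨i, h1, h2⟩ := mem_cells_iff_slot.1 htx
    refine ⟨(t.2, i), fun s => ⟨?_, ?_⟩⟩
    · rintro rfl
      refine ⟨h2, ?_⟩
      rw [← h1]
      simpa using htS
    · rintro ⟨h3, h4⟩
      have := hu _ ⟨h4, mem_cells_iff_slot.2 ⟨s.2, by simp, h3⟩⟩
      have e2 : s.1 = t.2 := congrArg Prod.snd this
      have e1 : x.1 - s.cell.1 = t.1 := congrArg Prod.fst this
      refine Prod.ext e2.symm (Slot.cell_injective t.2 ?_)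
      have e : (t.2, s.2) = s := by rw [← e2]
      simp only [e]
      ext1
      · rw [← add_right_inj t.1, h1, ← e1]; abel
      · rw [h2, h3]
  choose f hf using h
  exact ⟨f, hf⟩

/-- A locally checked relation between data on neighbouring cells holds globally. -/
theorem eq_of_local {α : Type*} {S : Set Tile} {f : Cell → Slot}
    (hf : ∀ x s, f x = s ↔ s.cell.2 = x.2 ∧ (x.1 - s.cell.1, s.1) ∈ S)
    {δ : Fin 6 → Eis} {c : Fin 6} {F G : Slot → α} {bd : Fin 6 → α}
    (h₁ : ∀ s : Slot, (∃ i, Slot.cell (s.1, i) = (s.cell.1 + δ s.cell.2, s.cell.2 + c) ∧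
      F s = G (s.1, i)) ∨ F s = bd s.cell.2)
    (h₂ : ∀ s : Slot, (∃ i, s.cell = ((Slot.cell (s.1, i)).1 + δ (Slot.cell (s.1, i)).2,
      (Slot.cell (s.1, i)).2 + c) ∧ F (s.1, i) = G s) ∨ G s = bd (s.cell.2 - c)) (x : Cell) :
    F (f x) = G (f (x.1 + δ x.2, x.2 + c)) := by
  obtain ⟨hx, hxS⟩ := (hf x _).1 rfl
  rcases h₁ (f x) with ⟨i, hi, e⟩ | e
  · rw [e]
    congr 1
    refine ((hf _ _).2 ?_).symm
    rw [hi]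
    refine ⟨by rw [hx], ?_⟩
    simp only [hx]
    simpa using hxS
  set y := f (x.1 + δ x.2, x.2 + c) with hy
  obtain ⟨hy1, hyS⟩ := (hf _ y).1 hy.symm
  rcases h₂ y with ⟨i, hi, e'⟩ | e'
  · rw [← e']
    congr 1
    refine (hf _ _).2 ?_
    have hk : (Slot.cell (y.1, i)).2 = x.2 := by
      have := congrArg Prod.snd hi
      rw [hy1] at this
      exact (add_right_cancel this).symm
    refine ⟨hk, ?_⟩
    have h3 := congrArg Prod.fst hi
    simp only [hk] at h3
    rw [h3] at hyS
    simpa using hyS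
  · rw [e, e', hx, hy1]
    simp

/-- Integer vectors with coordinates for the six edge directions of the tile. -/
abbrev Vec : Type := Fin 6 → ℤ

def rotV (v : Vec) : Vec := ![-v 2, v 0, v 1, -v 5, v 3, v 4]
def conjV (v : Vec) : Vec := ![v 0, -v 2, -v 1, -v 5, -v 4, -v 3]

/-- For each cell of the tile: formal displacements along the boundary of the tile, from the center
of the cell to the first midpoint, the vertex and the second midpoint of the cell. -/
def hatData : Fin 8 → Vec × Vec × Vec :=
  ![(![0, 0, 0, 1, 0, 0], ![1, 0, 0, 0, 1, 0], ![0, 0, 0, 0, 1, 0]),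
    (![0, 0, 0, -1, 0, 0], ![0, 0, -1, -1, 0, 0], ![1, 0, -1, -1, 0, 0]),
    (![1, 0, -1, -1, 0, 0], ![2, 0, -1, -1, 0, 0], ![2, 1, -1, -1, 0, 0]),
    (![2, 1, -1, -1, 0, 0], ![2, 0, 0, 0, 0, 0], ![0, 0, 0, 1, 0, 0]),
    (![0, 0, 0, 1, 0, 0], ![0, 0, 1, 1, 0, 0], ![-1, 0, 1, 1, 0, 0]),
    (![-1, 0, 1, 1, 0, 0], ![0, -1, 1, 1, 0, 1], ![0, 0, 0, 0, 0, 1]),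
    (![0, 0, 0, 0, 0, 1], ![0, -1, 0, 0, 0, 1], ![-1, -1, 0, 1, -1, 1]),
    (![-1, -1, 0, 1, -1, 1], ![1, -1, 0, 0, -1, 1], ![0, 0, 0, 0, -1, 0])]

namespace Slot

def first (s : Slot) : Vec :=
  rotV^[s.1.1.val] (if s.1.2 then conjV (hatData s.2).2.2 else (hatData s.2).1)
def vertex (s : Slot) : Vec :=
  rotV^[s.1.1.val] (if s.1.2 then conjV (hatData s.2).2.1 else (hatData s.2).2.1)
def second (s : Slot) : Vec :=
  rotV^[s.1.1.val] (if s.1.2 then conjV (hatData s.2).1 else (hatData s.2).2.2)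

/-- Twice the signed area of the image of a cell under projection to two coordinates. -/
def area (s : Slot) (i j : Fin 6) : ℤ :=
  wedge (s.first i, s.first j) (s.vertex i, s.vertex j) +
    wedge (s.vertex i, s.vertex j) (s.second i, s.second j)

end Slot

/-- Twice the signed area of the image of a tile under projection to two coordinates. -/
def tileArea (t : Fin 6 × Bool) (i j : Fin 6) : ℤ := ∑ n, Slot.area (t, n) i j

theorem second_local (s : Slot) :
    (∃ i, Slot.cell (s.1, i) = (s.cell.1 + 0, s.cell.2 + 1) ∧ s.second = Slot.first (s.1, i)) ∨
      s.second = rotV^[s.cell.2.val] ![0, 0, 0, 1, 0, 0] := by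
  revert s; decide +kernel

theorem first_local (s : Slot) :
    (∃ i, s.cell = ((Slot.cell (s.1, i)).1 + 0, (Slot.cell (s.1, i)).2 + 1) ∧
      Slot.second (s.1, i) = s.first) ∨
      s.first = rotV^[(s.cell.2 - 1).val] ![0, 0, 0, 1, 0, 0] := by
  revert s; decide +kernel

theorem first_sub_vertex_local (s : Slot) :
    (∃ i, Slot.cell (s.1, i) = (s.cell.1 + rotn (s.cell.2 - 1) (1, 0), s.cell.2 + 2) ∧
      s.first - s.vertex = Slot.second (s.1, i) - Slot.vertex (s.1, i)) ∨
      s.first - s.vertex = rotV^[s.cell.2.val] ![0, -1, 0, 0, 0, 0] := by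
  revert s; decide +kernel

theorem second_sub_vertex_local (s : Slot) :
    (∃ i, s.cell = ((Slot.cell (s.1, i)).1 + rotn ((Slot.cell (s.1, i)).2 - 1) (1, 0),
        (Slot.cell (s.1, i)).2 + 2) ∧
      Slot.first (s.1, i) - Slot.vertex (s.1, i) = s.second - s.vertex) ∨
      s.second - s.vertex = rotV^[(s.cell.2 - 2).val] ![0, -1, 0, 0, 0, 0] := by
  revert s; decide +kernel

/-- Sums over cells can be computed tile by tile. -/
theorem boxSum_slot {S : Set Tile} {f : Cell → Slot} [DecidablePred (· ∈ S)]
    (hf : ∀ x s, f x = s ↔ s.cell.2 = x.2 ∧ (x.1 - s.cell.1, s.1) ∈ S)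
    {N : ℕ} (hp : ∀ t, BiPeriodic N fun u => (u, t) ∈ S) (W : Slot → ℤ) :
    boxSum N (fun u => ∑ k, W (f (u, k))) =
      ∑ t, boxSum N (fun u => if (u, t) ∈ S then 1 else 0) * ∑ i, W (t, i) := by
  have h (u : Eis) : ∑ k, W (f (u, k)) =
      ∑ s : Slot, (if (u - s.cell.1, s.1) ∈ S then 1 else 0) * W s := by
    have (k : Fin 6) : W (f (u, k)) = ∑ s : Slot, if f (u, k) = s then W s else 0 := by simp
    simp only [this, hf]
    rw [Finset.sum_comm]
    refine Finset.sum_congr rfl fun s _ => ?_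
    simp only [ite_and]
    rw [Finset.sum_ite_eq]
    simp
  simp only [h, boxSum_sum, boxSum_mul]
  rw [Fintype.sum_prod_type]
  refine Finset.sum_congr rfl fun t _ => ?_
  rw [Finset.mul_sum]
  refine Finset.sum_congr rfl fun i _ => ?_
  congr 1
  have p : BiPeriodic N fun u => if (u, t) ∈ S then (1 : ℤ) else 0 := fun u => by
    have := hp t u
    simp only [this.1, this.2, and_self]
  simpa [sub_eq_add_neg] using boxSum_shift p (-(Slot.cell (t, i)).1)

theorem false_of_pluecker (a b : Fin 6 → ℤ) {m : ℕ} (hm : 0 < m) (q : Fin 6 → Fin 6 → ℤ)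
    (hq : ∀ i j, q i j = a i * b j - a j * b i)
    (R : ∀ j ∈ ({3, 4, 5} : Finset (Fin 6)), q 0 j - q 1 j + q 2 j = 0)
    (T : ∀ i ∈ ({0, 1, 2} : Finset (Fin 6)), q i 3 - q i 4 + q i 5 = 0)
    (P : q 0 1 + q 1 2 + q 0 2 = 4 * m) (Q : q 3 4 + q 4 5 + q 3 5 = 2 * m)
    (U : q 0 3 - q 2 5 = q 0 2 - q 1 2) (W : q 0 5 + q 2 3 + q 2 5 = q 2 0 - q 1 0) : False := by
  have nz {x : ℤ} (h : x * m = 0) : x = 0 := (mul_eq_zero.1 h).resolve_right (by positivity)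
  have R₃ := R 3 (by simp)
  have R₄ := R 4 (by simp)
  have R₅ := R 5 (by simp)
  have T₀ := T 0 (by simp)
  have T₁ := T 1 (by simp)
  have T₂ := T 2 (by simp)
  simp only [hq] at *
  have ra : a 0 - a 1 + a 2 = 0 := nz <| mul_left_cancel₀ (two_ne_zero' ℤ) (by
    linear_combination -(a 0 - a 1 + a 2) * Q + (a 3 * R₄ - a 4 * R₃) + (a 4 * R₅ - a 5 * R₄) +
      (a 3 * R₅ - a 5 * R₃))
  have rb : b 0 - b 1 + b 2 = 0 := nz <| mul_left_cancel₀ (two_ne_zero' ℤ) (by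
    linear_combination -(b 0 - b 1 + b 2) * Q + (b 3 * R₄ - b 4 * R₃) + (b 4 * R₅ - b 5 * R₄) +
      (b 3 * R₅ - b 5 * R₃))
  have ta : a 3 - a 4 + a 5 = 0 := nz <| mul_left_cancel₀ (four_ne_zero' ℤ) (by
    linear_combination -(a 3 - a 4 + a 5) * P + (a 1 * T₀ - a 0 * T₁) + (a 2 * T₁ - a 1 * T₂) +
      (a 2 * T₀ - a 0 * T₂))
  have tb : b 3 - b 4 + b 5 = 0 := nz <| mul_left_cancel₀ (four_ne_zero' ℤ) (by
    linear_combination -(b 3 - b 4 + b 5) * P + (b 1 * T₀ - b 0 * T₁) + (b 2 * T₁ - b 1 * T₂) +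
      (b 2 * T₀ - b 0 * T₂))
  have ra' : a 1 = a 0 + a 2 := by linarith
  have rb' : b 1 = b 0 + b 2 := by linarith
  have ta' : a 4 = a 3 + a 5 := by linarith
  have tb' : b 4 = b 3 + b 5 := by linarith
  rw [ra', rb'] at P U W
  rw [ta', tb'] at Q
  set x := a 0 * b 3 - a 3 * b 0 with hx
  set y := a 0 * b 5 - a 5 * b 0 with hy
  have P' : 3 * (a 0 * b 2 - a 2 * b 0) = 4 * m := by linarith
  have Q' : 3 * (a 3 * b 5 - a 5 * b 3) = 2 * m := by linarith
  have d : a 2 * b 5 - a 5 * b 2 = x := by linarith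
  have c : a 2 * b 3 - a 3 * b 2 = -x - y := by linarith
  refine two_mul_sq_ne (n := 2 * m) (by omega) x y ?_
  have : (a 0 * b 2 - a 2 * b 0) * (a 3 * b 5 - a 5 * b 3) = x * x - y * (-x - y) := by
    rw [← c]
    nth_rewrite 2 [← d]
    rw [hx, hy]
    ring
  push_cast
  linear_combination 9 * this - (4 * m : ℤ) * Q' - 3 * (a 3 * b 5 - a 5 * b 3) * P'

theorem not_exactCover_of_biPeriodic {S : Set Tile} {N : ℕ} (hN : 0 < N)
    (hp : ∀ t, BiPeriodic N fun u => (u, t) ∈ S) : ¬ ExactCover S := by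
  classical
  intro hS
  obtain ⟨f, hf⟩ := hS.exists_slot
  have hfp (k : Fin 6) : BiPeriodic N fun u => f (u, k) := by
    intro u
    constructor <;> simp only [hf] <;> refine ⟨((hf _ _).1 rfl).1, ?_⟩
    · have h := ((hf (u, k) _).1 rfl).2
      have h' := (hp (f (u, k)).1 (u - (f (u, k)).cell.1)).1
      rw [add_sub_right_comm]
      exact h'.mpr h
    · have h := ((hf (u, k) _).1 rfl).2
      have h' := (hp (f (u, k)).1 (u - (f (u, k)).cell.1)).2
      rw [add_sub_right_comm]
      exact h'.mpr h
  have e₁ := eq_of_local hf (δ := fun _ => 0) (F := Slot.second) (G := Slot.first) (c := 1)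
    (bd := fun k => rotV^[k.val] ![0, 0, 0, 1, 0, 0]) second_local first_local
  have e₂ := eq_of_local hf (F := fun s => s.first - s.vertex) (G := fun s => s.second - s.vertex)
    (δ := fun k => rotn (k - 1) (1, 0)) (c := 2) (bd := fun k => rotV^[k.val] ![0, -1, 0, 0, 0, 0])
    first_sub_vertex_local second_sub_vertex_local
  let n (t : Fin 6 × Bool) : ℤ := boxSum N fun u => if (u, t) ∈ S then 1 else 0
  have hn (W : Slot → ℤ) : boxSum N (fun u => ∑ k, W (f (u, k))) = ∑ t, n t * ∑ i, W (t, i) :=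
    boxSum_slot hf hp W
  obtain ⟨a, b, hab⟩ : ∃ a b : Vec, ∀ i j,
      ∑ t, n t * tileArea t i j = 2 * (a i * b j - a j * b i) := by
    let V (u : Eis) (k : Fin 6) : Vec := (f (u, k)).second
    refine ⟨fun i => ∑ m ∈ range N, (V ((m, 0) : Eis) 0 - V (((m, 0) : Eis) + (1, 0)) 3) i,
      fun i => ∑ m ∈ range N, (V ((0, m) : Eis) 1 - V (((0, m) : Eis) + (0, 1)) 4) i,
      fun i j => ?_⟩
    have := boxSum_area (N := N) (X := fun u k => ((f (u, k)).second i, (f (u, k)).second j))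
      (B := fun u k => ((f (u, k)).vertex i, (f (u, k)).vertex j)) ?_ ?_ ?_
    · simp only [tileArea]
      rw [← hn fun s => s.area i j]
      have hX (u : Eis) (k : Fin 6) : (f (u, k - 1)).second = (f (u, k)).first := by
        have := e₁ (u, k - 1)
        simpa using this
      simp only [hX] at this
      simp only [Slot.area, this]
      simp only [wedge, Prod.fst_sum, Prod.snd_sum, V]
      rfl
    · intro u
      simp only [(hfp _ u).1, (hfp _ u).2, and_self]
    · intro u
      simp only [(hfp _ u).1, (hfp _ u).2, and_self]
    · intro u k
      have h1 := e₁ (u, k - 1)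
      have h2 := e₂ (u, k)
      simp only [add_zero, sub_add_cancel] at h1 h2
      rw [h1]
      ext1
      · exact congrFun h2 i
      · exact congrFun h2 j
  have hcount := hn fun _ => 1
  have lin (l : List (ℤ × Fin 6 × Fin 6)) (c : ℤ)
      (hl : ∀ t, (l.map fun x => x.1 * tileArea t x.2.1 x.2.2).sum = c) :
      2 * (l.map fun x => x.1 * (a x.2.1 * b x.2.2 - a x.2.2 * b x.2.1)).sum = c * ∑ t, n t := by
    have key : ∑ t, n t * (l.map fun x => x.1 * tileArea t x.2.1 x.2.2).sum =
        2 * (l.map fun x => x.1 * (a x.2.1 * b x.2.2 - a x.2.2 * b x.2.1)).sum := by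
      clear hl
      induction l with
      | nil => simp
      | cons x l ih =>
        simp only [List.map_cons, List.sum_cons, mul_add, Finset.sum_add_distrib, ih]
        rw [mul_left_comm 2, ← hab, Finset.mul_sum]
        simp only [mul_left_comm]
    rw [← key]
    simp only [hl]
    rw [← Finset.sum_mul, mul_comm]
  set m := ∑ t, n t with hm
  have hmpos : 0 < m := by
    have : m * 8 = N * (N * 6) := by simpa [boxSum, ← Finset.sum_mul] using hcount.symm
    have h' : (0 : ℤ) < N * (N * 6) := by positivity
    omega
  clear_value m
  lift m to ℕ using hmpos.le
  refine false_of_pluecker a b (m := m) (by exact_mod_cast hmpos) _ (fun _ _ => rfl) ?_ ?_ ?_ ?_ ?_ ?_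
  · intro k hk
    have := lin [(1, 0, k), (-1, 1, k), (1, 2, k)] 0 (by revert k; decide +kernel)
    simp only [List.map_cons, List.map_nil, List.sum_cons, List.sum_nil] at this
    linarith
  · intro k hk
    have := lin [(1, k, 3), (-1, k, 4), (1, k, 5)] 0 (by revert k; decide +kernel)
    simp only [List.map_cons, List.map_nil, List.sum_cons, List.sum_nil] at this
    linarith
  · have := lin [(1, 0, 1), (1, 1, 2), (1, 0, 2)] 8 (by decide +kernel)
    simp only [List.map_cons, List.map_nil, List.sum_cons, List.sum_nil] at this
    linarith
  · have := lin [(1, 3, 4), (1, 4, 5), (1, 3, 5)] 4 (by decide +kernel)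
    simp only [List.map_cons, List.map_nil, List.sum_cons, List.sum_nil] at this
    linarith
  · have := lin [(1, 0, 3), (-1, 2, 5), (-1, 0, 2), (1, 1, 2)] 0 (by decide +kernel)
    simp only [List.map_cons, List.map_nil, List.sum_cons, List.sum_nil] at this
    linarith
  · have := lin [(1, 0, 5), (1, 2, 3), (1, 2, 5), (-1, 2, 0), (1, 1, 0)] 0 (by decide +kernel)
    simp only [List.map_cons, List.map_nil, List.sum_cons, List.sum_nil] at this
    linarith

end

theorem exists_locally_equal_periodic {B : Type*} [Finite B] (g : ℤ → B) (W : ℕ) :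
    ∃ n : ℤ, 0 < n ∧ ∃ G : ℤ → B, (∀ k, G (k + n) = G k) ∧
      ∀ k, ∃ k', ∀ e : ℤ, |e| ≤ W → G (k + e) = g (k' + e) := by
  obtain ⟨a, b, hab, he⟩ : ∃ a b : ℕ, a < b ∧ ∀ e : ℕ, e < 2 * W + 1 → g (a + e) = g (b + e) := by
    obtain ⟨a, b, hne, h⟩ := Finite.exists_ne_map_eq_of_infinite
      fun (a : ℕ) (e : Fin (2 * W + 1)) => g (a + e)
    have h' (e : ℕ) (he : e < 2 * W + 1) : g (a + e) = g (b + e) := congrFun h ⟨e, he⟩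
    rcases lt_or_gt_of_ne hne with h1 | h1
    · exact ⟨a, b, h1, h'⟩
    · exact ⟨b, a, h1, fun e he => (h' e he).symm⟩
  obtain ⟨n, rfl⟩ := Nat.exists_eq_add_of_lt hab
  have hg : ∀ k : ℕ, k ≤ n + 1 + 2 * W → g (a + k) = g (a + (k : ℤ) % (n + 1 : ℕ)) := by
    intro k
    induction k using Nat.strong_induction_on with
    | _ k ih =>
      intro hk
      by_cases hkn : k < n + 1
      · rw [Int.emod_eq_of_lt (by omega) (by omega)]
      · obtain ⟨e, rfl⟩ := Nat.exists_eq_add_of_le (not_lt.1 hkn)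
        have h1 := he e (by omega)
        have h2 := ih e (by omega) (by omega)
        have h3 : ((n + 1 + e : ℕ) : ℤ) % (n + 1 : ℕ) = (e : ℤ) % (n + 1 : ℕ) := by simp
        rw [h3, ← h2, h1]
        congr 1
        push_cast
        ring
  refine ⟨(n + 1 : ℕ), by positivity, fun k => g (a + k % (n + 1 : ℕ)), fun k => by simp, fun k =>
    ⟨a + (k - W) % (n + 1 : ℕ) + W, fun e he => ?_⟩⟩
  have h0 := Int.emod_nonneg (k - W) (b := (n + 1 : ℕ)) (by positivity)
  have h1 := Int.emod_lt_of_pos (k - W) (b := (n + 1 : ℕ)) (by positivity)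
  have he' := abs_le.1 he
  have := hg ((k - W) % (n + 1 : ℕ) + W + e).toNat (by omega)
  rw [Int.toNat_of_nonneg (by omega)] at this
  have e1 : (a : ℤ) + (k - W) % (n + 1 : ℕ) + W + e = a + ((k - W) % (n + 1 : ℕ) + W + e) := by ring
  have e2 : (k - W) % (n + 1 : ℕ) + W + e = (k - W) % (n + 1 : ℕ) + (W + e) := by ring
  have e3 : k - W + (W + e) = k + e := by ring
  rw [e1, this, e2, Int.emod_add_emod, e3]

/-- A configuration with a period is locally equal to a doubly periodic one. -/
theorem exists_locally_equal_biPeriodic {A : Type*} [Finite A] {σ : Eis → A} {v : Eis} (hv : v ≠ 0)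
    (h : ∀ x, σ (x + v) = σ x) (R : ℕ) :
    ∃ N : ℕ, 0 < N ∧ ∃ τ : Eis → A, BiPeriodic N τ ∧
      ∀ x, ∃ y, ∀ d : Eis, |d.1| ≤ R → |d.2| ≤ R → τ (x + d) = σ (y + d) := by
  wlog hq : v.2 ≠ 0 generalizing σ v
  · have hp : v.1 ≠ 0 := fun hp => hv (Prod.ext hp (not_not.1 hq))
    obtain ⟨N, hN, τ, hτ, hloc⟩ := this (σ := fun x => σ x.swap) (v := v.swap)
      (fun h0 => hv (Prod.swap_injective (by simpa using h0)))
      (fun x => by simpa using h x.swap) (by simpa using hp)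
    refine ⟨N, hN, fun x => τ x.swap, fun u => ?_, fun x => ?_⟩
    · have := hτ u.swap
      exact ⟨by simpa using this.2, by simpa using this.1⟩
    · obtain ⟨y, hy⟩ := hloc x.swap
      exact ⟨y.swap, fun d h1 h2 => by simpa using hy d.swap h2 h1⟩
  wlog hq' : 0 < v.2 generalizing v
  · exact this (v := -v) (by simpa using hv) (fun x => by simpa using (h (x + -v)).symm)
      (by simpa using hq) (by simp; omega)
  obtain ⟨p, q⟩ := v
  simp only at hq hq'
  have hz (m : ℤ) (x : Eis) : σ (x + m • (p, q)) = σ x := by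
    induction m using Int.induction_on with
    | zero => simp
    | succ m ih => rw [add_smul, one_smul, ← add_assoc, h, ih]
    | pred m ih => rw [← ih, ← h, sub_smul, one_smul, add_assoc, sub_add_cancel]
  lift q to ℕ using hq'.le
  have hq0 : 0 < q := by exact_mod_cast hq'
  have hfold (i j : ℤ) : σ (i, j) = σ (i - p * (j / q), j % q) := by
    rw [← hz (j / q) (i - p * (j / q), j % q)]
    congr 1
    ext
    · simp [mul_comm]
    · have := Int.emod_add_mul_ediv j q
      simp only [Prod.smul_mk, smul_eq_mul, Prod.mk_add_mk]
      linarith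
  obtain ⟨n, hn, G, hG, hloc⟩ := exists_locally_equal_periodic
    (fun i (j : Fin q) => σ (i, j)) (R + p.natAbs * R)
  have hGm (m k : ℤ) : G (k + m * n) = G k := by
    induction m using Int.induction_on with
    | zero => simp
    | succ m ih => rw [add_mul, one_mul, ← add_assoc, hG, ih]
    | pred m ih => rw [← ih, ← hG, sub_mul, one_mul]; congr 1; ring
  let r (j : ℤ) : Fin q := ⟨(j % q).toNat, by
    have := Int.emod_lt_of_pos j hq'; have := Int.emod_nonneg j hq'.ne'; omega⟩
  have hr (j : ℤ) : ((r j : ℕ) : ℤ) = j % q := Int.toNat_of_nonneg (Int.emod_nonneg j hq'.ne')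
  lift n to ℕ using hn.le
  refine ⟨n * q, by have : 0 < n := by exact_mod_cast hn
                    positivity, fun x => G (x.1 - p * (x.2 / q)) (r x.2), fun u => ⟨?_, ?_⟩, ?_⟩
  · simp only [Prod.fst_add, Prod.snd_add, add_zero]
    have : u.1 + ((n * q : ℕ) : ℤ) - p * (u.2 / q) = u.1 - p * (u.2 / q) + q * n := by
      push_cast; ring
    rw [this, hGm]
  · simp only [Prod.fst_add, Prod.snd_add, add_zero]
    have h1 : r (u.2 + (n * q : ℕ)) = r u.2 := by
      ext
      simp [r]
    have h2 : (u.2 + (n * q : ℕ)) / (q : ℤ) = u.2 / q + n := by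
      push_cast
      rw [Int.add_mul_ediv_right _ _ hq'.ne']
    have h3 : u.1 - p * (u.2 / q + n) = u.1 - p * (u.2 / q) + -p * n := by ring
    rw [h1, h2, h3, hGm]
  · rintro ⟨i, j⟩
    obtain ⟨k', hk'⟩ := hloc (i - p * (j / q))
    refine ⟨(k' + p * (j / q), j), ?_⟩
    rintro ⟨d₁, d₂⟩ h1 h2
    simp only [Prod.mk_add_mk] at h1 h2 ⊢
    have hd : |j / q - (j + d₂) / q| ≤ R := by
      have hb := abs_le.1 h2
      rw [abs_le]
      have e1 : (j + d₂) / q ≤ (j + R * q) / q :=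
        Int.ediv_le_ediv hq' (by nlinarith)
      have e2 : (j + (-R) * q) / q ≤ (j + d₂) / q :=
        Int.ediv_le_ediv hq' (by nlinarith)
      rw [Int.add_mul_ediv_right _ _ hq'.ne'] at e1 e2
      constructor <;> linarith
    have := hk' (d₁ + p * (j / q - (j + d₂) / q)) (by
      refine (abs_add_le _ _).trans ?_
      rw [abs_mul]
      push_cast
      gcongr)
    rw [hfold (k' + p * (j / q) + d₁)]
    have e : i + d₁ - p * ((j + d₂) / q) =
        i - p * (j / q) + (d₁ + p * (j / q - (j + d₂) / q)) := by ring
    have e' : k' + p * (j / q) + d₁ - p * ((j + d₂) / q) =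
        k' + (d₁ + p * (j / q - (j + d₂) / q)) := by ring
    rw [e, this, e', ← hr]

theorem abs_cell_sub_le : ∀ t : Fin 6 × Bool, ∀ x ∈ cells (0, t), ∀ y ∈ cells (0, t),
    |(y.1 - x.1).1| ≤ 2 ∧ |(y.1 - x.1).2| ≤ 2 := by decide +kernel

theorem Tile.eq_shift (t : Tile) : t = Tile.shift t.1 (0, t.2) := by simp [Tile.shift]

/-- No exact cover of the cells by tiles has a nonzero period. -/
theorem ExactCover.eq_zero_of_shift {S : Set Tile} (hS : ExactCover S) {v : Eis}
    (hv : ∀ t, t ∈ S ↔ t.shift v ∈ S) : v = 0 := by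
  by_contra hv0
  choose τ hτ hu using fun x => (hS x)
  have hτv (u : Eis) (k : Fin 6) : τ (u + v, k) = (τ (u, k)).shift v :=
    (hu _ _ ⟨(hv _).1 (hτ (u, k)).1, mem_cells_shift.2 (by simpa using (hτ (u, k)).2)⟩).symm
  let A (k : Fin 6) : Type := {t : Tile | ((0, k) : Cell) ∈ cells t}
  have (k : Fin 6) : Finite (A k) := finite_setOf_mem_cells (0, k)
  let σ (u : Eis) (k : Fin 6) : A k := ⟨(τ (u, k)).shift (-u), by
    rw [Set.mem_ofPred_eq, mem_cells_shift]; simpa using (hτ (u, k)).2⟩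
  have hσ (u : Eis) : σ (u + v) = σ u := by
    funext k
    refine Subtype.ext ?_
    change (τ (u + v, k)).shift _ = (τ (u, k)).shift _
    rw [hτv, Tile.shift_shift]
    congr 1
    abel
  obtain ⟨N, hN, σ', hp, hloc⟩ := exists_locally_equal_biPeriodic hv0 hσ 2
  let T (x : Cell) : Tile := (σ' x.1 x.2).1.shift x.1
  have hT (x : Cell) : x ∈ cells (T x) := by
    have := (σ' x.1 x.2).2
    rw [Set.mem_ofPred_eq] at this
    rw [mem_cells_shift]
    simpa using this
  have hTT (x y : Cell) (hy : y ∈ cells (T x)) : T y = T x := by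
    obtain ⟨z, hz⟩ := hloc x.1
    have hd : |(y.1 - x.1).1| ≤ 2 ∧ |(y.1 - x.1).2| ≤ 2 := by
      have h1 := hT x
      rw [Tile.eq_shift (T x), mem_cells_shift] at h1 hy
      simpa using abs_cell_sub_le _ _ h1 _ hy
    have e1 : (σ' x.1 x.2).1 = (τ (z, x.2)).shift (-z) := by
      have := hz 0 (by simp) (by simp)
      simp only [add_zero] at this
      rw [this]
    have e2 : (σ' y.1 y.2).1 = (τ (z + (y.1 - x.1), y.2)).shift (-(z + (y.1 - x.1))) := by
      have := hz (y.1 - x.1) (by exact_mod_cast hd.1) (by exact_mod_cast hd.2)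
      rw [add_sub_cancel] at this
      rw [this]
    simp only [T, e1, e2, Tile.shift_shift] at hy ⊢
    rw [mem_cells_shift] at hy
    have e3 : τ (z + (y.1 - x.1), y.2) = τ (z, x.2) := by
      refine (hu _ _ ⟨(hτ _).1, ?_⟩).symm
      convert hy using 2
      abel
    rw [e3]
    congr 1
    abel
  refine not_exactCover_of_biPeriodic (S := Set.range T) hN (fun t => ?_) fun x =>
    ⟨T x, ⟨⟨x, rfl⟩, hT x⟩, ?_⟩
  · have key (w : Eis) (hw : ∀ u, σ' (u + w) = σ' u) (s : Tile) :
        s.shift w ∈ Set.range T ↔ s ∈ Set.range T := by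
      have hTw (x : Cell) : T (x.1 + w, x.2) = (T x).shift w := by
        simp only [T, hw, Tile.shift_shift]
        rw [add_comm]
      constructor
      · rintro ⟨x, hx⟩
        refine ⟨(x.1 - w, x.2), ?_⟩
        have := hTw (x.1 - w, x.2)
        simp only [sub_add_cancel, hx] at this
        have h2 := congrArg (Tile.shift (-w)) this
        simpa [Tile.shift_shift, Tile.shift_zero] using h2.symm
      · rintro ⟨x, rfl⟩
        exact ⟨_, hTw x⟩
    intro u
    have h1 := key _ (fun u => (hp u).1) (u, t)
    have h2 := key _ (fun u => (hp u).2) (u, t)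
    simp only [Tile.shift, add_comm _ u] at h1 h2
    exact ⟨propext h1, propext h2⟩
  · rintro _ ⟨⟨y, rfl⟩, hx⟩
    exact (hTT y x hx).symm

section

open Filter Topology Complex

/-! ### Oblique coordinates -/

/-- The primitive sixth root of unity in the upper half plane. -/
def zeta : ℂ := ⟨1 / 2, √3 / 2⟩

def cX (z : ℂ) : ℝ := z.re - z.im / √3
def cY (z : ℂ) : ℝ := 2 * z.im / √3

theorem sqrt3_mul_self : √3 * √3 = 3 := Real.mul_self_sqrt (by norm_num)
theorem sqrt3_pos : 0 < √3 := by positivity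

theorem cX_add (z w : ℂ) : cX (z + w) = cX z + cX w := by simp only [cX, add_re, add_im]; ring
theorem cY_add (z w : ℂ) : cY (z + w) = cY z + cY w := by simp only [cY, add_im]; ring
theorem cX_sub (z w : ℂ) : cX (z - w) = cX z - cX w := by simp only [cX, sub_re, sub_im]; ring
theorem cY_sub (z w : ℂ) : cY (z - w) = cY z - cY w := by simp only [cY, sub_im]; ring
theorem cX_real_mul (r : ℝ) (z : ℂ) : cX (r * z) = r * cX z := by
  simp only [cX, re_ofReal_mul, im_ofReal_mul]; ring
theorem cY_real_mul (r : ℝ) (z : ℂ) : cY (r * z) = r * cY z := by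
  simp only [cY, im_ofReal_mul]; ring
theorem cX_zeta_mul (z : ℂ) : cX (zeta * z) = -cY z := by
  have := sqrt3_mul_self
  simp only [cX, cY, zeta, mul_re, mul_im]
  field_simp
  linear_combination -z.im * this
theorem cY_zeta_mul (z : ℂ) : cY (zeta * z) = cX z + cY z := by
  have := sqrt3_mul_self
  simp only [cX, cY, zeta, mul_im]
  field_simp
  ring
theorem cX_I_mul (z : ℂ) : √3 * cX (I * z) = -cX z - 2 * cY z := by
  have := sqrt3_mul_self
  simp only [cX, cY, mul_re, mul_im, I_re, I_im]
  field_simp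
  linear_combination -z.im * this
theorem cY_I_mul (z : ℂ) : √3 * cY (I * z) = 2 * cX z + cY z := by
  simp only [cX, cY, mul_im, I_re, I_im]
  field_simp
  ring
theorem cX_conj (z : ℂ) : cX (starRingEnd ℂ z) = cX z + cY z := by
  simp only [cX, cY, conj_re, conj_im]; ring
theorem cY_conj (z : ℂ) : cY (starRingEnd ℂ z) = -cY z := by
  simp only [cY, conj_im]; ring
@[fun_prop] theorem continuous_cX : Continuous cX := by unfold cX; fun_prop
@[fun_prop] theorem continuous_cY : Continuous cY := by unfold cY; fun_prop

theorem eq_of_coords {z w : ℂ} (h₁ : cX z = cX w) (h₂ : cY z = cY w) : z = w := by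
  have h3 := sqrt3_pos.ne'
  have hi : z.im = w.im := by
    simp only [cY] at h₂
    field_simp at h₂
    linarith
  refine Complex.ext ?_ hi
  simpa [cX, hi] using h₁

/-- The embedding of the Eisenstein integers into the plane. -/
def em (x : Eis) : ℂ := x.1 + x.2 * zeta

@[simp] theorem cX_em (x : Eis) : cX (em x) = x.1 := by
  have := cX_real_mul x.2 zeta
  have h2 := cX_zeta_mul 1
  have h3 : cX (x.1 : ℂ) = x.1 := by simp [cX]
  rw [mul_one] at h2
  rw [em, cX_add, h3, show ((x.2 : ℤ) : ℂ) = ((x.2 : ℝ) : ℂ) by simp, this, h2]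
  simp [cY]
@[simp] theorem cY_em (x : Eis) : cY (em x) = x.2 := by
  have := cY_real_mul x.2 zeta
  have h2 := cY_zeta_mul 1
  have h3 : cY (x.1 : ℂ) = 0 := by simp [cY]
  rw [mul_one] at h2
  rw [em, cY_add, h3, show ((x.2 : ℤ) : ℂ) = ((x.2 : ℝ) : ℂ) by simp, this, h2]
  simp [cX, cY]

theorem em_injective : Function.Injective em := fun x y h => by
  ext
  · have := congrArg cX h; simpa using this
  · have := congrArg cY h; simpa using this

theorem em_add (x y : Eis) : em (x + y) = em x + em y :=
  eq_of_coords (by simp [cX_add]) (by simp [cY_add])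
theorem em_sub (x y : Eis) : em (x - y) = em x - em y :=
  eq_of_coords (by simp [cX_sub]) (by simp [cY_sub])
@[simp] theorem em_zero : em 0 = 0 := by simp [em]

theorem em_rot (x : Eis) : em (rot x) = zeta * em x :=
  eq_of_coords (by simp [cX_zeta_mul, rot]) (by simp [cY_zeta_mul, rot])

/-- Powers of `zeta`. -/
def zr (k : Fin 6) : ℂ := zeta ^ k.val

theorem em_rotn (k : Fin 6) (x : Eis) : em (rotn k x) = zr k * em x := by
  rw [rotn, zr]
  generalize k.val = n
  induction n generalizing x with
  | zero => simp
  | succ n ih => rw [Function.iterate_succ_apply, ih, em_rot, pow_succ, mul_assoc]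

theorem em_one : em (1, 0) = 1 := by simp [em]

theorem zr_eq (k : Fin 6) : zr k = em (rotn k (1, 0)) := by rw [em_rotn, em_one, mul_one]

theorem zr_add (j k : Fin 6) : zr (j + k) = zr j * zr k := by
  rw [zr_eq (j + k), rotn_add_apply, em_rotn, ← zr_eq]

@[simp] theorem zr_zero : zr 0 = 1 := by simp [zr]

theorem zr_neg_mul (k : Fin 6) : zr (-k) * zr k = 1 := by rw [← zr_add]; simp
theorem zr_mul_neg (k : Fin 6) : zr k * zr (-k) = 1 := by rw [← zr_add]; simp
theorem zr_ne_zero (k : Fin 6) : zr k ≠ 0 := left_ne_zero_of_mul_eq_one (zr_mul_neg k)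

theorem coords_zr_mul (z : ℂ) :
    (cX (zr 0 * z) = cX z ∧ cY (zr 0 * z) = cY z) ∧
    (cX (zr 1 * z) = -cY z ∧ cY (zr 1 * z) = cX z + cY z) ∧
    (cX (zr 2 * z) = -cX z - cY z ∧ cY (zr 2 * z) = cX z) ∧
    (cX (zr 3 * z) = -cX z ∧ cY (zr 3 * z) = -cY z) ∧
    (cX (zr 4 * z) = cY z ∧ cY (zr 4 * z) = -cX z - cY z) ∧
    (cX (zr 5 * z) = cX z + cY z ∧ cY (zr 5 * z) = -cX z) := by
  have h : ∀ n : ℕ, zeta ^ (n + 1) * z = zeta * (zeta ^ n * z) := fun n => by rw [pow_succ']; ring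
  have e (k : Fin 6) (n : ℕ) (hk : k.val = n) : zr k = zeta ^ n := by rw [zr, hk]
  rw [e 0 0 rfl, e 1 (0 + 1) rfl, e 2 (0 + 1 + 1) rfl, e 3 (0 + 1 + 1 + 1) rfl,
    e 4 (0 + 1 + 1 + 1 + 1) rfl, e 5 (0 + 1 + 1 + 1 + 1 + 1) rfl]
  simp only [h, pow_zero, one_mul, cX_zeta_mul, cY_zeta_mul]
  refine ⟨⟨?_, ?_⟩, ⟨?_, ?_⟩, ⟨?_, ?_⟩, ⟨?_, ?_⟩, ⟨?_, ?_⟩, ?_, ?_⟩ <;> first | rfl | trivial | ring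

/-! ### Germs of half-discs -/

/-- The filter of neighbourhoods of the start of the ray from `p` in direction `w`, on its left side
for `s = 1` and on its right side for `s = -1`. -/
def germ (p w : ℂ) (s : ℝ) : Filter ℂ :=
  (𝓝[>] (0 : ℝ)).bind fun δ : ℝ =>
    Filter.map (fun ε : ℝ => p + ε * (w + δ * (s * (I * w)))) (𝓝[>] (0 : ℝ))

theorem eventually_germ {p w : ℂ} {s : ℝ} {P : ℂ → Prop} : (∀ᶠ z in germ p w s, P z) ↔
    ∀ᶠ δ : ℝ in 𝓝[>] 0, ∀ᶠ ε : ℝ in 𝓝[>] 0, P (p + ε * (w + δ * (s * (I * w)))) := Iff.rfl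

instance (p w : ℂ) (s : ℝ) : (germ p w s).NeBot := by
  rw [neBot_iff]
  intro h
  have : ∀ᶠ z in germ p w s, False := by rw [h]; trivial
  rw [eventually_germ] at this
  obtain ⟨δ, hδ⟩ := this.exists
  exact hδ.exists.elim fun _ h => h

theorem germ_le_nhds (p w : ℂ) (s : ℝ) : germ p w s ≤ 𝓝 p := by
  intro A hA
  refine eventually_germ.2 (Eventually.of_forall fun δ => ?_)
  have hc : Tendsto (fun ε : ℝ => p + ε * (w + δ * (s * (I * w)))) (𝓝[>] 0) (𝓝 p) := by
    have : Continuous (fun ε : ℝ => p + ε * (w + δ * (s * (I * w)))) := by fun_prop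
    have := this.tendsto 0
    simp only [ofReal_zero, zero_mul, add_zero] at this
    exact this.mono_left nhdsWithin_le_nhds
  exact hc.eventually hA

theorem map_germ {u : ℂ} (t p w : ℂ) (s : ℝ) :
    (germ p w s).map (fun z => u * z + t) = germ (u * p + t) (u * w) s := by
  ext A
  change (∀ᶠ z in germ p w s, u * z + t ∈ A) ↔ ∀ᶠ z in germ _ _ _, z ∈ A
  simp only [eventually_germ]
  refine eventually_congr (Eventually.of_forall fun δ => eventually_congr
    (Eventually.of_forall fun ε => ?_))
  ring_nf

/-- Lexicographic positivity. -/
def LexPos {α : Type*} [Zero α] [LT α] (a b c : α) : Prop :=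
  0 < a ∨ a = 0 ∧ (0 < b ∨ b = 0 ∧ 0 < c)

instance (a b c : ℤ) : Decidable (LexPos a b c) := by unfold LexPos; infer_instance

theorem LexPos.cast {a b c : ℤ} (h : LexPos a b c) : LexPos (a : ℝ) b c := by
  unfold LexPos at *; exact_mod_cast h

theorem lexPos_or {a b c : ℝ} (h : b = 0 → c ≠ 0) : LexPos a b c ∨ LexPos (-a) (-b) (-c) := by
  unfold LexPos
  rcases lt_trichotomy a 0 with h1 | rfl | h1
  · right; left; linarith
  · rcases lt_trichotomy b 0 with h2 | rfl | h2
    · right; right; exact ⟨by simp, Or.inl (by linarith)⟩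
    · rcases (h rfl).lt_or_gt with h3 | h3
      · right; right; exact ⟨by simp, Or.inr ⟨by simp, by linarith⟩⟩
      · left; right; exact ⟨rfl, Or.inr ⟨rfl, h3⟩⟩
    · left; right; exact ⟨rfl, Or.inl h2⟩
  · left; left; exact h1

/-- An affine function is positive on a germ if its value, its derivative along the ray and its
derivative across the ray are lexicographically positive. -/
theorem eventually_germ_pos {p w : ℂ} {s : ℝ} {a b c : ℝ}
    (h : LexPos (c + a * cX p + b * cY p) (a * cX w + b * cY w)
      (s * (a * (-cX w - 2 * cY w) + b * (2 * cX w + cY w)))) :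
    ∀ᶠ z in germ p w s, 0 < c + a * cX z + b * cY z := by
  rw [eventually_germ]
  have e (δ ε : ℝ) : c + a * cX (p + ε * (w + δ * (s * (I * w)))) +
      b * cY (p + ε * (w + δ * (s * (I * w)))) = (c + a * cX p + b * cY p) +
      ε * ((a * cX w + b * cY w) + δ / √3 * (s * (a * (-cX w - 2 * cY w) + b * (2 * cX w + cY w)))) := by
    rw [← cX_I_mul, ← cY_I_mul]
    simp only [cX_add, cY_add, cX_real_mul, cY_real_mul]
    have := sqrt3_pos.ne'
    field_simp
    ring
  simp only [e]
  rcases h with h | ⟨h1, h | ⟨h2, h⟩⟩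
  · refine Eventually.of_forall fun δ => ?_
    exact ((Continuous.tendsto' (by fun_prop) 0 _ (by simp)).eventually
      (lt_mem_nhds h)).filter_mono nhdsWithin_le_nhds
  · have : ∀ᶠ δ : ℝ in 𝓝[>] 0, 0 < (a * cX w + b * cY w) +
        δ / √3 * (s * (a * (-cX w - 2 * cY w) + b * (2 * cX w + cY w))) :=
      ((Continuous.tendsto' (by fun_prop) 0 _ (by simp)).eventually
        (lt_mem_nhds h)).filter_mono nhdsWithin_le_nhds
    filter_upwards [this] with δ hδ
    filter_upwards [self_mem_nhdsWithin] with ε hε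
    rw [h1, zero_add]
    exact mul_pos hε hδ
  · filter_upwards [self_mem_nhdsWithin] with δ hδ
    filter_upwards [self_mem_nhdsWithin] with ε hε
    rw [h1, h2, zero_add, zero_add]
    exact mul_pos hε (mul_pos (div_pos hδ sqrt3_pos) h)

/-! ### Kites -/

/-- Coefficients of the four affine forms that are nonnegative on the kite `(0, 0)`. -/
def coef : Fin 4 → ℤ × ℤ × ℤ := ![(0, 1, 2), (2, -1, 0), (2, -1, -1), (0, 1, -1)]

def form (e : Fin 4) (z : ℂ) : ℝ := (coef e).1 + (coef e).2.1 * cX z + (coef e).2.2 * cY z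

theorem forall_form {P : ℝ → Prop} {z : ℂ} : (∀ e, P (form e z)) ↔
    P (cX z + 2 * cY z) ∧ P (2 - cX z) ∧ P (2 - cX z - cY z) ∧ P (cX z - cY z) := by
  have h : form 0 z = cX z + 2 * cY z ∧ form 1 z = 2 - cX z ∧ form 2 z = 2 - cX z - cY z ∧
      form 3 z = cX z - cY z := by
    refine ⟨?_, ?_, ?_, ?_⟩ <;> simp [form, coef] <;> ring
  rw [← h.2.2.1, ← h.1, ← h.2.1, ← h.2.2.2]
  exact ⟨fun h => ⟨h 0, h 1, h 2, h 3⟩, fun h e => by fin_cases e; exacts [h.1, h.2.1, h.2.2.1, h.2.2.2]⟩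

/-- The motion carrying a cell to the cell `(0, 0)`. -/
def pull (c : Cell) (z : ℂ) : ℂ := zr (-c.2) * (z - em (latHom c.1))

def okite (c : Cell) : Set ℂ := {z | ∀ e, 0 < form e (pull c z)}

def kite (c : Cell) : Set ℂ := {z | ∀ e, 0 ≤ form e (pull c z)}

@[fun_prop] theorem continuous_form (e : Fin 4) : Continuous (form e) := by unfold form; fun_prop
@[fun_prop] theorem continuous_pull (c : Cell) : Continuous (pull c) := by unfold pull; fun_prop

theorem okite_subset_kite (c : Cell) : okite c ⊆ kite c := fun _ h e => (h e).le

theorem isOpen_okite (c : Cell) : IsOpen (okite c) := by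
  have : okite c = ⋂ e, {z | 0 < form e (pull c z)} := by ext; simp [okite]
  rw [this]
  exact isOpen_iInter_of_finite fun e => isOpen_lt continuous_const (by fun_prop)

theorem isClosed_kite (c : Cell) : IsClosed (kite c) := by
  have : kite c = ⋂ e, {z | 0 ≤ form e (pull c z)} := by ext; simp [kite]
  rw [this]
  exact isClosed_iInter fun e => isClosed_le continuous_const (by fun_prop)

theorem pull_act (p : Eis) (r : Fin 6) (c : Cell) (z : ℂ) :
    pull (Kite.act p r c) (zr r * z + em (latHom p)) = pull c z := by
  simp only [pull, Kite.act, map_add, latHom_rotn, em_add, em_rotn, neg_add, zr_add]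
  linear_combination (zr (-c.2) * (z - em (latHom c.1))) * zr_neg_mul r

theorem mem_kite_act {p : Eis} {r : Fin 6} {c : Cell} {z : ℂ} :
    zr r * z + em (latHom p) ∈ kite (Kite.act p r c) ↔ z ∈ kite c := by
  change (∀ e, _) ↔ ∀ e, _
  rw [pull_act]

theorem mem_okite_act {p : Eis} {r : Fin 6} {c : Cell} {z : ℂ} :
    zr r * z + em (latHom p) ∈ okite (Kite.act p r c) ↔ z ∈ okite c := by
  change (∀ e, _) ↔ ∀ e, _
  rw [pull_act]

theorem act_self (c : Cell) : Kite.act c.1 c.2 (0, 0) = c := by simp [Kite.act]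

theorem pull_zero (z : ℂ) : pull (0, 0) z = z := by simp [pull]

theorem mem_kite_zero {z : ℂ} : z ∈ kite (0, 0) ↔
    0 ≤ cX z + 2 * cY z ∧ 0 ≤ 2 - cX z ∧ 0 ≤ 2 - cX z - cY z ∧ 0 ≤ cX z - cY z := by
  change (∀ e, _) ↔ _
  rw [pull_zero, forall_form (P := fun x => 0 ≤ x)]

theorem mem_okite_zero {z : ℂ} : z ∈ okite (0, 0) ↔
    0 < cX z + 2 * cY z ∧ 0 < 2 - cX z ∧ 0 < 2 - cX z - cY z ∧ 0 < cX z - cY z := by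
  change (∀ e, _) ↔ _
  rw [pull_zero, forall_form (P := fun x => 0 < x)]

theorem mem_kite_iff {c : Cell} {z : ℂ} : z ∈ kite c ↔ pull c z ∈ kite (0, 0) := by
  change (∀ e, _) ↔ ∀ e, _
  rw [pull_zero]

theorem mem_okite_iff {c : Cell} {z : ℂ} : z ∈ okite c ↔ pull c z ∈ okite (0, 0) := by
  change (∀ e, _) ↔ ∀ e, _
  rw [pull_zero]

theorem coords_latHom (u : Eis) : cX (em (latHom u)) = 2 * u.1 - 2 * u.2 ∧
    cY (em (latHom u)) = 2 * u.1 + 4 * u.2 := by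
  simp [latHom]

/-- Coordinates of `pull`. -/
theorem coords_pull (u : Eis) (z : ℂ) {a b : ℝ} (ha : a = cX z - (2 * u.1 - 2 * u.2))
    (hb : b = cY z - (2 * u.1 + 4 * u.2)) :
    (cX (pull (u, 0) z) = a ∧ cY (pull (u, 0) z) = b) ∧
    (cX (pull (u, 1) z) = a + b ∧ cY (pull (u, 1) z) = -a) ∧
    (cX (pull (u, 2) z) = b ∧ cY (pull (u, 2) z) = -a - b) ∧
    (cX (pull (u, 3) z) = -a ∧ cY (pull (u, 3) z) = -b) ∧
    (cX (pull (u, 4) z) = -a - b ∧ cY (pull (u, 4) z) = a) ∧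
    (cX (pull (u, 5) z) = -b ∧ cY (pull (u, 5) z) = a + b) := by
  have h := coords_zr_mul (z - em (latHom u))
  rw [cX_sub, cY_sub, (coords_latHom u).1, (coords_latHom u).2, ← ha, ← hb] at h
  have e (j k : Fin 6) (hj : -j = k) : pull (u, j) z = zr k * (z - em (latHom u)) := by
    rw [← hj]; rfl
  rw [e 0 0 rfl, e 1 5 rfl, e 2 4 rfl, e 3 3 rfl, e 4 2 rfl, e 5 1 rfl]
  exact ⟨h.1, h.2.2.2.2.2, h.2.2.2.2.1, h.2.2.2.1, h.2.2.1, h.2.1⟩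

theorem mem_kite_coords (u : Eis) (z : ℂ) {a b : ℝ} (ha : a = cX z - (2 * u.1 - 2 * u.2))
    (hb : b = cY z - (2 * u.1 + 4 * u.2)) :
    (z ∈ kite (u, 0) ↔ 0 ≤ a + 2 * b ∧ 0 ≤ 2 - a ∧ 0 ≤ 2 - a - b ∧ 0 ≤ a - b) ∧
    (z ∈ kite (u, 1) ↔ 0 ≤ b - a ∧ 0 ≤ 2 - a - b ∧ 0 ≤ 2 - b ∧ 0 ≤ 2 * a + b) ∧
    (z ∈ kite (u, 2) ↔ 0 ≤ -b - 2 * a ∧ 0 ≤ 2 - b ∧ 0 ≤ 2 + a ∧ 0 ≤ a + 2 * b) ∧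
    (z ∈ kite (u, 3) ↔ 0 ≤ -a - 2 * b ∧ 0 ≤ 2 + a ∧ 0 ≤ 2 + a + b ∧ 0 ≤ b - a) ∧
    (z ∈ kite (u, 4) ↔ 0 ≤ a - b ∧ 0 ≤ 2 + a + b ∧ 0 ≤ 2 + b ∧ 0 ≤ -2 * a - b) ∧
    (z ∈ kite (u, 5) ↔ 0 ≤ 2 * a + b ∧ 0 ≤ 2 + b ∧ 0 ≤ 2 - a ∧ 0 ≤ -a - 2 * b) := by
  obtain ⟨⟨h0, h0'⟩, ⟨h1, h1'⟩, ⟨h2, h2'⟩, ⟨h3, h3'⟩, ⟨h4, h4'⟩, h5, h5'⟩ := coords_pull u z ha hb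
  refine ⟨?_, ?_, ?_, ?_, ?_, ?_⟩
  · rw [mem_kite_iff, mem_kite_zero, h0, h0']
  · rw [mem_kite_iff, mem_kite_zero, h1, h1']; ring_nf
  · rw [mem_kite_iff, mem_kite_zero, h2, h2']; ring_nf
  · rw [mem_kite_iff, mem_kite_zero, h3, h3']; ring_nf
  · rw [mem_kite_iff, mem_kite_zero, h4, h4']; ring_nf
  · rw [mem_kite_iff, mem_kite_zero, h5, h5']; ring_nf

theorem exists_mem_kite (z : ℂ) : ∃ c, z ∈ kite c := by
  set m := ⌊(2 * cX z + cY z) / 6⌋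
  set n := ⌊(cY z - cX z) / 6⌋
  have h1 : (m : ℝ) ≤ _ := Int.floor_le ((2 * cX z + cY z) / 6)
  have h2 : _ < (m : ℝ) + 1 := Int.lt_floor_add_one ((2 * cX z + cY z) / 6)
  have h3 : (n : ℝ) ≤ _ := Int.floor_le ((cY z - cX z) / 6)
  have h4 : _ < (n : ℝ) + 1 := Int.lt_floor_add_one ((cY z - cX z) / 6)
  obtain ⟨a, ha⟩ : ∃ a, a = cX z - (2 * m - 2 * n) := ⟨_, rfl⟩
  obtain ⟨b, hb⟩ : ∃ b, b = cY z - (2 * m + 4 * n) := ⟨_, rfl⟩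
  have k0 := mem_kite_coords (m, n) z ha hb
  have k1 := mem_kite_coords (m + 1, n) z (a := a - 2) (b := b - 2) (by push_cast; linarith)
    (by push_cast; linarith)
  have k2 := mem_kite_coords (m, n + 1) z (a := a + 2) (b := b - 4) (by push_cast; linarith)
    (by push_cast; linarith)
  have k3 := mem_kite_coords (m + 1, n + 1) z (a := a) (b := b - 6) (by push_cast; linarith)
    (by push_cast; linarith)
  have b1 : 0 ≤ 2 * a + b := by linarith
  have b2 : 2 * a + b < 6 := by linarith
  have b3 : 0 ≤ b - a := by linarith
  have b4 : b - a < 6 := by linarith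
  rcases le_total (a + 2 * b) 6 with h | h
  · rcases le_total (a + b) 2 with h5 | h5
    · rcases le_total b 2 with h6 | h6
      · exact ⟨_, k0.2.1.2 ⟨by linarith, by linarith, by linarith, by linarith⟩⟩
      · exact ⟨_, k2.2.2.2.2.2.2 ⟨by linarith, by linarith, by linarith, by linarith⟩⟩
    · rcases le_total 0 a with h6 | h6
      · exact ⟨_, k1.2.2.2.1.2 ⟨by linarith, by linarith, by linarith, by linarith⟩⟩
      · exact ⟨_, k2.2.2.2.2.2.2 ⟨by linarith, by linarith, by linarith, by linarith⟩⟩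
  · rcases le_total (a + b) 4 with h5 | h5
    · rcases le_total a 0 with h6 | h6
      · exact ⟨_, k2.1.2 ⟨by linarith, by linarith, by linarith, by linarith⟩⟩
      · exact ⟨_, k1.2.2.1.2 ⟨by linarith, by linarith, by linarith, by linarith⟩⟩
    · rcases le_total b 4 with h6 | h6
      · exact ⟨_, k1.2.2.1.2 ⟨by linarith, by linarith, by linarith, by linarith⟩⟩
      · exact ⟨_, k3.2.2.2.2.1.2 ⟨by linarith, by linarith, by linarith, by linarith⟩⟩

theorem hexagon_of_mem_kite {c : Cell} {z : ℂ} (h : z ∈ kite c) :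
    |cX (z - em (latHom c.1))| ≤ 2 ∧ |cY (z - em (latHom c.1))| ≤ 2 ∧
      |cX (z - em (latHom c.1)) + cY (z - em (latHom c.1))| ≤ 2 := by
  obtain ⟨u, k⟩ := c
  rw [cX_sub, cY_sub, (coords_latHom u).1, (coords_latHom u).2]
  have := mem_kite_coords u z rfl rfl
  simp only [abs_le]
  generalize cX z - (2 * (u.1 : ℝ) - 2 * u.2) = a at *
  generalize cY z - (2 * (u.1 : ℝ) + 4 * u.2) = b at *
  obtain ⟨h0, h1, h2, h3, h4, h5⟩ := this
  have hs : ∀ k : Fin 6, k = 0 ∨ k = 1 ∨ k = 2 ∨ k = 3 ∨ k = 4 ∨ k = 5 := by decide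
  rcases hs k with rfl | rfl | rfl | rfl | rfl | rfl
  · obtain ⟨_, _, _, _⟩ := h0.1 h; refine ⟨⟨?_, ?_⟩, ⟨?_, ?_⟩, ?_, ?_⟩ <;> linarith
  · obtain ⟨_, _, _, _⟩ := h1.1 h; refine ⟨⟨?_, ?_⟩, ⟨?_, ?_⟩, ?_, ?_⟩ <;> linarith
  · obtain ⟨_, _, _, _⟩ := h2.1 h; refine ⟨⟨?_, ?_⟩, ⟨?_, ?_⟩, ?_, ?_⟩ <;> linarith
  · obtain ⟨_, _, _, _⟩ := h3.1 h; refine ⟨⟨?_, ?_⟩, ⟨?_, ?_⟩, ?_, ?_⟩ <;> linarith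
  · obtain ⟨_, _, _, _⟩ := h4.1 h; refine ⟨⟨?_, ?_⟩, ⟨?_, ?_⟩, ?_, ?_⟩ <;> linarith
  · obtain ⟨_, _, _, _⟩ := h5.1 h; refine ⟨⟨?_, ?_⟩, ⟨?_, ?_⟩, ?_, ?_⟩ <;> linarith

theorem eq_of_mem_okite_zero {u : Eis} {z : ℂ} {k : Fin 6} (h : z ∈ okite (u, k))
    (h' : z ∈ kite (0, 0)) : (u, k) = ((0, 0) : Cell) := by
  obtain ⟨h1, h2, h3⟩ := hexagon_of_mem_kite h'
  have hk : z ∈ kite (u, k) := okite_subset_kite _ h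
  have ho : 0 < 2 - cX (pull (u, k) z) ∧ 0 < 2 - cX (pull (u, k) z) - cY (pull (u, k) z) ∧
      0 < cX (pull (u, k) z) - cY (pull (u, k) z) := (mem_okite_zero.1 (mem_okite_iff.1 h)).2
  have h0 := (mem_okite_zero.1 (mem_okite_iff.1 h)).1
  have hz := mem_kite_zero.1 h'
  have e : cX (z - em (latHom ((0, 0) : Cell).1)) = cX z ∧
      cY (z - em (latHom ((0, 0) : Cell).1)) = cY z := by simp
  rw [e.1] at h1 h3
  rw [e.2] at h2 h3
  rw [abs_le] at h1 h2 h3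
  have hu : u = 0 := by
    obtain ⟨m, n⟩ := u
    have hs : ∀ k : Fin 6, k = 0 ∨ k = 1 ∨ k = 2 ∨ k = 3 ∨ k = 4 ∨ k = 5 := by decide
    have := coords_pull (m, n) z rfl rfl
    have key : |cX z - (2 * m - 2 * n)| < 2 ∧ |cY z - (2 * m + 4 * n)| < 2 ∧
        |cX z - (2 * m - 2 * n) + (cY z - (2 * m + 4 * n))| < 2 := by
      simp only [abs_lt]
      generalize cX z - (2 * (m : ℝ) - 2 * n) = a at *
      generalize cY z - (2 * (m : ℝ) + 4 * n) = b at *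
      obtain ⟨g0, g1, g2, g3, g4, g5⟩ := this
      rcases hs k with rfl | rfl | rfl | rfl | rfl | rfl
      · rw [g0.1, g0.2] at h0 ho
        refine ⟨⟨?_, ?_⟩, ⟨?_, ?_⟩, ?_, ?_⟩ <;> linarith
      · rw [g1.1, g1.2] at h0 ho
        refine ⟨⟨?_, ?_⟩, ⟨?_, ?_⟩, ?_, ?_⟩ <;> linarith
      · rw [g2.1, g2.2] at h0 ho
        refine ⟨⟨?_, ?_⟩, ⟨?_, ?_⟩, ?_, ?_⟩ <;> linarith
      · rw [g3.1, g3.2] at h0 ho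
        refine ⟨⟨?_, ?_⟩, ⟨?_, ?_⟩, ?_, ?_⟩ <;> linarith
      · rw [g4.1, g4.2] at h0 ho
        refine ⟨⟨?_, ?_⟩, ⟨?_, ?_⟩, ?_, ?_⟩ <;> linarith
      · rw [g5.1, g5.2] at h0 ho
        refine ⟨⟨?_, ?_⟩, ⟨?_, ?_⟩, ?_, ?_⟩ <;> linarith
    simp only [abs_lt] at key
    obtain ⟨⟨k1, k2⟩, ⟨k3, k4⟩, k5, k6⟩ := key
    have b1 : 2 * m - 2 * n < 4 := by exact_mod_cast (show (2 * m - 2 * n : ℝ) < 4 by linarith)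
    have b2 : -4 < 2 * m - 2 * n := by exact_mod_cast (show (-4 : ℝ) < 2 * m - 2 * n by linarith)
    have b3 : 2 * m + 4 * n < 4 := by exact_mod_cast (show (2 * m + 4 * n : ℝ) < 4 by linarith)
    have b4 : -4 < 2 * m + 4 * n := by exact_mod_cast (show (-4 : ℝ) < 2 * m + 4 * n by linarith)
    have b5 : 4 * m + 2 * n < 4 := by exact_mod_cast (show (4 * m + 2 * n : ℝ) < 4 by linarith)
    have b6 : -4 < 4 * m + 2 * n := by exact_mod_cast (show (-4 : ℝ) < 4 * m + 2 * n by linarith)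
    ext <;> simp only [Prod.fst_zero, Prod.snd_zero] <;> omega
  subst hu
  obtain ⟨g0, g1, g2, g3, g4, g5⟩ := coords_pull 0 z (a := cX z) (b := cY z) (by simp) (by simp)
  have hs : ∀ k : Fin 6, k = 0 ∨ k = 1 ∨ k = 2 ∨ k = 3 ∨ k = 4 ∨ k = 5 := by decide
  rcases hs k with rfl | rfl | rfl | rfl | rfl | rfl
  · rfl
  · rw [g1.1, g1.2] at h0 ho; linarith
  · rw [g2.1, g2.2] at h0 ho; linarith
  · rw [g3.1, g3.2] at h0 ho; linarith
  · rw [g4.1, g4.2] at h0 ho; linarith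
  · rw [g5.1, g5.2] at h0 ho; linarith

theorem eq_of_mem_okite {c c' : Cell} {z : ℂ} (h : z ∈ okite c) (h' : z ∈ kite c') : c = c' := by
  let p : Eis := -rotn (-c'.2) c'.1
  let r : Fin 6 := -c'.2
  have e : Kite.act p r c' = (0, 0) := by simp [Kite.act, p, r]
  rw [← mem_okite_act (p := p) (r := r)] at h
  rw [← mem_kite_act (p := p) (r := r), e] at h'
  exact Kite.act_injective p r (a₁ := c) (a₂ := c') ((eq_of_mem_okite_zero h h').trans e.symm)

theorem finite_setOf_kite_near (p : ℂ) (R : ℝ) : {c | ∃ z ∈ kite c, ‖z - p‖ ≤ R}.Finite := by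
  have hb : ∀ z : ℂ, |cX z| ≤ 2 * ‖z‖ ∧ |cY z| ≤ 2 * ‖z‖ := by
    intro z
    have h1 := abs_re_le_norm z
    have h2 := abs_im_le_norm z
    have h3 : 1 ≤ √3 := Real.one_le_sqrt.2 (by norm_num)
    have h4 : |z.im / √3| ≤ ‖z‖ := by
      rw [abs_div, abs_of_pos sqrt3_pos]
      exact (div_le_self (abs_nonneg _) h3).trans h2
    constructor
    · rw [cX]; exact (abs_sub _ _).trans (by linarith)
    · rw [cY, mul_div_assoc, abs_mul, abs_two]; linarith
  have hf : (Set.Icc (-(⌈2 * R + 2 * ‖p‖ + 2⌉)) ⌈2 * R + 2 * ‖p‖ + 2⌉ : Set ℤ).Finite :=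
    Set.finite_Icc _ _
  refine (((hf.prod hf).preimage latHom_injective.injOn).prod
    (Set.finite_univ (α := Fin 6))).subset ?_
  rintro ⟨u, k⟩ ⟨z, hz, hzp⟩
  obtain ⟨h1, h2, -⟩ := hexagon_of_mem_kite hz
  have key : ∀ x y : ℝ, ∀ n : ℤ, |x - n| ≤ 2 → |x - y| ≤ 2 * R → |y| ≤ 2 * ‖p‖ →
      n ∈ (Set.Icc (-(⌈2 * R + 2 * ‖p‖ + 2⌉)) ⌈2 * R + 2 * ‖p‖ + 2⌉ : Set ℤ) := by
    intro x y n h1 h2 h3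
    have := Int.le_ceil (2 * R + 2 * ‖p‖ + 2)
    rw [abs_le] at h1 h2 h3
    constructor
    · exact_mod_cast (show -(⌈2 * R + 2 * ‖p‖ + 2⌉ : ℝ) ≤ n by linarith)
    · exact_mod_cast (show (n : ℝ) ≤ ⌈2 * R + 2 * ‖p‖ + 2⌉ by linarith)
  rw [cX_sub, cX_em] at h1
  rw [cY_sub, cY_em] at h2
  have h3 := hb (z - p)
  rw [cX_sub, cY_sub] at h3
  refine ⟨⟨key _ _ _ h1 (h3.1.trans (by linarith)) (hb p).1,
    key _ _ _ h2 (h3.2.trans (by linarith)) (hb p).2⟩, trivial⟩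

/-! ### Owners of germs -/

/-- The linear part of `form e`. -/
def lin (e : Fin 4) (z : ℂ) : ℝ := (coef e).2.1 * cX z + (coef e).2.2 * cY z

/-- The linear part of `form e` at `√3 * I * z`. -/
def linI (e : Fin 4) (z : ℂ) : ℝ :=
  (coef e).2.1 * (-cX z - 2 * cY z) + (coef e).2.2 * (2 * cX z + cY z)

theorem map_pull_germ (c : Cell) (p w : ℂ) (s : ℝ) :
    (germ p w s).map (pull c) = germ (pull c p) (zr (-c.2) * w) s := by
  have : pull c = fun z => zr (-c.2) * z + -(zr (-c.2) * em (latHom c.1)) := by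
    funext z; simp only [pull]; ring
  rw [this, map_germ]

def LexData (c : Cell) (p w : ℂ) (s : ℝ) (e : Fin 4) : Prop :=
  LexPos (form e (pull c p)) (lin e (zr (-c.2) * w)) (s * linI e (zr (-c.2) * w))

theorem eventually_okite {c : Cell} {p w : ℂ} {s : ℝ} (h : ∀ e, LexData c p w s e) :
    ∀ᶠ z in germ p w s, z ∈ okite c := by
  refine eventually_all.2 fun e => ?_
  have := eventually_germ_pos (h e)
  rw [← map_pull_germ, eventually_map] at this
  exact this

theorem lexData_or {c : Cell} {p w : ℂ} {s : ℝ} (hw : w ≠ 0) (hs : s ≠ 0) (e : Fin 4) :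
    LexData c p w s e ∨ ∀ᶠ z in germ p w s, form e (pull c z) < 0 := by
  have h0 : zr (-c.2) * w ≠ 0 := mul_ne_zero (zr_ne_zero _) hw
  have hne : lin e (zr (-c.2) * w) = 0 → s * linI e (zr (-c.2) * w) ≠ 0 := by
    generalize zr (-c.2) * w = v at h0
    intro h1 h2
    have h2 : linI e v = 0 := (mul_eq_zero.1 h2).resolve_left hs
    refine h0 (eq_of_coords ?_ ?_)
    · have : cX 0 = 0 := by simp [cX]
      rw [this]
      fin_cases e <;> simp [lin, linI, coef] at h1 h2 <;> linarith
    · have : cY 0 = 0 := by simp [cY]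
      rw [this]
      fin_cases e <;> simp [lin, linI, coef] at h1 h2 <;> linarith
  rcases lexPos_or (a := form e (pull c p)) hne with h | h
  · exact Or.inl h
  · right
    have := eventually_germ_pos (p := pull c p) (w := zr (-c.2) * w) (s := s)
      (a := -(coef e).2.1) (b := -(coef e).2.2) (c := -(coef e).1) (by
      convert h using 1
      · simp only [form]; ring
      · simp only [lin]; ring
      · simp only [linI]; ring)
    rw [← map_pull_germ, eventually_map] at this
    filter_upwards [this] with z hz
    simp only [form]
    linarith

/-- The kite `c` contains a germ. -/
def Own (c : Cell) (p w : ℂ) (s : ℝ) : Prop := ∀ᶠ z in germ p w s, z ∈ okite c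

theorem own_iff {c : Cell} {p w : ℂ} {s : ℝ} (hw : w ≠ 0) (hs : s ≠ 0) :
    Own c p w s ↔ ∀ e, LexData c p w s e := by
  refine ⟨fun h e => (lexData_or hw hs e).resolve_right fun h' => ?_, eventually_okite⟩
  obtain ⟨z, hz, hz'⟩ := (h.and h').exists
  exact (hz e).not_gt hz'

theorem own_or {p w : ℂ} {s : ℝ} (hw : w ≠ 0) (hs : s ≠ 0) (c : Cell) :
    Own c p w s ∨ ∀ᶠ z in germ p w s, z ∉ kite c := by
  by_cases h : ∀ e, LexData c p w s e
  · exact Or.inl (eventually_okite h)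
  · obtain ⟨e, he⟩ := not_forall.1 h
    right
    filter_upwards [(lexData_or hw hs e).resolve_left he] with z hz hz'
    exact (hz' e).not_gt hz

/-- In a locally finite cover by sets each of which is decided by the germ, some member owns the
germ. -/
theorem exists_eventually_mem {ι : Type*} {A B : ι → Set ℂ} {p w : ℂ} {s : ℝ} {F : Set ι}
    (hF : F.Finite) (hA : ∀ᶠ z in 𝓝 p, ∃ i ∈ F, z ∈ A i)
    (hd : ∀ i ∈ F, (∀ᶠ z in germ p w s, z ∈ B i) ∨ ∀ᶠ z in germ p w s, z ∉ A i) :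
    ∃ i ∈ F, ∀ᶠ z in germ p w s, z ∈ B i := by
  by_contra h
  have : ∀ᶠ z in germ p w s, ∀ i ∈ F, z ∉ A i :=
    (eventually_all_finite hF).2 fun i hi => (hd i hi).resolve_left fun hB => h ⟨i, hi, hB⟩
  obtain ⟨z, hz, i, hi, hz'⟩ := (this.and (germ_le_nhds p w s hA)).exists
  exact hz i hi hz'

theorem exists_own (p : ℂ) {w : ℂ} {s : ℝ} (hw : w ≠ 0) (hs : s ≠ 0) : ∃ c, Own c p w s := by
  have near : ∀ᶠ z in 𝓝 p, ∃ c ∈ {c | ∃ z ∈ kite c, ‖z - p‖ ≤ 1}, z ∈ kite c := by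
    filter_upwards [Metric.closedBall_mem_nhds p one_pos] with z hz
    obtain ⟨c, hc⟩ := exists_mem_kite z
    exact ⟨c, ⟨z, hc, by simpa [dist_eq_norm] using hz⟩, hc⟩
  obtain ⟨c, -, hc⟩ := exists_eventually_mem (finite_setOf_kite_near p 1) near
    fun c _ => own_or hw hs c
  exact ⟨c, hc⟩

theorem Own.eq {c c' : Cell} {p w : ℂ} {s : ℝ} (h : Own c p w s) (h' : Own c' p w s) : c = c' := by
  obtain ⟨z, hz, hz'⟩ := (h.and h').exists
  exact eq_of_mem_okite hz (okite_subset_kite _ hz')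

/-- Germs at lattice points, in integer coordinates. -/
def OwnZ (c : Cell) (p w : Eis) (s : ℤ) : Prop :=
  ∀ e : Fin 4, LexPos
    ((coef e).1 + (coef e).2.1 * (rotn (-c.2) (p - latHom c.1)).1 +
      (coef e).2.2 * (rotn (-c.2) (p - latHom c.1)).2)
    ((coef e).2.1 * (rotn (-c.2) w).1 + (coef e).2.2 * (rotn (-c.2) w).2)
    (s * ((coef e).2.1 * (-(rotn (-c.2) w).1 - 2 * (rotn (-c.2) w).2) +
      (coef e).2.2 * (2 * (rotn (-c.2) w).1 + (rotn (-c.2) w).2)))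

instance (c : Cell) (p w : Eis) (s : ℤ) : Decidable (OwnZ c p w s) := by
  unfold OwnZ; infer_instance

theorem OwnZ.own {c : Cell} {p w : Eis} {s : ℤ} (h : OwnZ c p w s) : Own c (em p) (em w) s := by
  refine eventually_okite fun e => ?_
  have := (h e).cast
  simp only [LexData, form, lin, linI, pull, ← em_sub, ← em_rotn, cX_em, cY_em]
  exact_mod_cast this

theorem own_smul {c : Cell} {p w : ℂ} {s : ℝ} {r : ℝ} (hr : 0 < r) (h : Own c p w s) :
    Own c p (r * w) s := by
  unfold Own at *
  rw [eventually_germ] at *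
  filter_upwards [h] with δ hδ
  have : Tendsto (fun ε : ℝ => r * ε) (𝓝[>] 0) (𝓝[>] 0) := by
    refine tendsto_nhdsWithin_iff.2 ⟨(Continuous.tendsto' (by fun_prop) 0 _ (by simp)).mono_left
      nhdsWithin_le_nhds, ?_⟩
    filter_upwards [self_mem_nhdsWithin] with ε hε using mul_pos hr hε
  filter_upwards [this.eventually hδ] with ε hε
  convert hε using 1
  push_cast
  ring

/-! ### Directions at multiples of `π/6` -/

def mulE (x y : Eis) : Eis := (x.1 * y.1 - x.2 * y.2, x.1 * y.2 + x.2 * y.1 + x.2 * y.2)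

theorem zeta_sq : zeta * zeta = zeta - 1 := by
  refine eq_of_coords ?_ ?_
  · rw [cX_zeta_mul, cX_sub]; simp [cX, cY, zeta]; field_simp; norm_num
  · rw [cY_zeta_mul, cY_sub]; simp [cX, cY, zeta]; field_simp; norm_num

theorem em_mulE (x y : Eis) : em (mulE x y) = em x * em y := by
  simp only [em, mulE]
  push_cast
  linear_combination -(x.2 : ℂ) * y.2 * zeta_sq

/-- The primitive twelfth root of unity in the first quadrant. -/
def eta1 : ℂ := (√3 : ℂ)⁻¹ * em (1, 1)

theorem sqrt3_mul_self_complex : (√3 : ℂ) * √3 = 3 := by exact_mod_cast sqrt3_mul_self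
theorem sqrt3_ne_zero_complex : (√3 : ℂ) ≠ 0 := by exact_mod_cast sqrt3_pos.ne'

theorem eta1_mul_self : eta1 * eta1 = zeta := by
  have h1 := sqrt3_mul_self_complex
  have h2 := sqrt3_ne_zero_complex
  have h3 : em (1, 1) * em (1, 1) = 3 * zeta := by
    simp only [em]; push_cast; linear_combination zeta_sq
  rw [eta1]
  field_simp
  rw [sq, sq, h3, h1]

theorem zeta_pow_six : zeta ^ 6 = 1 := by
  have := zr_mul_neg 1
  simpa [zr, ← pow_succ'] using this

def eta (k : Fin 12) : ℂ := eta1 ^ k.val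

theorem eta1_pow_mod (n : ℕ) : eta1 ^ (n % 12) = eta1 ^ n := by
  conv_rhs => rw [← Nat.div_add_mod n 12, pow_add, pow_mul]
  have : eta1 ^ 12 = 1 := by
    rw [show 12 = 2 * 6 from rfl, pow_mul, sq, eta1_mul_self, zeta_pow_six]
  rw [this, one_pow, one_mul]

theorem eta_add (j k : Fin 12) : eta (j + k) = eta j * eta k := by
  rw [eta, Fin.val_add, eta1_pow_mod, pow_add]; rfl

@[simp] theorem eta_zero : eta 0 = 1 := by simp [eta]

theorem eta_six : eta 6 = -1 := by
  rw [eta, show ((6 : Fin 12) : ℕ) = 2 * 3 from rfl, pow_mul, sq, eta1_mul_self]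
  linear_combination (zeta + 1) * zeta_sq

theorem eta_ne_zero (k : Fin 12) : eta k ≠ 0 := by
  have : eta k * eta (-k) = 1 := by rw [← eta_add]; simp
  exact left_ne_zero_of_mul_eq_one this

/-- A lattice vector in the direction of `eta k`. -/
def dir12 (k : Fin 12) : Eis :=
  rotn ⟨k.val / 2, by omega⟩ (if k.val % 2 = 0 then (1, 0) else (1, 1))

theorem eta_eq (k : Fin 12) : ∃ r : ℝ, 0 < r ∧ eta k = r * em (dir12 k) := by
  have hk := Nat.div_add_mod k.val 2
  have h : eta k = zr ⟨k.val / 2, by omega⟩ * eta1 ^ (k.val % 2) := by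
    rw [zr, eta, ← eta1_mul_self, ← sq, ← pow_mul, ← pow_add, hk]
  rw [dir12, em_rotn, h]
  rcases Nat.mod_two_eq_zero_or_one k.val with h0 | h0
  · exact ⟨1, one_pos, by simp [h0, em_one]⟩
  · refine ⟨(√3)⁻¹, inv_pos.2 sqrt3_pos, ?_⟩
    simp only [h0, pow_one, eta1, ofReal_inv]
    simp only [one_ne_zero, if_false]
    ring

theorem own_eta {c : Cell} {p : ℂ} {d : Eis} {k : Fin 12} {s : ℝ}
    (h : Own c p (em (mulE (dir12 k) d)) s) : Own c p (eta k * em d) s := by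
  obtain ⟨r, hr, e⟩ := eta_eq k
  rw [e, mul_assoc, ← em_mulE]
  exact own_smul hr h

/-! ### Edges of kites -/

/-- The start of an edge of the kite `(0, 0)`. -/
def st : Fin 4 → Eis := ![(0, 0), (2, -1), (2, 0), (1, 1)]

/-- The direction of an edge of the kite `(0, 0)`. -/
def dk : Fin 4 → Eis := ![(2, -1), (0, 1), (-1, 1), (-1, -1)]

/-- The neighbours of the kite `(0, 0)`. -/
def nbZero : Fin 4 → Cell := ![(0, 5), ((1, -1), 2), ((1, 0), 4), (0, 1)]

/-- The index of the edge as an edge of the neighbour. -/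
def opp : Fin 4 → Fin 4 := ![3, 2, 1, 0]

def startZ (c : Cell) (e : Fin 4) : Eis := rotn c.2 (st e) + latHom c.1
def dirZ (c : Cell) (e : Fin 4) : Eis := rotn c.2 (dk e)
def nb (c : Cell) (e : Fin 4) : Cell := Kite.act c.1 c.2 (nbZero e)

theorem startZ_act (u : Eis) (k : Fin 6) (c : Cell) (e : Fin 4) :
    startZ (Kite.act u k c) e = rotn k (startZ c e) + latHom u := by
  simp only [startZ, Kite.act, rotn_add, rotn_add_apply, map_add, latHom_rotn]
  abel

theorem dirZ_act (u : Eis) (k : Fin 6) (c : Cell) (e : Fin 4) :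
    dirZ (Kite.act u k c) e = rotn k (dirZ c e) := by
  simp only [dirZ, Kite.act, rotn_add_apply]

theorem startZ_nb (c : Cell) (e : Fin 4) : startZ (nb c e) (opp e) = startZ c e + dirZ c e := by
  have h : ∀ e, startZ (nbZero e) (opp e) = st e + dk e := by decide
  rw [nb, startZ_act, h, startZ, dirZ, rotn_add]
  abel

theorem dirZ_nb (c : Cell) (e : Fin 4) : dirZ (nb c e) (opp e) = -dirZ c e := by
  have h : ∀ e, dirZ (nbZero e) (opp e) = -dk e := by decide
  rw [nb, dirZ_act, h, rotn_neg, dirZ]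

/-- A point of an edge of a kite. -/
def edgePt (c : Cell) (e : Fin 4) (t : ℝ) : ℂ := em (startZ c e) + t * em (dirZ c e)

theorem edgePt_nb (c : Cell) (e : Fin 4) (t : ℝ) :
    edgePt (nb c e) (opp e) (1 - t) = edgePt c e t := by
  have : em (-dirZ c e) = -em (dirZ c e) := by
    rw [← zero_sub, em_sub, em_zero, zero_sub]
  rw [edgePt, startZ_nb, dirZ_nb, em_add, this, edgePt]
  push_cast
  ring

theorem pull_edgePt (c : Cell) (e : Fin 4) (t : ℝ) :
    pull c (edgePt c e t) = em (st e) + t * em (dk e) := by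
  simp only [pull, edgePt, startZ, dirZ, em_add, em_rotn]
  linear_combination (em (st e) + t * em (dk e)) * zr_neg_mul c.2

theorem zr_mul_dirZ (c : Cell) (e : Fin 4) : zr (-c.2) * em (dirZ c e) = em (dk e) := by
  rw [← em_rotn, dirZ, rotn_neg_rotn]

theorem own_edgePt {c : Cell} {e : Fin 4} {t : ℝ} (h0 : 0 < t) (h1 : t < 1) {w : ℂ} {s : ℝ}
    (h : LexPos 0 (lin e (zr (-c.2) * w)) (s * linI e (zr (-c.2) * w))) :
    Own c (edgePt c e t) w s := by
  refine eventually_okite fun e' => ?_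
  by_cases he : e' = e
  · subst he
    have : form e' (pull c (edgePt c e' t)) = 0 := by
      rw [pull_edgePt, form, cX_add, cY_add, cX_real_mul, cY_real_mul]
      fin_cases e' <;> simp [coef, st, dk] <;> ring
    rw [LexData, this]
    exact h
  · left
    rw [pull_edgePt, form, cX_add, cY_add, cX_real_mul, cY_real_mul]
    fin_cases e' <;> fin_cases e <;> simp [coef, st, dk] at he ⊢ <;> linarith

theorem own_edgePt_slot {c : Cell} {e : Fin 4} {t : ℝ} (h0 : 0 < t) (h1 : t < 1) {k : Fin 12}
    (hk : k.val < 6) : Own c (edgePt c e t) (eta k * em (dirZ c e)) 1 ∧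
      Own c (edgePt c e t) (eta (k + 1) * em (dirZ c e)) (-1) := by
  have key : ∀ k : Fin 12, ∀ e, k.val < 6 →
      LexPos 0 ((coef e).2.1 * (mulE (dir12 k) (dk e)).1 + (coef e).2.2 * (mulE (dir12 k) (dk e)).2)
        (1 * ((coef e).2.1 * (-(mulE (dir12 k) (dk e)).1 - 2 * (mulE (dir12 k) (dk e)).2) +
          (coef e).2.2 * (2 * (mulE (dir12 k) (dk e)).1 + (mulE (dir12 k) (dk e)).2))) ∧
      LexPos 0 ((coef e).2.1 * (mulE (dir12 (k + 1)) (dk e)).1 +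
          (coef e).2.2 * (mulE (dir12 (k + 1)) (dk e)).2)
        (-1 * ((coef e).2.1 * (-(mulE (dir12 (k + 1)) (dk e)).1 -
            2 * (mulE (dir12 (k + 1)) (dk e)).2) +
          (coef e).2.2 * (2 * (mulE (dir12 (k + 1)) (dk e)).1 +
            (mulE (dir12 (k + 1)) (dk e)).2))) := by
    decide +kernel
  have hp (j : Fin 12) : zr (-c.2) * em (mulE (dir12 j) (dirZ c e)) = em (mulE (dir12 j) (dk e)) := by
    rw [em_mulE, em_mulE, ← zr_mul_dirZ c e]; ring
  constructor
  · refine own_eta (own_edgePt h0 h1 ?_)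
    have := (key k e hk).1.cast
    rw [hp, lin, linI, cX_em, cY_em]
    exact_mod_cast this
  · refine own_eta (own_edgePt h0 h1 ?_)
    have := (key k e hk).2.cast
    rw [hp, lin, linI, cX_em, cY_em]
    exact_mod_cast this

theorem em_neg (x : Eis) : em (-x) = -em x := by rw [← zero_sub, em_sub, em_zero, zero_sub]

theorem own_nb_edgePt_slot {c : Cell} {e : Fin 4} {t : ℝ} (h0 : 0 < t) (h1 : t < 1) {k : Fin 12}
    (hk : 6 ≤ k.val) : Own (nb c e) (edgePt c e t) (eta k * em (dirZ c e)) 1 ∧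
      Own (nb c e) (edgePt c e t) (eta (k + 1) * em (dirZ c e)) (-1) := by
  have := own_edgePt_slot (c := nb c e) (e := opp e) (t := 1 - t) (by linarith) (by linarith)
    (k := k - 6) (by revert k; decide)
  have h6 (j : Fin 12) : eta j * -em (dirZ c e) = eta (j + 6) * em (dirZ c e) := by
    rw [eta_add, eta_six]; ring
  rwa [edgePt_nb, dirZ_nb, em_neg, h6, h6, sub_add_cancel, add_right_comm, sub_add_cancel] at this

theorem LexPos.nonneg {a b c : ℝ} (h : LexPos a b c) : 0 ≤ a := by
  rcases h with h | ⟨h, -⟩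
  exacts [h.le, h.ge]

theorem LexPos.pos {a b c : ℝ} (h : LexPos a b c) (hb : b < 0) : 0 < a := by
  rcases h with h | ⟨-, h | ⟨h, -⟩⟩
  exacts [h, (hb.not_gt h).elim, (hb.ne h).elim]

/-- A ray whose left side but not its right side lies in a kite is along the boundary. -/
theorem exists_edgePt {c : Cell} {p w : ℂ} (hw : w ≠ 0) (h : Own c p w 1) (h' : ¬ Own c p w (-1)) :
    ∃ e t r, 0 ≤ t ∧ t < 1 ∧ 0 < r ∧ p = edgePt c e t ∧ w = (r : ℝ) * em (dirZ c e) := by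
  have hl := (own_iff hw one_ne_zero).1 h
  rw [own_iff hw (by norm_num)] at h'
  obtain ⟨e, he⟩ := not_forall.1 h'
  have key : ∃ t r, 0 ≤ t ∧ t < 1 ∧ 0 < r ∧ pull c p = em (st e) + (t : ℝ) * em (dk e) ∧
      zr (-c.2) * w = (r : ℝ) * em (dk e) := by
    simp only [LexData, one_mul] at hl he
    generalize zr (-c.2) * w = v at *
    generalize pull c p = q at *
    have e1 := hl e
    have h1 : form e q = 0 ∧ lin e v = 0 ∧ 0 < linI e v := by
      unfold LexPos at e1 he
      rcases e1 with h1 | ⟨h1, h2 | ⟨h2, h3⟩⟩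
      · exact (he (Or.inl h1)).elim
      · exact (he (Or.inr ⟨h1, Or.inl h2⟩)).elim
      · exact ⟨h1, h2, h3⟩
    have g0 := hl 0
    have g1 := hl 1
    have g2 := hl 2
    have g3 := hl 3
    have hs : ∀ k : Fin 4, k = 0 ∨ k = 1 ∨ k = 2 ∨ k = 3 := by decide
    obtain ⟨h1, h2, h3⟩ := h1
    rcases hs e with rfl | rfl | rfl | rfl
    · have n0 := g3.nonneg
      have n1 : lin 1 v < 0 → 0 < form 1 q := g1.pos
      simp [form, lin, linI, coef] at h1 h2 h3 n0 n1
      refine ⟨cX q / 2, cX v / 2, by linarith, ?_, by linarith, eq_of_coords ?_ ?_, eq_of_coords ?_ ?_⟩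
      · linarith [n1 (by linarith)]
      all_goals simp only [cX_add, cY_add, cX_real_mul, cY_real_mul]; simp [st, dk]; try linarith
    · have n0 := g0.nonneg
      have n1 : lin 2 v < 0 → 0 < form 2 q := g2.pos
      simp [form, lin, linI, coef] at h1 h2 h3 n0 n1
      refine ⟨cY q + 1, cY v, by linarith, ?_, by linarith, eq_of_coords ?_ ?_, eq_of_coords ?_ ?_⟩
      · linarith [n1 (by linarith)]
      all_goals simp only [cX_add, cY_add, cX_real_mul, cY_real_mul]; simp [st, dk]; try linarith
    · have n0 := g1.nonneg
      have n1 : lin 3 v < 0 → 0 < form 3 q := g3.pos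
      simp [form, lin, linI, coef] at h1 h2 h3 n0 n1
      refine ⟨cY q, cY v, by linarith, ?_, by linarith, eq_of_coords ?_ ?_, eq_of_coords ?_ ?_⟩
      · linarith [n1 (by linarith)]
      all_goals simp only [cX_add, cY_add, cX_real_mul, cY_real_mul]; simp [st, dk]; try linarith
    · have n0 := g2.nonneg
      have n1 : lin 0 v < 0 → 0 < form 0 q := g0.pos
      simp [form, lin, linI, coef] at h1 h2 h3 n0 n1
      refine ⟨1 - cX q, -cX v, by linarith, ?_, by linarith, eq_of_coords ?_ ?_, eq_of_coords ?_ ?_⟩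
      · linarith [n1 (by linarith)]
      all_goals simp only [cX_add, cY_add, cX_real_mul, cY_real_mul]; simp [st, dk]; try linarith
  obtain ⟨t, r, ht, ht1, hr, hq, hv⟩ := key
  refine ⟨e, t, r, ht, ht1, hr, ?_, ?_⟩
  · rw [← pull_edgePt] at hq
    simp only [pull] at hq
    exact sub_left_injective (mul_left_cancel₀ (zr_ne_zero _) hq)
  · rw [← zr_mul_dirZ c e] at hv
    refine mul_left_cancel₀ (zr_ne_zero (-c.2)) ?_
    rw [hv]; ring

/-! ### The boundary of the hat -/

/-- The vertices of the hat and of its mirror image. -/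
def vtx : Bool → Fin 13 → Eis
  | false => ![(0, 0), (-1, -1), (0, -2), (2, -2), (2, -1), (4, -2), (5, -1), (4, 0), (3, 0), (2, 2),
      (0, 3), (0, 2), (-1, 2)]
  | true => ![(0, 0), (1, -2), (2, -2), (3, -3), (4, -2), (3, 0), (4, 0), (4, 1), (2, 2), (1, 1),
      (0, 2), (-2, 2), (-2, 1)]

/-- The interior angles, in units of `π/6`. -/
def ang : Bool → Fin 13 → ℕ
  | false => ![8, 3, 4, 4, 9, 4, 3, 4, 9, 4, 3, 8, 3]
  | true => ![8, 3, 8, 3, 4, 9, 4, 3, 4, 9, 4, 4, 3]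

/-- The directions of the edges. -/
def dirIx : Bool → Fin 13 → Fin 12
  | false => ![7, 10, 0, 2, 11, 1, 4, 6, 3, 5, 8, 6, 9]
  | true => ![9, 0, 10, 1, 3, 0, 2, 5, 7, 4, 6, 8, 11]

/-- The number of edges of kites in each edge. -/
def mult : Bool → Fin 13 → ℕ
  | false => ![1, 1, 2, 1, 1, 1, 1, 1, 1, 1, 1, 1, 1]
  | true => ![1, 1, 1, 1, 1, 1, 1, 1, 1, 1, 2, 1, 1]

theorem vtx_succ (m : Bool) (j : Fin 13) : vtx m (j + 1) = vtx m j + mult m j • dir12 (dirIx m j) := by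
  revert m j; decide

theorem dirIx_add_ang (m : Bool) (j : Fin 13) :
    Fin.ofNat 12 (ang m (j + 1)) + dirIx m (j + 1) = dirIx m j + 6 := by
  revert m j; decide

/-- The length of `dir12 k`. -/
def len12 (k : Fin 12) : ℝ := if k.val % 2 = 0 then 1 else √3

theorem em_dir12 (k : Fin 12) : em (dir12 k) = len12 k * eta k := by
  have h2 := sqrt3_ne_zero_complex
  have hk := Nat.div_add_mod k.val 2
  have h : eta k = zr ⟨k.val / 2, by omega⟩ * eta1 ^ (k.val % 2) := by
    rw [zr, eta, ← eta1_mul_self, ← sq, ← pow_mul, ← pow_add, hk]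
  rw [dir12, em_rotn, h, len12]
  rcases Nat.mod_two_eq_zero_or_one k.val with h0 | h0
  · simp [h0, em_one]
  · simp only [h0, pow_one, eta1, one_ne_zero, if_false]
    field_simp

theorem len12_pos (k : Fin 12) : 0 < len12 k := by
  unfold len12; split_ifs; exacts [one_pos, sqrt3_pos]

/-- The length of an edge. -/
def len (m : Bool) (j : Fin 13) : ℝ := mult m j * len12 (dirIx m j)

def vtxC (m : Bool) (j : Fin 13) : ℂ := em (vtx m j)

theorem em_nsmul (n : ℕ) (x : Eis) : em (n • x) = n * em x := by
  induction n with
  | zero => simp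
  | succ n ih => rw [succ_nsmul, em_add, ih]; push_cast; ring

theorem vtxC_succ (m : Bool) (j : Fin 13) : vtxC m (j + 1) = vtxC m j + len m j * eta (dirIx m j) := by
  rw [vtxC, vtx_succ, em_add, em_nsmul, em_dir12, vtxC, len]
  push_cast; ring

theorem eta_dirIx (m : Bool) (j : Fin 13) :
    eta (Fin.ofNat 12 (ang m (j + 1))) * eta (dirIx m (j + 1)) = -eta (dirIx m j) := by
  rw [← eta_add, dirIx_add_ang, eta_add, eta_six]; ring

/-- The union of the kites with the given cells. -/
def cellUnion (L : List Cell) : Set ℂ := ⋃ c ∈ L, kite c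

theorem mem_cellUnion {L : List Cell} {z : ℂ} : z ∈ cellUnion L ↔ ∃ c ∈ L, z ∈ kite c := by
  simp [cellUnion]

/-- The interior of `A` contains a germ. -/
def Inside (A : Set ℂ) (p w : ℂ) (s : ℝ) : Prop := ∀ᶠ z in germ p w s, z ∈ interior A

theorem okite_subset_interior {L : List Cell} {c : Cell} (hc : c ∈ L) :
    okite c ⊆ interior (cellUnion L) :=
  interior_maximal (fun _ hz => mem_cellUnion.2 ⟨c, hc, okite_subset_kite _ hz⟩) (isOpen_okite c)

theorem inside_of_own {L : List Cell} {c : Cell} (hc : c ∈ L) {p w : ℂ} {s : ℝ} (h : Own c p w s) :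
    Inside (cellUnion L) p w s := h.mono (okite_subset_interior hc)

theorem Inside.mem_of_own {L : List Cell} {c : Cell} {p w : ℂ} {s : ℝ} (h : Inside (cellUnion L) p w s)
    (hc : Own c p w s) : c ∈ L := by
  obtain ⟨z, hz, hz'⟩ := (h.and hc).exists
  obtain ⟨c', hc', h'⟩ := mem_cellUnion.1 (interior_subset hz)
  rwa [eq_of_mem_okite hz' h']

theorem inside_cellUnion_iff {L : List Cell} {p w : ℂ} {s : ℝ} (hw : w ≠ 0) (hs : s ≠ 0) :
    Inside (cellUnion L) p w s ↔ ∃ c ∈ L, Own c p w s := by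
  constructor
  · intro h
    obtain ⟨c, hc⟩ := exists_own p hw hs
    exact ⟨c, h.mem_of_own hc, hc⟩
  · rintro ⟨c, hc, h⟩
    exact inside_of_own hc h

theorem inside_or_cellUnion {p w : ℂ} {s : ℝ} (hw : w ≠ 0) (hs : s ≠ 0) (L : List Cell) :
    Inside (cellUnion L) p w s ∨ ∀ᶠ z in germ p w s, z ∉ cellUnion L := by
  by_cases h : ∃ c ∈ L, Own c p w s
  · exact Or.inl ((inside_cellUnion_iff hw hs).2 h)
  · right
    have : ∀ᶠ z in germ p w s, ∀ c ∈ L.toFinset, z ∉ kite c := by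
      rw [Filter.eventually_all_finset]
      intro c hc
      exact (own_or hw hs c).resolve_left fun h' => h ⟨c, List.mem_toFinset.1 hc, h'⟩
    filter_upwards [this] with z hz hz'
    obtain ⟨c, hc, hzc⟩ := mem_cellUnion.1 hz'
    exact hz c (List.mem_toFinset.2 hc) hzc

/-- The germs at `p` inside `A` are those of the `b` sectors of angle `π/6` following the ray `w`. -/
def Arc (A : Set ℂ) (p w : ℂ) (b : ℕ) : Prop :=
  ∀ k : Fin 12, (Inside A p (eta k * w) 1 ↔ k.val < b) ∧ (Inside A p (eta (k + 1) * w) (-1) ↔ k.val < b)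

/-- The hat, or its mirror image. -/
def hat (m : Bool) : Set ℂ := cellUnion (hatCells m)

/-- `Arc` for the hat, in integer coordinates. -/
def ArcZ (m : Bool) (p : Eis) (d : Fin 12) (b : ℕ) : Prop :=
  ∀ k : Fin 12, ((∃ c ∈ hatCells m, OwnZ c p (dir12 (k + d)) 1) ↔ k.val < b) ∧
    ((∃ c ∈ hatCells m, OwnZ c p (dir12 (k + 1 + d)) (-1)) ↔ k.val < b)

instance (m : Bool) (p : Eis) (d : Fin 12) (b : ℕ) : Decidable (ArcZ m p d b) := by
  unfold ArcZ; infer_instance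

theorem em_ne_zero {x : Eis} (h : x ≠ 0) : em x ≠ 0 := fun h' => h (em_injective (by rw [h', em_zero]))

theorem own_iff_ownZ {c : Cell} {p w : Eis} {s : ℤ} (hw : w ≠ 0) (hs : s ≠ 0) :
    Own c (em p) (em w) s ↔ OwnZ c p w s := by
  refine ⟨fun h => ?_, OwnZ.own⟩
  rw [own_iff (em_ne_zero hw) (by exact_mod_cast hs)] at h
  intro e
  have := h e
  simp only [LexData, form, lin, linI, pull, ← em_sub, ← em_rotn, cX_em, cY_em] at this
  unfold LexPos at *
  exact_mod_cast this

theorem own_eta_iff {c : Cell} {p : Eis} {k : Fin 12} {s : ℤ} (hs : s ≠ 0) :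
    Own c (em p) (eta k) s ↔ OwnZ c p (dir12 k) s := by
  have h0 : dir12 k ≠ 0 := by revert k; decide
  rw [← own_iff_ownZ h0 hs, em_dir12]
  refine ⟨own_smul (len12_pos k), fun h => ?_⟩
  have := own_smul (inv_pos.2 (len12_pos k)) h
  rwa [← mul_assoc, ← ofReal_mul, inv_mul_cancel₀ (len12_pos k).ne', ofReal_one, one_mul] at this

theorem ArcZ.arc {m : Bool} {p : Eis} {d : Fin 12} {b : ℕ} (h : ArcZ m p d b) :
    Arc (hat m) (em p) (eta d) b := by
  intro k
  have h1 := fun (c : Cell) (k : Fin 12) => own_eta_iff (c := c) (p := p) (k := k) (s := 1) one_ne_zero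
  have h2 := fun (c : Cell) (k : Fin 12) => own_eta_iff (c := c) (p := p) (k := k) (s := -1) (by decide)
  simp only [Int.cast_one, Int.cast_neg] at h1 h2
  rw [← eta_add, ← eta_add, hat, inside_cellUnion_iff (eta_ne_zero _) one_ne_zero,
    inside_cellUnion_iff (eta_ne_zero _) (by norm_num)]
  simp only [h1, h2]
  exact h k

theorem arc_vtx (m : Bool) (j : Fin 13) : Arc (hat m) (vtxC m j) (eta (dirIx m j)) (ang m j) := by
  have : ∀ m j, ArcZ m (vtx m j) (dirIx m j) (ang m j) := by decide +kernel
  exact (this m j).arc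

theorem arc_edgePt {m : Bool} {c : Cell} {e : Fin 4} (hc : c ∈ hatCells m) (hn : nb c e ∉ hatCells m)
    {t : ℝ} (h0 : 0 < t) (h1 : t < 1) {w : ℂ} {r : ℝ} (hr : 0 < r) (hw : w = r * em (dirZ c e)) :
    Arc (hat m) (edgePt c e t) w 6 := by
  have sm {c' : Cell} {k : Fin 12} {s : ℝ} (h : Own c' (edgePt c e t) (eta k * em (dirZ c e)) s) :
      Own c' (edgePt c e t) (eta k * w) s := by
    rw [hw, mul_left_comm]
    exact own_smul hr h
  intro k
  by_cases hk : k.val < 6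
  · have := own_edgePt_slot (c := c) (e := e) h0 h1 hk
    simp only [hk, iff_true]
    exact ⟨inside_of_own hc (sm this.1), inside_of_own hc (sm this.2)⟩
  · have := own_nb_edgePt_slot (c := c) (e := e) h0 h1 (not_lt.1 hk)
    simp only [hk, iff_false]
    exact ⟨fun h => hn (h.mem_of_own (sm this.1)), fun h => hn (h.mem_of_own (sm this.2))⟩

theorem exists_kite_edge (m : Bool) (j : Fin 13) (n : Fin 2) (hn : n.val < mult m j) :
    ∃ c ∈ hatCells m, ∃ e, nb c e ∉ hatCells m ∧ startZ c e = vtx m j + n.val • dir12 (dirIx m j) ∧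
      dirZ c e = dir12 (dirIx m j) := by
  revert m j n; decide +kernel

theorem arc_edge {m : Bool} {j : Fin 13} {x : ℝ} (h0 : 0 < x) (h1 : x < len m j) :
    Arc (hat m) (vtxC m j + x * eta (dirIx m j)) (eta (dirIx m j)) 6 := by
  have hl := len12_pos (dirIx m j)
  have piece (n : Fin 2) (hn : n.val < mult m j) {t : ℝ} (h0 : 0 < t) (h1 : t < 1)
      (hx : x = (n.val + t) * len12 (dirIx m j)) :
      Arc (hat m) (vtxC m j + x * eta (dirIx m j)) (eta (dirIx m j)) 6 := by
    obtain ⟨c, hc, e, hne, hs, hd⟩ := exists_kite_edge m j n hn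
    have : edgePt c e t = vtxC m j + x * eta (dirIx m j) := by
      rw [edgePt, hs, hd, em_add, em_nsmul, em_dir12, hx, vtxC]
      push_cast; ring
    rw [← this]
    refine arc_edgePt hc hne h0 h1 (inv_pos.2 hl) ?_
    rw [hd, em_dir12, ← mul_assoc, ← ofReal_mul, inv_mul_cancel₀ hl.ne', ofReal_one, one_mul]
  have hm : ∀ m j, mult m j = 1 ∨ mult m j = 2 := by decide
  replace hm := hm m j
  have hf : mult m j = 2 → ArcZ m (vtx m j + dir12 (dirIx m j)) (dirIx m j) 6 := by
    have : ∀ m j, mult m j = 2 → ArcZ m (vtx m j + dir12 (dirIx m j)) (dirIx m j) 6 := by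
      decide +kernel
    exact this m j
  rw [len] at h1
  have hx : x = x / len12 (dirIx m j) * len12 (dirIx m j) := by field_simp
  have h0' : 0 < x / len12 (dirIx m j) := div_pos h0 hl
  rcases hm with hm | hm
  · rw [hm] at h1
    refine piece 0 (by rw [hm]; decide) h0' ((div_lt_one hl).2 (by simpa using h1)) ?_
    simpa using hx
  · rw [hm] at h1
    rcases lt_trichotomy (x / len12 (dirIx m j)) 1 with h | h | h
    · refine piece 0 (by rw [hm]; decide) h0' h ?_
      simpa using hx
    · have := (hf hm).arc
      rw [h, one_mul] at hx
      rwa [em_add, em_dir12, ← hx] at this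
    · refine piece 1 (by rw [hm]; decide) (sub_pos.2 h) ?_ ?_ (t := x / len12 (dirIx m j) - 1)
      · rw [sub_lt_iff_lt_add, div_lt_iff₀ hl]
        norm_num at h1 ⊢
        exact h1
      · simpa using hx

/-- A ray whose left side but not its right side lies in the hat is along the boundary. -/
theorem exists_edge {m : Bool} {p w : ℂ} (hw : ‖w‖ = 1) (h : Inside (hat m) p w 1)
    (h' : ¬ Inside (hat m) p w (-1)) :
    ∃ j x, 0 ≤ x ∧ x < len m j ∧ p = vtxC m j + (x : ℝ) * eta (dirIx m j) ∧ w = eta (dirIx m j) := by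
  have hw0 : w ≠ 0 := by rintro rfl; simp at hw
  obtain ⟨c, hc, ho⟩ := (inside_cellUnion_iff hw0 one_ne_zero).1 h
  have ho' : ¬ Own c p w (-1) := fun h2 => h' (inside_of_own hc h2)
  obtain ⟨e, t, r, ht, ht1, hr, rfl, rfl⟩ := exists_edgePt hw0 ho ho'
  have hnb : nb c e ∉ hatCells m := by
    intro hn
    refine h' (inside_of_own hn (own_smul hr ?_))
    rcases ht.eq_or_lt with rfl | ht
    · have key : ∀ e, OwnZ (nbZero e) (st e) (dk e) (-1) := by decide
      have := (key e).own
      rw [Own] at this ⊢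
      have e1 := map_germ (u := zr c.2) (em (latHom c.1)) (em (st e)) (em (dk e)) (-1)
      have e2 : edgePt c e 0 = zr c.2 * em (st e) + em (latHom c.1) := by
        simp [edgePt, startZ, em_add, em_rotn]
      rw [e2, dirZ, em_rotn, ← e1, eventually_map]
      simp only [Int.cast_neg, Int.cast_one] at this
      filter_upwards [this] with z hz
      exact mem_okite_act.2 hz
    · have := (own_nb_edgePt_slot (c := c) (e := e) ht ht1 (k := 11) (by decide)).2
      simpa using this
  have key : ∀ m, ∀ c ∈ hatCells m, ∀ e, nb c e ∉ hatCells m → ∃ j, ∃ n : Fin 2, n.val < mult m j ∧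
      startZ c e = vtx m j + n.val • dir12 (dirIx m j) ∧ dirZ c e = dir12 (dirIx m j) := by
    decide +kernel
  obtain ⟨j, n, hn, hs, hd⟩ := key m c hc e hnb
  have hl := len12_pos (dirIx m j)
  refine ⟨j, (n.val + t) * len12 (dirIx m j), by positivity, ?_, ?_, ?_⟩
  · rw [len]
    have : (n.val : ℝ) + 1 ≤ mult m j := by exact_mod_cast hn
    nlinarith
  · rw [edgePt, hs, hd, em_add, em_nsmul, em_dir12, vtxC]
    push_cast; ring
  · have e3 : ‖eta (dirIx m j)‖ = 1 := by
      have h2 := sqrt3_ne_zero_complex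
      have : ‖eta (dirIx m j)‖ ^ 12 = 1 := by
        rw [← norm_pow, eta, ← pow_mul, mul_comm, pow_mul, ← eta1_pow_mod]
        simp
      exact (pow_eq_one_iff_of_nonneg (norm_nonneg _) (by norm_num)).1 this
    rw [hd, em_dir12, ← mul_assoc, ← ofReal_mul] at hw ⊢
    rw [norm_mul, e3, mul_one, norm_real, Real.norm_of_nonneg (by positivity)] at hw
    rw [hw, ofReal_one, one_mul]

/-! ### Copies of the hat -/

theorem norm_le_coords (z : ℂ) : ‖z‖ ≤ |cX z| + |cY z| := by
  have hz : z = (cX z : ℂ) * em (1, 0) + (cY z : ℂ) * em (0, 1) := by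
    refine eq_of_coords ?_ ?_
    · simp [cX_add, cX_real_mul]
    · simp [cY_add, cY_real_mul]
  have h1 : ‖em (0, 1)‖ = 1 := by
    have : ‖em (0, 1)‖ ^ 6 = 1 := by rw [← norm_pow]; simp [em, zeta_pow_six]
    exact (pow_eq_one_iff_of_nonneg (norm_nonneg _) (by norm_num)).1 this
  calc ‖z‖ = _ := congrArg norm hz
    _ ≤ _ := norm_add_le _ _
    _ = _ := by rw [norm_mul, norm_mul, h1, em_one]; simp

theorem isCompact_kite (c : Cell) : IsCompact (kite c) := by
  refine Metric.isCompact_of_isClosed_isBounded (isClosed_kite c) ?_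
  refine (Metric.isBounded_iff_subset_closedBall (em (latHom c.1))).2 ⟨4, fun z hz => ?_⟩
  obtain ⟨h1, h2, -⟩ := hexagon_of_mem_kite hz
  rw [Metric.mem_closedBall, dist_eq_norm]
  linarith [norm_le_coords (z - em (latHom c.1))]

theorem isCompact_cellUnion (L : List Cell) : IsCompact (cellUnion L) := by
  have : cellUnion L = ⋃ c ∈ {c | c ∈ L}, kite c := rfl
  rw [this]
  exact L.finite_toSet.isCompact_biUnion fun c _ => isCompact_kite c

/-- A placement of the hat or of its mirror image: `z ↦ u * z + t`. -/
structure Pose where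
  m : Bool
  u : ℂ
  t : ℂ
  norm_u : ‖u‖ = 1

namespace Pose

variable (X Y : Pose)

theorem u_ne_zero : X.u ≠ 0 := fun h => by simpa [h] using X.norm_u

/-- The isometry of the plane. -/
def homeo : ℂ ≃ₜ ℂ := (Homeomorph.mulLeft₀ X.u X.u_ne_zero).trans (Homeomorph.addRight X.t)

theorem homeo_apply (z : ℂ) : X.homeo z = X.u * z + X.t := rfl

/-- The region covered. -/
def body : Set ℂ := X.homeo '' hat X.m

/-- The germs at `p` inside `A` are inside the image of `A`. -/
theorem inside_body_iff {p w : ℂ} {s : ℝ} :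
    Inside X.body (X.homeo p) (X.u * w) s ↔ Inside (hat X.m) p w s := by
  rw [Inside, homeo_apply, ← map_germ X.t p w s, eventually_map, body, ← X.homeo.image_interior]
  exact eventually_congr (Eventually.of_forall fun z => X.homeo.injective.mem_set_image (a := z))

theorem exists_preimage (p w : ℂ) : ∃ p' w', p = X.homeo p' ∧ w = X.u * w' :=
  ⟨X.homeo.symm p, X.u⁻¹ * w, by simp, by rw [mul_inv_cancel_left₀ X.u_ne_zero]⟩

theorem inside_or {p w : ℂ} {s : ℝ} (hw : w ≠ 0) (hs : s ≠ 0) :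
    Inside X.body p w s ∨ ∀ᶠ z in germ p w s, z ∉ X.body := by
  obtain ⟨p, w, rfl, rfl⟩ := X.exists_preimage p w
  rw [inside_body_iff, homeo_apply, ← map_germ X.t p w s, eventually_map]
  refine (inside_or_cellUnion (right_ne_zero_of_mul hw) hs (hatCells X.m)).imp id fun h => ?_
  filter_upwards [h] with z hz hz'
  exact hz (X.homeo.injective.mem_set_image.1 hz')

theorem arc_body_iff {p w : ℂ} {b : ℕ} :
    Arc X.body (X.homeo p) (X.u * w) b ↔ Arc (hat X.m) p w b := by
  simp only [Arc, ← inside_body_iff X, mul_left_comm]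

/-- The vertices. -/
def P (j : Fin 13) : ℂ := X.homeo (vtxC X.m j)

/-- The directions of the edges. -/
def D (j : Fin 13) : ℂ := X.u * eta (dirIx X.m j)

theorem arc_P (j : Fin 13) : Arc X.body (X.P j) (X.D j) (ang X.m j) :=
  X.arc_body_iff.2 (arc_vtx _ _)

theorem homeo_add (p v : ℂ) : X.homeo (p + v) = X.homeo p + X.u * v := by
  simp only [homeo_apply]; ring

theorem P_succ (j : Fin 13) : X.P (j + 1) = X.P j + len X.m j * X.D j := by
  rw [P, vtxC_succ, homeo_add, P, D, mul_left_comm]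

theorem eta1_pow_mul_D (j : Fin 13) : eta1 ^ ang X.m (j + 1) * X.D (j + 1) = -X.D j := by
  have := eta_dirIx X.m j
  rw [eta, Fin.val_ofNat, eta1_pow_mod] at this
  rw [D, mul_left_comm, this, D, mul_neg]

theorem arc_D {j : Fin 13} {x : ℝ} (h0 : 0 < x) (h1 : x < len X.m j) :
    Arc X.body (X.P j + x * X.D j) (X.D j) 6 := by
  have := X.arc_body_iff.2 (arc_edge h0 h1)
  rwa [homeo_add, mul_left_comm] at this

/-- The tile starts an arc of size `b` at the ray. -/
def Start (p w : ℂ) (b : ℕ) : Prop :=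
  (∃ j, p = X.P j ∧ w = X.D j ∧ b = ang X.m j) ∨
    (b = 6 ∧ ∃ j, ∃ x : ℝ, 0 < x ∧ x < len X.m j ∧ p = X.P j + x * X.D j ∧ w = X.D j)

variable {X Y}

theorem Start.arc {p w : ℂ} {b : ℕ} (h : X.Start p w b) : Arc X.body p w b := by
  rcases h with ⟨j, rfl, rfl, rfl⟩ | ⟨rfl, j, x, h0, h1, rfl, rfl⟩
  exacts [X.arc_P j, X.arc_D h0 h1]

theorem norm_eta1 : ‖eta1‖ = 1 := by
  have : ‖eta1‖ ^ 12 = 1 := by rw [← norm_pow, ← eta1_pow_mod]; simp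
  exact (pow_eq_one_iff_of_nonneg (norm_nonneg _) (by norm_num)).1 this

theorem norm_D (j : Fin 13) : ‖X.D j‖ = 1 := by
  rw [D, norm_mul, X.norm_u, eta, norm_pow, norm_eta1]; simp

theorem exists_start {p w : ℂ} (hw : ‖w‖ = 1) (h : Inside X.body p w 1)
    (h' : ¬ Inside X.body p w (-1)) : ∃ b, X.Start p w b := by
  obtain ⟨p, w, rfl, rfl⟩ := X.exists_preimage p w
  rw [inside_body_iff] at h h'
  rw [norm_mul, X.norm_u, one_mul] at hw
  obtain ⟨j, x, h0, h1, rfl, rfl⟩ := exists_edge hw h h'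
  rcases h0.eq_or_lt with rfl | h0
  · exact ⟨_, Or.inl ⟨j, by simp [P], rfl, rfl⟩⟩
  · refine ⟨6, Or.inr ⟨rfl, j, x, h0, h1, ?_, rfl⟩⟩
    rw [homeo_add, mul_left_comm]; rfl

theorem ang_mem (m : Bool) (j : Fin 13) : ang m j ∈ ({3, 4, 8, 9} : Finset ℕ) := by
  revert m j; decide

theorem Start.size {p w : ℂ} {b : ℕ} (h : X.Start p w b) :
    b = 3 ∨ b = 4 ∨ b = 6 ∨ b = 8 ∨ b = 9 := by
  rcases h with ⟨j, -, -, rfl⟩ | ⟨rfl, -⟩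
  · have := ang_mem X.m j
    simp at this; tauto
  · simp

end Pose

/-- A set of placements tiling the plane. -/
structure PoseTiling (S : Set Pose) : Prop where
  cover : ∀ z, ∃ X ∈ S, z ∈ X.body
  disj : S.Pairwise fun X Y => Disjoint (interior X.body) (interior Y.body)

theorem Inside.not_disjoint {A B : Set ℂ} {p w : ℂ} {s : ℝ} (h : Inside A p w s)
    (h' : Inside B p w s) : ¬ Disjoint (interior A) (interior B) := by
  obtain ⟨z, hz, hz'⟩ := (h.and h').exists
  exact fun hd => Set.disjoint_left.1 hd hz hz'

theorem exists_ball_subset_hat (m : Bool) : ∃ c : ℂ, ∃ r > 0, Metric.ball c r ⊆ interior (hat m) := by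
  have h := ((arc_vtx m 0 0).1).2 (by revert m; decide)
  obtain ⟨z, hz⟩ := h.exists
  obtain ⟨r, hr, h⟩ := Metric.isOpen_iff.1 isOpen_interior z hz
  exact ⟨z, r, hr, h⟩

theorem Pose.ball_subset_body (X : Pose) {c : ℂ} {r : ℝ} (h : Metric.ball c r ⊆ interior (hat X.m)) :
    Metric.ball (X.homeo c) r ⊆ interior X.body := by
  intro z hz
  rw [body, ← X.homeo.image_interior]
  refine ⟨X.homeo.symm z, h ?_, by simp⟩
  have e : X.homeo (X.homeo.symm z) = z := by simp
  generalize X.homeo.symm z = y at *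
  rw [Metric.mem_ball, dist_eq_norm] at *
  rw [← e, homeo_apply, homeo_apply, add_sub_add_right_eq_sub, ← mul_sub, norm_mul, X.norm_u,
    one_mul] at hz
  exact hz

namespace PoseTiling

variable {S : Set Pose} (hS : PoseTiling S)
include hS

theorem eq_of_inside {X Y : Pose} (hX : X ∈ S) (hY : Y ∈ S) {p w : ℂ} {s : ℝ}
    (h : Inside X.body p w s) (h' : Inside Y.body p w s) : X = Y := by
  by_contra hne
  exact h.not_disjoint h' (hS.disj hX hY hne)

theorem finite_near (p : ℂ) : {X ∈ S | ∃ z ∈ X.body, ‖z - p‖ ≤ 1}.Finite := by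
  have hm (m : Bool) : {X ∈ S | X.m = m ∧ ∃ z ∈ X.body, ‖z - p‖ ≤ 1}.Finite := by
    obtain ⟨c, r, hr, hc⟩ := exists_ball_subset_hat m
    obtain ⟨R, hR⟩ := (isCompact_cellUnion (hatCells m)).isBounded.subset_closedBall c
    set T := {X ∈ S | X.m = m ∧ ∃ z ∈ X.body, ‖z - p‖ ≤ 1}
    have hsep : ∀ X ∈ T, ∀ Y ∈ T, dist (X.homeo c) (Y.homeo c) < r → X = Y := by
      rintro X ⟨hX, hXm, -⟩ Y ⟨hY, hYm, -⟩ hd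
      by_contra hne
      exact Set.disjoint_left.1 (hS.disj hX hY hne)
        (X.ball_subset_body (by rwa [hXm]) (Metric.mem_ball_self hr))
        (Y.ball_subset_body (by rwa [hYm]) hd)
    have hb : TotallyBounded ((fun X : Pose => X.homeo c) '' T) := by
      refine TotallyBounded.subset ?_ (isCompact_closedBall p (R + 1)).totallyBounded
      rintro _ ⟨X, ⟨-, rfl, z, ⟨y, hy, rfl⟩, hz⟩, rfl⟩
      have h1 : ‖X.homeo c - X.homeo y‖ = ‖y - c‖ := by
        rw [X.homeo_apply, X.homeo_apply, add_sub_add_right_eq_sub, ← mul_sub, norm_mul, X.norm_u,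
          one_mul, norm_sub_rev]
      have h2 := hR hy
      rw [Metric.mem_closedBall, dist_eq_norm] at h2 ⊢
      have := norm_sub_le_norm_sub_add_norm_sub (X.homeo c) (X.homeo y) p
      linarith
    obtain ⟨t, ht, hf, hc⟩ := Metric.finite_approx_of_totallyBounded hb r hr
    refine Set.Finite.of_finite_image (hf.subset ?_) (f := fun X : Pose => X.homeo c) ?_
    · rintro _ ⟨X, hX, rfl⟩
      obtain ⟨y, hy, hd⟩ := Set.mem_iUnion₂.1 (hc ⟨X, hX, rfl⟩)
      obtain ⟨Y, hY, rfl⟩ := ht hy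
      rwa [hsep X hX Y hY hd]
    · intro X hX Y hY h
      exact hsep X hX Y hY (by simpa [h] using hr)
  refine ((hm false).union (hm true)).subset fun X ⟨hX, h⟩ => ?_
  cases hX' : X.m
  exacts [Or.inl ⟨hX, hX', h⟩, Or.inr ⟨hX, hX', h⟩]

theorem exists_inside (p : ℂ) {w : ℂ} {s : ℝ} (hw : w ≠ 0) (hs : s ≠ 0) :
    ∃ X ∈ S, Inside X.body p w s := by
  have near : ∀ᶠ z in 𝓝 p, ∃ X ∈ {X ∈ S | ∃ z ∈ X.body, ‖z - p‖ ≤ 1}, z ∈ X.body := by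
    filter_upwards [Metric.closedBall_mem_nhds p one_pos] with z hz
    obtain ⟨X, hX, hzX⟩ := hS.cover z
    exact ⟨X, ⟨hX, z, hzX, by rwa [Metric.mem_closedBall, dist_eq_norm] at hz⟩, hzX⟩
  obtain ⟨X, hX, h⟩ := exists_eventually_mem (hS.finite_near p) near
    fun X _ => X.inside_or (p := p) (w := w) (s := s) hw hs
  exact ⟨X, hX.1, h⟩

end PoseTiling

/-! ### Tiles around a vertex -/

theorem Arc.left {A : Set ℂ} {p w : ℂ} {b n : ℕ} (h : Arc A p w b) (hn : n < 12) :
    Inside A p (eta1 ^ n * w) 1 ↔ n < b := (h ⟨n, hn⟩).1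

theorem Arc.right {A : Set ℂ} {p w : ℂ} {b n : ℕ} (h : Arc A p w b) (hn : n < 12) :
    Inside A p (eta1 ^ (n + 1) * w) (-1) ↔ n < b := by
  have := (h ⟨n, hn⟩).2
  rw [eta, Fin.val_add] at this
  change Inside A p (eta1 ^ ((n + 1) % 12) * w) (-1) ↔ n < b at this
  rwa [eta1_pow_mod] at this

theorem eta1_pow_twelve : eta1 ^ 12 = 1 := by rw [← eta1_pow_mod]; simp

theorem eta1_pow_six : eta1 ^ 6 = -1 := eta_six

theorem norm_eta1_pow_mul (n : ℕ) (w : ℂ) : ‖eta1 ^ n * w‖ = ‖w‖ := by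
  rw [norm_mul, norm_pow, Pose.norm_eta1, one_pow, one_mul]

/-- The end of edge `i` of `X` is the start of edge `j` of `Y`, and the edges share a ray. -/
def Touch (X : Pose) (i : Fin 13) (Y : Pose) (j : Fin 13) : Prop :=
  X.P (i + 1) = Y.P j ∧ Y.D j = -X.D i

/-- The parity of the direction of an edge. -/
def par (m : Bool) (j : Fin 13) : ℕ := (dirIx m j).val % 2

theorem len_cases (m : Bool) (j : Fin 13) :
    par m j = 0 ∧ (len m j = 1 ∨ len m j = 2) ∨ par m j = 1 ∧ len m j = √3 := by
  have key : ∀ m j, par m j = 0 ∧ (mult m j = 1 ∨ mult m j = 2) ∨ par m j = 1 ∧ mult m j = 1 := by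
    decide
  simp only [len, len12]
  have := key m j
  unfold par at *
  rcases this with ⟨h1, h2 | h2⟩ | ⟨h1, h2⟩ <;> simp [h1, h2]

theorem sqrt3_gt : (1.5 : ℝ) < √3 := Real.lt_sqrt_of_sq_lt (by norm_num)
theorem sqrt3_lt : √3 < 2 := (Real.sqrt_lt' two_pos).2 (by norm_num)

theorem one_le_len (m : Bool) (j : Fin 13) : 1 ≤ len m j := by
  have := sqrt3_gt
  rcases len_cases m j with ⟨-, h | h⟩ | ⟨-, h⟩ <;> rw [h] <;> linarith

theorem len_sub_lt {m m' : Bool} {i j : Fin 13} (h : par m i ≠ par m' j) :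
    len m i < len m' j ∧ len m' j - len m i < 1 ∨ len m' j < len m i ∧ len m i - len m' j < 1 := by
  have h1 := sqrt3_gt
  have h2 := sqrt3_lt
  rcases len_cases m i with ⟨h3, h4 | h4⟩ | ⟨h3, h4⟩ <;>
    rcases len_cases m' j with ⟨h5, h6 | h6⟩ | ⟨h5, h6⟩ <;> rw [h4, h6] <;>
    first
    | exact (h (h3.trans h5.symm)).elim
    | (left; constructor <;> linarith)
    | (right; constructor <;> linarith)

namespace Pose

theorem Start.vertex {X : Pose} {p w : ℂ} {b : ℕ} (h : X.Start p w b) (hb : b ≠ 6) :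
    ∃ j, p = X.P (j + 1) ∧ w = X.D (j + 1) ∧ b = ang X.m (j + 1) := by
  rcases h with ⟨j, h⟩ | ⟨h, -⟩
  · exact ⟨j - 1, by rwa [sub_add_cancel]⟩
  · exact (hb h).elim

theorem Start.three_le {X : Pose} {p w : ℂ} {b : ℕ} (h : X.Start p w b) : 3 ≤ b := by
  have := h.size
  omega

theorem P_eq (X : Pose) (i : Fin 13) : X.P i = X.P (i + 1) - len X.m i * X.D i := by
  rw [P_succ]; ring

end Pose

namespace PoseTiling

variable {S : Set Pose} (hS : PoseTiling S)
include hS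

theorem next {X : Pose} (hX : X ∈ S) {p w : ℂ} {c : ℕ} (hw : ‖w‖ = 1) (h : Arc X.body p w c)
    (h0 : 0 < c) (h1 : c < 12) : ∃ Y ∈ S, ∃ b, Y.Start p (eta1 ^ c * w) b := by
  have hw' : ‖eta1 ^ c * w‖ = 1 := by rw [norm_eta1_pow_mul, hw]
  have h2 : eta1 ^ c * w ≠ 0 := by intro h; simp [h] at hw'
  obtain ⟨Y, hY, h3⟩ := hS.exists_inside p h2 one_ne_zero
  refine ⟨Y, hY, Pose.exists_start hw' h3 fun h4 => ?_⟩
  obtain ⟨n, rfl⟩ := Nat.exists_eq_succ_of_ne_zero h0.ne'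
  obtain rfl := hS.eq_of_inside hX hY ((h.right (by omega)).2 n.lt_succ_self) h4
  exact lt_irrefl _ ((h.left h1).1 h3)

theorem fit {X Y : Pose} (hX : X ∈ S) (hY : Y ∈ S) {p w : ℂ} {a b n : ℕ} (h : Arc X.body p w a)
    (h' : Arc Y.body p (eta1 ^ n * w) b) (ha : 0 < a) (han : a ≤ n) (hn : n < 12) (hb : 0 < b) :
    n + b ≤ 12 := by
  by_contra hlt
  have h1 := (h.left (n := 0) (by norm_num)).2 ha
  have h2 := (h'.left (n := 12 - n) (by omega)).2 (by omega)
  rw [← mul_assoc, ← pow_add, Nat.sub_add_cancel hn.le, eta1_pow_twelve, one_mul] at h2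
  rw [pow_zero, one_mul] at h1
  obtain rfl := hS.eq_of_inside hX hY h1 h2
  have h3 := (h'.left (n := 0) (by norm_num)).2 hb
  rw [pow_zero, one_mul] at h3
  exact (h.left hn).1 h3 |>.not_ge han

theorem flat_start {X Y : Pose} (hX : X ∈ S) (hY : Y ∈ S) {w : ℂ} {j : Fin 13}
    (h : Arc X.body (Y.P j) w 6) (h' : Y.D j = -w) :
    ang Y.m j = 3 ∧ ∃ Z ∈ S, ∃ i, Y.P j = Z.P (i + 1) ∧ Z.D i = -w := by
  have ha := Y.arc_P j
  have hD : Y.D j = eta1 ^ 6 * w := by rw [h', eta1_pow_six]; ring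
  have hm := Pose.ang_mem Y.m j
  simp only [Finset.mem_insert, Finset.mem_singleton] at hm
  obtain ⟨Z, hZ, b, hb⟩ := hS.next hY (Pose.norm_D j) ha (by omega) (by omega)
  have hs := hb.size
  rw [hD] at ha hb
  have f1 := hS.fit hX hY h ha (by norm_num) le_rfl (by norm_num) (by omega)
  rw [← mul_assoc, ← pow_add] at hb
  have f2 := hS.fit hX hZ h hb.arc (by norm_num) (by omega) (by omega) (by omega)
  have h3 : ang Y.m j = 3 := by omega
  have hb3 : b = 3 := by omega
  rw [h3] at hb
  obtain ⟨i, h4, h5, h6⟩ := hb.vertex (by omega)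
  refine ⟨h3, Z, hZ, i, h4, ?_⟩
  have := Z.eta1_pow_mul_D i
  rw [← h5, ← h6, hb3, ← mul_assoc, ← pow_add, eta1_pow_twelve, one_mul] at this
  rw [this, neg_neg]

theorem flat_end {X Y : Pose} (hX : X ∈ S) (hY : Y ∈ S) {w : ℂ} {j : Fin 13} (hw : ‖w‖ = 1)
    (h : Arc X.body (Y.P (j + 1)) w 6) (h' : Y.D j = -w) :
    ang Y.m (j + 1) = 3 ∧ ∃ Z ∈ S, ∃ i, Y.P (j + 1) = Z.P i ∧ Z.D i = -w := by
  have ha := Y.arc_P (j + 1)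
  have hD := Y.eta1_pow_mul_D j
  rw [h', neg_neg] at hD
  have hm := Pose.ang_mem Y.m (j + 1)
  simp only [Finset.mem_insert, Finset.mem_singleton] at hm
  obtain ⟨Z, hZ, b, hb⟩ := hS.next hX hw h (by norm_num) (by norm_num)
  have hs := hb.size
  have hb' := hb
  rw [← hD] at h hb
  have f1 := hS.fit hY hX ha h (by omega) le_rfl (by omega) (by norm_num)
  rw [← mul_assoc, ← pow_add] at hb
  have f2 := hS.fit hY hZ ha hb.arc (by omega) (by omega) (by omega) (by omega)
  refine ⟨by omega, Z, hZ, ?_⟩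
  obtain ⟨i, h4, h5, h6⟩ := hb'.vertex (by omega)
  exact ⟨i + 1, h4, by rw [← h5, eta1_pow_six]; ring⟩

theorem mixed {X Y : Pose} (hX : X ∈ S) (hY : Y ∈ S) {i j : Fin 13} (h : Touch X i Y j)
    (hp : par X.m i ≠ par Y.m j) : ang X.m i = 3 ∧ ang Y.m (j + 1) = 3 := by
  obtain ⟨hP, hD⟩ := h
  have hwX : ‖X.D i‖ = 1 := Pose.norm_D i
  have hwY : ‖Y.D j‖ = 1 := Pose.norm_D j
  have hD' : X.D i = -Y.D j := by rw [hD, neg_neg]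
  have e1 : X.P i = Y.P j + len X.m i * Y.D j := by rw [X.P_eq, hP, hD]; ring
  have e2 := Y.P_succ j
  rcases len_sub_lt hp with ⟨h1, h2⟩ | ⟨h1, h2⟩
  · have a1 := Y.arc_D (j := j) (x := len X.m i) (by linarith [one_le_len X.m i]) h1
    rw [← e1] at a1
    obtain ⟨h3, Z, hZ, k, h4, h5⟩ := hS.flat_start hY hX a1 hD'
    refine ⟨h3, ?_⟩
    have h6 := one_le_len Z.m k
    have a2 := Z.arc_D (j := k) (x := len Z.m k - (len Y.m j - len X.m i)) (by linarith)
      (by linarith)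
    have e3 : Z.P k + ((len Z.m k - (len Y.m j - len X.m i) : ℝ) : ℂ) * Z.D k = Y.P (j + 1) := by
      rw [Z.P_eq k, ← h4, h5, e1, e2]; push_cast; ring
    rw [e3] at a2
    exact (hS.flat_end hZ hY (Pose.norm_D k) a2 (by rw [h5, neg_neg])).1
  · have a1 := X.arc_D (j := i) (x := len X.m i - len Y.m j) (by linarith)
      (by linarith [one_le_len Y.m j])
    have e3 : X.P i + ((len X.m i - len Y.m j : ℝ) : ℂ) * X.D i = Y.P (j + 1) := by
      rw [e1, e2, hD']; push_cast; ring
    rw [e3] at a1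
    obtain ⟨h3, Z, hZ, k, h4, h5⟩ := hS.flat_end hX hY hwX a1 hD
    refine ⟨?_, h3⟩
    rw [← hD] at h5
    have h6 := one_le_len Z.m k
    have a2 := Z.arc_D (j := k) (x := len X.m i - len Y.m j) (by linarith) (by linarith)
    have e4 : Z.P k + ((len X.m i - len Y.m j : ℝ) : ℂ) * Z.D k = X.P i := by
      rw [← h4, h5, e1, e2]; push_cast; ring
    rw [e4] at a2
    exact (hS.flat_start hZ hX a2 (by rw [h5, hD'])).1

end PoseTiling

/-- Half of an even index. -/
def half (k : Fin 12) : Fin 6 := ⟨k.val / 2, by omega⟩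

/-- Two placements are related by a symmetry of the lattice of hexagons. -/
def Rel (X Y : Pose) : Prop := ∃ k q, Y.u = X.u * zr k ∧ Y.t = X.t + X.u * em (latHom q)

theorem Rel.symm {X Y : Pose} (h : Rel X Y) : Rel Y X := by
  obtain ⟨k, q, h1, h2⟩ := h
  refine ⟨-k, -rotn (-k) q, ?_, ?_⟩
  · rw [h1, mul_assoc, zr_mul_neg, mul_one]
  · rw [map_neg, latHom_rotn, em_neg, em_rotn, h1, h2]
    linear_combination X.u * em (latHom q) * zr_mul_neg k

theorem Rel.trans {X Y Z : Pose} (h : Rel X Y) (h' : Rel Y Z) : Rel X Z := by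
  obtain ⟨k, q, h1, h2⟩ := h
  obtain ⟨k', q', h3, h4⟩ := h'
  refine ⟨k + k', q + rotn k q', ?_, ?_⟩
  · rw [h3, h1, zr_add, mul_assoc]
  · rw [map_add, latHom_rotn, em_add, em_rotn, h4, h2, h1]; ring

theorem Touch.rel {X Y : Pose} {i j : Fin 13} (h : Touch X i Y j) (hp : par X.m i = par Y.m j)
    (ha : (ang X.m (i + 1) = 4 ∨ ang X.m (i + 1) = 8) ↔ (ang Y.m j = 4 ∨ ang Y.m j = 8)) :
    Rel X Y := by
  have key : ∀ m i m' j, par m i = par m' j →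
      ((ang m (i + 1) = 4 ∨ ang m (i + 1) = 8) ↔ (ang m' j = 4 ∨ ang m' j = 8)) →
      (dirIx m i + 6 - dirIx m' j).val % 2 = 0 ∧
      IsLat (vtx m (i + 1) -
        rotn (half (dirIx m i + 6 - dirIx m' j)) (vtx m' j)) := by
    decide +kernel
  obtain ⟨h1, h2⟩ := key _ _ _ _ hp ha
  obtain ⟨q, hq⟩ := (isLat_iff _).1 h2
  obtain ⟨hP, hD⟩ := h
  set d := dirIx X.m i + 6 - dirIx Y.m j with hd
  have hu : Y.u = X.u * zr (half d) := by
    have e1 : eta d = zr (half d) := by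
      rw [eta, zr, half, ← eta1_mul_self, ← sq, ← pow_mul, Nat.mul_div_cancel' (Nat.dvd_of_mod_eq_zero h1)]
    have e2 : eta (dirIx X.m i) * -1 = eta d * eta (dirIx Y.m j) := by
      rw [← eta_add, hd, sub_add_cancel, eta_add, eta_six]
    refine mul_right_cancel₀ (eta_ne_zero (dirIx Y.m j)) ?_
    simp only [Pose.D] at hD
    rw [hD, ← e1]
    linear_combination X.u * e2
  refine ⟨_, q, hu, ?_⟩
  rw [hq, em_sub, em_rotn]
  simp only [Pose.P, Pose.homeo_apply, vtxC] at hP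
  linear_combination -hP - em (vtx Y.m j) * hu

theorem Touch.inside {X Y : Pose} {i j : Fin 13} (h : Touch X i Y j) :
    Inside Y.body (X.P (i + 1)) (-X.D i) 1 := by
  rw [h.1, ← h.2]
  have hm := Pose.ang_mem Y.m j
  simp only [Finset.mem_insert, Finset.mem_singleton] at hm
  simpa using ((Y.arc_P j).left (n := 0) (by norm_num)).2 (by omega)

theorem Touch.inside' {X Y : Pose} {i j : Fin 13} (h : Touch X i Y j) :
    Inside X.body (Y.P j) (Y.D j) (-1) := by
  rw [← h.1, h.2, ← X.eta1_pow_mul_D]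
  have hm := Pose.ang_mem X.m (i + 1)
  simp only [Finset.mem_insert, Finset.mem_singleton] at hm
  obtain ⟨n, hn⟩ := Nat.exists_eq_succ_of_ne_zero (show ang X.m (i + 1) ≠ 0 by omega)
  have := (X.arc_P (i + 1)).right (n := n) (by omega)
  rw [hn] at this ⊢
  exact this.2 n.lt_succ_self

theorem PoseTiling.around {S : Set Pose} (hS : PoseTiling S) {X : Pose} (hX : X ∈ S) (i : Fin 13)
    (h3 : ang X.m (i + 1) ≠ 3) : (∃ Y ∈ S, ∃ j, Touch X i Y j ∧ Rel X Y) ∧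
      ∃ Y ∈ S, ∃ j, Touch Y j X (i + 1) ∧ Rel X Y := by
  have nine : ∀ m i, ang m (i + 1) = 9 → ang m i ≠ 3 ∧ ang m (i + 1 + 1) ≠ 3 := by decide
  have four : ∀ m i, ang m (i + 1) = 4 → ¬ (ang m i = 3 ∧ ang m (i + 1 + 1) = 3) := by decide
  have pr : ∀ m i, ang m (i + 1) = 4 ∨ ang m (i + 1) = 8 → par m (i + 1) = par m i := by decide
  have hw : ‖X.D (i + 1)‖ = 1 := Pose.norm_D _
  have arcX := X.arc_P (i + 1)
  have hD := X.eta1_pow_mul_D i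
  have hm := Pose.ang_mem X.m (i + 1)
  simp only [Finset.mem_insert, Finset.mem_singleton] at hm
  obtain ⟨Y, hY, b, hb⟩ := hS.next hX hw arcX (by omega) (by omega)
  have hb3 := hb.three_le
  have f1 := hS.fit hX hY arcX hb.arc (by omega) le_rfl (by omega) (by omega)
  have arcY := hb.arc
  have hwY : ‖eta1 ^ ang X.m (i + 1) * X.D (i + 1)‖ = 1 := by rw [norm_eta1_pow_mul, hw]
  by_cases hclose : ang X.m (i + 1) + b = 12
  · obtain ⟨j, p1, d1, rfl⟩ := hb.vertex (by
      have : ∀ m i, ang m i ≠ 6 := by decide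
      have := this X.m (i + 1)
      omega)
    have t1 : Touch X i Y (j + 1) := ⟨p1, by rw [← d1, hD]⟩
    have t2 : Touch Y j X (i + 1) := by
      refine ⟨p1.symm, ?_⟩
      rw [← Y.eta1_pow_mul_D, ← d1, ← mul_assoc, ← pow_add,
        Nat.add_comm, hclose, eta1_pow_twelve,
        one_mul]
    have hsize : ang X.m (i + 1) = 9 ∨ (ang X.m (i + 1) = 4 ∨ ang X.m (i + 1) = 8) ∧
        (ang Y.m (j + 1) = 4 ∨ ang Y.m (j + 1) = 8) := by omega
    have h48 : (ang X.m (i + 1) = 4 ∨ ang X.m (i + 1) = 8) ↔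
        (ang Y.m (j + 1) = 4 ∨ ang Y.m (j + 1) = 8) := by omega
    have hr : par X.m i = par Y.m (j + 1) ∧ par Y.m j = par X.m (i + 1) := by
      have m1 := hS.mixed hX hY t1
      have m2 := hS.mixed hY hX t2
      rcases hsize with h9 | ⟨hX', hY'⟩
      · have x9 := nine X.m i h9
        exact ⟨by_contra fun h => x9.1 (m1 h).1, by_contra fun h => x9.2 (m2 h).2⟩
      · have h4 : ang X.m (i + 1) = 4 ∨ ang Y.m (j + 1) = 4 := by clear m1 m2; omega
        rw [pr _ _ hX', pr _ _ hY'] at *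
        suffices par X.m i = par Y.m j from ⟨this, this.symm⟩
        by_contra hne
        have n1 := m1 hne
        have n2 := m2 (Ne.symm hne)
        rcases h4 with h4 | h4
        exacts [four _ _ h4 ⟨n1.1, n2.2⟩, four _ _ h4 ⟨n2.1, n1.2⟩]
    exact ⟨⟨Y, hY, _, t1, t1.rel hr.1 h48⟩, Y, hY, _, t2, (t2.rel hr.2 h48.symm).symm⟩
  · obtain ⟨Z, hZ, c, hc⟩ := hS.next hY hwY arcY (by omega) (by omega)
    have hc3 := hc.three_le
    have hc' := hc
    rw [← mul_assoc, ← pow_add] at hc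
    have f2 := hS.fit hX hZ arcX hc.arc (by omega) (by omega) (by omega) (by omega)
    have hclose' : b + ang X.m (i + 1) + c = 12 := by
      by_contra hne
      obtain ⟨W, hW, d, hd⟩ := hS.next hZ (by rw [norm_eta1_pow_mul, hw]) hc.arc (by omega) (by omega)
      have hd3 := hd.three_le
      rw [← mul_assoc, ← pow_add] at hd
      have f3 := hS.fit hX hW arcX hd.arc (by omega) (by omega) (by omega) (by omega)
      omega
    have hX4 : ang X.m (i + 1) = 4 := by omega
    have hbc : b = 4 ∧ c = 4 := by
      have hs := hb.size
      have hs' := hc'.size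
      omega
    clear hm
    obtain ⟨j, p1, d1, rfl⟩ := hb.vertex (by omega)
    obtain ⟨k, p2, d2, rfl⟩ := hc'.vertex (by omega)
    have hY4 := hbc.1
    have hZ4 := hbc.2
    have t1 : Touch X i Y (j + 1) := ⟨p1, by rw [← d1, hD]⟩
    have t2 : Touch Y j Z (k + 1) := ⟨p1.symm.trans p2, by rw [← d2, d1, Y.eta1_pow_mul_D]⟩
    have t3 : Touch Z k X (i + 1) := by
      refine ⟨p2.symm, ?_⟩
      rw [← Z.eta1_pow_mul_D, ← d2, hX4, hY4, hZ4, ← mul_assoc, ← mul_assoc, ← pow_add, ← pow_add,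
        eta1_pow_twelve, one_mul]
    have m1 := hS.mixed hX hY t1
    have m2 := hS.mixed hY hZ t2
    have m3 := hS.mixed hZ hX t3
    have x4 := four X.m i hX4
    have y4 := four Y.m j hY4
    have z4 := four Z.m k hZ4
    have xp := pr X.m i (Or.inl hX4)
    have yp := pr Y.m j (Or.inl hY4)
    have zp := pr Z.m k (Or.inl hZ4)
    rw [yp] at m1
    rw [zp] at m2
    rw [xp] at m3
    have r1 : par X.m i = par Y.m j := by
      by_contra hne
      have h1 := m1 hne
      by_cases h : par Y.m j = par Z.m k
      · have h2 := m3 (by rw [← h]; exact Ne.symm hne)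
        exact x4 ⟨h1.1, h2.2⟩
      · exact y4 ⟨(m2 h).1, h1.2⟩
    have r2 : par Z.m k = par X.m i := by
      by_contra hne
      exact z4 ⟨(m3 hne).1, (m2 (by rw [← r1]; exact Ne.symm hne)).2⟩
    exact ⟨⟨Y, hY, _, t1, t1.rel (by rw [yp, r1]) (by rw [hX4, hY4])⟩, Z, hZ, _, t3,
      (t3.rel (by rw [xp, r2]) (by rw [hX4, hZ4])).symm⟩

/-! ### Every tiling is aligned with the kites -/

/-- `Y` is the image of `X` under the given symmetry of the lattice of hexagons. -/
def RelBy (X Y : Pose) (k : Fin 6) (q : Eis) : Prop :=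
  Y.u = X.u * zr k ∧ Y.t = X.t + X.u * em (latHom q)

theorem RelBy.trans {X Y Z : Pose} {k k' : Fin 6} {q q' : Eis} (h : RelBy X Y k q)
    (h' : RelBy Y Z k' q') : RelBy X Z (k + k') (q + rotn k q') := by
  obtain ⟨h1, h2⟩ := h
  obtain ⟨h3, h4⟩ := h'
  refine ⟨?_, ?_⟩
  · rw [h3, h1, zr_add, mul_assoc]
  · rw [map_add, latHom_rotn, em_add, em_rotn, h4, h2, h1]; ring

theorem own_act_iff {c : Cell} {p w : ℂ} {s : ℝ} {k : Fin 6} {q : Eis} :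
    Own (Kite.act q k c) (zr k * p + em (latHom q)) (zr k * w) s ↔ Own c p w s := by
  rw [Own, ← map_germ (em (latHom q)) p w s, eventually_map]
  exact eventually_congr (Eventually.of_forall fun z => mem_okite_act)

/-- Ownership of germs in the frame of a related placement. -/
theorem RelBy.inside_iff {X Y : Pose} {k : Fin 6} {q : Eis} (h : RelBy X Y k q) {p w : ℂ} {s : ℝ}
    (hw : w ≠ 0) (hs : s ≠ 0) : Inside Y.body (X.homeo p) (X.u * w) s ↔
      ∃ c, Own c p w s ∧ c ∈ cells (q, k, Y.m) := by
  obtain ⟨p, rfl⟩ : ∃ p', p = zr k * p' + em (latHom q) :=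
    ⟨zr (-k) * (p - em (latHom q)), by
      linear_combination -(p - em (latHom q)) * zr_mul_neg k⟩
  obtain ⟨w, rfl⟩ : ∃ w', w = zr k * w' := ⟨zr (-k) * w, by linear_combination -w * zr_mul_neg k⟩
  have e1 : X.homeo (zr k * p + em (latHom q)) = Y.homeo p := by
    rw [X.homeo_apply, Y.homeo_apply, h.1, h.2]; ring
  rw [e1, ← mul_assoc, ← h.1, Y.inside_body_iff, hat,
    inside_cellUnion_iff (right_ne_zero_of_mul hw) hs]
  simp only [mem_cells_iff]
  constructor
  · rintro ⟨c, hc, ho⟩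
    exact ⟨_, own_act_iff.2 ho, c, hc, rfl⟩
  · rintro ⟨_, ho, c, hc, rfl⟩
    exact ⟨c, hc, own_act_iff.1 ho⟩

theorem RelBy.inside {X Y : Pose} {k : Fin 6} {q : Eis} (h : RelBy X Y k q) {p w : ℂ} {s : ℝ}
    (hw : w ≠ 0) (hs : s ≠ 0) {c : Cell} (ho : Own c p w s) (hc : c ∈ cells (q, k, Y.m)) :
    Inside Y.body (X.homeo p) (X.u * w) s :=
  (h.inside_iff hw hs).2 ⟨c, ho, hc⟩

theorem RelBy.mem_cells {X Y : Pose} {k : Fin 6} {q : Eis} (h : RelBy X Y k q) {p w : ℂ} {s : ℝ}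
    (hw : w ≠ 0) (hs : s ≠ 0) {c : Cell} (ho : Own c p w s)
    (hi : Inside Y.body (X.homeo p) (X.u * w) s) : c ∈ cells (q, k, Y.m) := by
  obtain ⟨c', ho', hc'⟩ := (h.inside_iff hw hs).1 hi
  rwa [ho.eq ho']

theorem cell_induction {Q : Cell → Prop} {c₀ : Cell} (h₀ : Q c₀) (h : ∀ c e, Q c → Q (nb c e))
    (c : Cell) : Q c := by
  have e1 : ∀ j : Fin 6, rotn j ((1, 0) : Eis) = rotn (j + 1) ((1, -1) : Eis) := by decide
  have e3 : ∀ j : Fin 6, rotn (j + 3) ((1, 0) : Eis) = -rotn j (1, 0) := by decide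
  have h3 (u : Eis) (k : Fin 6) (hq : Q (u, k)) : Q (u, k + 1) := by
    simpa [nb, nbZero, Kite.act] using h _ 3 hq
  have hk (u : Eis) (k : Fin 6) (hq : Q (u, k)) (k' : Fin 6) : Q (u, k') := by
    have : ∀ n : ℕ, Q (u, k + Fin.ofNat 6 n) := by
      intro n
      induction n with
      | zero => simpa using hq
      | succ n ih =>
        have := h3 _ _ ih
        rw [add_assoc] at this
        convert this using 3
        ext; simp [Fin.val_add]
    convert this (k' - k).val using 2
    simp
  have h1 (u : Eis) (k j : Fin 6) (hq : Q (u, k)) (k' : Fin 6) : Q (u + rotn j (1, 0), k') := by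
    have := h _ 1 (hk u k hq (j + 1))
    simp only [nb, nbZero, Kite.act] at this
    refine hk _ (j + 1 + 2) ?_ _
    convert this using 3
    · exact e1 j
    · rfl
  have hx (n : ℕ) (u : Eis) (k j : Fin 6) (hq : Q (u, k)) : Q (u + n • rotn j (1, 0), k) := by
    induction n with
    | zero => simpa using hq
    | succ n ih => rw [succ_nsmul, ← add_assoc]; exact h1 _ k j ih k
  have hz (n : ℤ) (u : Eis) (k j : Fin 6) (hq : Q (u, k)) : Q (u + n • rotn j (1, 0), k) := by
    obtain ⟨n, rfl | rfl⟩ := n.eq_nat_or_neg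
    · simpa using hx n u k j hq
    · have := hx n u k (j + 3) hq
      rw [e3] at this
      simpa using this
  obtain ⟨u, k⟩ := c
  obtain ⟨u₀, k₀⟩ := c₀
  have := hz (u.2 - u₀.2) _ k 1 (hz (u.1 - u₀.1) _ k 0 (hk _ _ h₀ k))
  convert this using 2
  ext <;> simp [rotn, rot]

theorem exists_vertex (m : Bool) {c : Cell} (hc : c ∈ hatCells m) (e : Fin 4) :
    nb c e ∈ hatCells m ∨ ∃ j, ang m (j + 1) ≠ 3 ∧
      (OwnZ (nb c e) (vtx m (j + 1)) (dir12 (dirIx m j + 6)) 1 ∨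
        OwnZ (nb c e) (vtx m (j + 1)) (dir12 (dirIx m (j + 1))) (-1)) := by
  revert m c e; decide +kernel

/-- The placements of the tiles of a tiling, relative to one of them. -/
def tilesOf (S : Set Pose) (X : Pose) : Set Tile :=
  {t | ∃ Y ∈ S, RelBy X Y t.2.1 t.1 ∧ t.2.2 = Y.m}

theorem RelBy.refl (X : Pose) : RelBy X X 0 0 := by simp [RelBy]

theorem mem_tilesOf_self {S : Set Pose} {X : Pose} (hX : X ∈ S) : (0, 0, X.m) ∈ tilesOf S X :=
  ⟨X, hX, RelBy.refl X, rfl⟩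

theorem PoseTiling.exists_mem_cells {S : Set Pose} (hS : PoseTiling S) {X : Pose} (hX : X ∈ S)
    (c : Cell) : ∃ t ∈ tilesOf S X, c ∈ cells t := by
  have ne : ∃ c, c ∈ cells (0, 0, X.m) :=
    List.exists_mem_of_length_pos (by cases X.m <;> decide)
  refine cell_induction (Q := fun c => ∃ t ∈ tilesOf S X, c ∈ cells t)
    ⟨_, mem_tilesOf_self hX, ne.choose_spec⟩ ?_ c
  rintro _ e ⟨⟨q, k, m⟩, ⟨Y, hY, hr, rfl⟩, hc⟩
  obtain ⟨c, hc₁, rfl⟩ := mem_cells_iff.1 hc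
  have hnb : nb (Kite.act q k c) e = Kite.act q k (nb c e) := by
    simp [nb, Kite.act, rotn_add, rotn_add_apply, add_assoc]
  dsimp only at hc₁ hr ⊢
  rw [hnb]
  rcases exists_vertex Y.m hc₁ e with h | ⟨j, h3, h⟩
  · exact ⟨(q, k, Y.m), ⟨Y, hY, hr, rfl⟩, mem_cells_iff.2 ⟨nb c e, h, rfl⟩⟩
  obtain ⟨⟨Z, hZ, i, ht, k', q', hz⟩, ⟨W, hW, l, ht', k'', q'', hw⟩⟩ := hS.around hY j h3
  rcases h with h | h
  · have ho := (own_eta_iff (by decide)).2 h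
    have hi := ht.inside
    have : -Y.D j = Y.u * eta (dirIx Y.m j + 6) := by rw [eta_add, eta_six, Pose.D]; ring
    rw [this, Pose.P] at hi
    have hm := RelBy.mem_cells (k := k') (q := q') hz (eta_ne_zero _) one_ne_zero
      (by simpa [vtxC] using ho) hi
    obtain ⟨d, hd, he⟩ := mem_cells_iff.1 hm
    refine ⟨(q + rotn k q', k + k', Z.m), ⟨Z, hZ, RelBy.trans hr hz, rfl⟩, mem_cells_iff.2 ⟨d, hd, ?_⟩⟩
    rw [← he, Kite.act_act]
  · have ho := (own_eta_iff (by decide)).2 h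
    have hi := ht'.inside'
    rw [Pose.P, Pose.D] at hi
    have hm := RelBy.mem_cells (k := k'') (q := q'') hw (eta_ne_zero _) (by norm_num)
      (by simpa [vtxC] using ho) hi
    obtain ⟨d, hd, he⟩ := mem_cells_iff.1 hm
    refine ⟨(q + rotn k q'', k + k'', W.m), ⟨W, hW, RelBy.trans hr hw, rfl⟩, mem_cells_iff.2 ⟨d, hd, ?_⟩⟩
    rw [← he, Kite.act_act]

/-- All tiles of a tiling are related. -/
theorem PoseTiling.rel {S : Set Pose} (hS : PoseTiling S) {X Y : Pose} (hX : X ∈ S) (hY : Y ∈ S) :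
    Rel X Y := by
  have hi : Inside Y.body (Y.P 0) (Y.D 0) 1 := by
    have : 0 < ang Y.m 0 := by cases Y.m <;> decide
    simpa using ((Y.arc_P 0).left (n := 0) (by norm_num)).2 this
  have hD : Y.D 0 ≠ 0 := by intro h; simpa [h] using Pose.norm_D (X := Y) 0
  obtain ⟨p, w, hp, hw⟩ := X.exists_preimage (Y.P 0) (Y.D 0)
  rw [hw] at hD
  rw [hp, hw] at hi
  have hw0 := right_ne_zero_of_mul hD
  obtain ⟨c, hc⟩ := exists_own p hw0 one_ne_zero
  obtain ⟨⟨q, k, m⟩, ⟨Z, hZ, hr, rfl⟩, hm⟩ := hS.exists_mem_cells hX c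
  obtain rfl := hS.eq_of_inside hY hZ hi (RelBy.inside hr hw0 one_ne_zero hc hm)
  exact ⟨k, q, hr⟩

theorem exists_own_cell (c : Cell) : ∃ p w : ℂ, w ≠ 0 ∧ Own c p w 1 := by
  obtain ⟨q, k⟩ := c
  have h : OwnZ (0, 0) 0 (1, 0) 1 := by decide
  have := own_act_iff (k := k) (q := q).2 h.own
  refine ⟨zr k * em 0 + em (latHom q), zr k * em (1, 0),
    mul_ne_zero (zr_ne_zero k) (by simp [em_one]), ?_⟩
  simpa [Kite.act] using this

theorem zr_injective : Function.Injective zr := fun j k h => by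
  rw [zr_eq, zr_eq] at h
  have key : ∀ j k : Fin 6, rotn j ((1, 0) : Eis) = rotn k (1, 0) → j = k := by decide
  exact key j k (em_injective h)

theorem PoseTiling.exactCover {S : Set Pose} (hS : PoseTiling S) {X : Pose} (hX : X ∈ S) :
    ExactCover (tilesOf S X) := by
  intro c
  obtain ⟨t, ht, hc⟩ := hS.exists_mem_cells hX c
  refine ⟨t, ⟨ht, hc⟩, ?_⟩
  rintro ⟨q', k', _⟩ ⟨⟨Y', hY', hr', rfl⟩, hc'⟩
  obtain ⟨q, k, _⟩ := t
  obtain ⟨Y, hY, hr, rfl⟩ := ht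
  obtain ⟨p, w, hw, ho⟩ := exists_own_cell c
  obtain rfl := hS.eq_of_inside hY hY' (RelBy.inside hr hw one_ne_zero ho hc)
    (RelBy.inside hr' hw one_ne_zero ho hc')
  dsimp only at hr hr'
  have e1 := mul_left_cancel₀ X.u_ne_zero (hr.1.symm.trans hr'.1)
  have e2 := mul_left_cancel₀ X.u_ne_zero (add_left_cancel (hr.2.symm.trans hr'.2))
  rw [zr_injective e1, latHom_injective (em_injective e2)]

/-- The placement of a tile. -/
def poseOf (t : Tile) : Pose := ⟨t.2.2, zr t.2.1, em (latHom t.1), by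
  have : ‖zr t.2.1‖ ^ 6 = 1 := by
    rw [← norm_pow, zr, ← pow_mul, mul_comm, pow_mul, zeta_pow_six]; simp
  exact (pow_eq_one_iff_of_nonneg (norm_nonneg _) (by norm_num)).1 this⟩

/-- The standard placement of the hat. -/
def Pose.std : Pose := ⟨false, 1, 0, by simp⟩

theorem relBy_std (t : Tile) : RelBy Pose.std (poseOf t) t.2.1 t.1 := by
  simp [RelBy, Pose.std, poseOf]

theorem Pose.std_homeo (z : ℂ) : Pose.std.homeo z = z := by simp [homeo_apply, std]

theorem mem_body_poseOf {t : Tile} {z : ℂ} : z ∈ (poseOf t).body ↔ ∃ c ∈ cells t, z ∈ kite c := by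
  simp only [Pose.body, Set.mem_image, hat, mem_cellUnion, mem_cells_iff]
  constructor
  · rintro ⟨z, ⟨c, hc, hz⟩, rfl⟩
    exact ⟨_, ⟨c, hc, rfl⟩, mem_kite_act.2 hz⟩
  · rintro ⟨_, ⟨c, hc, rfl⟩, hz⟩
    obtain ⟨y, rfl⟩ := (poseOf t).homeo.surjective z
    exact ⟨y, ⟨c, hc, mem_kite_act.1 hz⟩, rfl⟩

theorem ExactCover.poseTiling {T : Set Tile} (hT : ExactCover T) : PoseTiling (poseOf '' T) where
  cover z := by
    obtain ⟨c, hc⟩ := exists_mem_kite z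
    obtain ⟨t, ⟨ht, hct⟩, -⟩ := hT c
    exact ⟨_, ⟨t, ht, rfl⟩, mem_body_poseOf.2 ⟨c, hct, hc⟩⟩
  disj := by
    rintro _ ⟨t, ht, rfl⟩ _ ⟨t', ht', rfl⟩ hne
    rw [Set.disjoint_left]
    intro z hz hz'
    have hi {A : Set ℂ} (h : z ∈ interior A) : Inside A z 1 1 :=
      germ_le_nhds z 1 1 (isOpen_interior.mem_nhds h)
    have key (t : Tile) (h : Inside (poseOf t).body z 1 1) : ∃ c, Own c z 1 1 ∧ c ∈ cells t := by
      refine ((relBy_std t).inside_iff one_ne_zero one_ne_zero).1 ?_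
      have e : Pose.std.u = 1 := rfl
      rw [Pose.std_homeo, e, one_mul]
      exact h
    obtain ⟨c, ho, hc⟩ := key t (hi hz)
    obtain ⟨c', ho', hc'⟩ := key t' (hi hz')
    rw [← ho.eq ho'] at hc'
    exact hne (congrArg poseOf ((hT c).unique ⟨ht, hc⟩ ⟨ht', hc'⟩))

/-! ### Isometries acting on placements -/

/-- The reflection of cells in the first coordinate axis. -/
def cconj (c : Cell) : Cell := ((c.1.1, -c.1.1 - c.1.2), -c.2)

theorem norm_zr (k : Fin 6) : ‖zr k‖ = 1 := by
  have : ‖zr k‖ ^ 6 = 1 := by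
    rw [← norm_pow, zr, ← pow_mul, mul_comm, pow_mul, zeta_pow_six]; simp
  exact (pow_eq_one_iff_of_nonneg (norm_nonneg _) (by norm_num)).1 this

theorem conj_zr (k : Fin 6) : starRingEnd ℂ (zr k) = zr (-k) := by
  have h : starRingEnd ℂ (zr k) * zr k = 1 := by
    rw [mul_comm, mul_conj, normSq_eq_norm_sq, norm_zr]; simp
  exact mul_right_cancel₀ (zr_ne_zero k) (h.trans (zr_neg_mul k).symm)

theorem conj_em_latHom (u : Eis) :
    starRingEnd ℂ (em (latHom u)) = em (latHom (u.1, -u.1 - u.2)) := by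
  refine eq_of_coords ?_ ?_
  · rw [cX_conj, (coords_latHom _).1, (coords_latHom _).2, (coords_latHom _).1]; push_cast; ring
  · rw [cY_conj, (coords_latHom _).2, (coords_latHom _).2]; push_cast; ring

theorem pull_cconj (c : Cell) (z : ℂ) :
    pull (cconj c) (starRingEnd ℂ z) = starRingEnd ℂ (pull c z) := by
  simp only [pull, cconj, map_mul, map_sub, conj_zr, conj_em_latHom]

theorem conj_mem_kite {c : Cell} {z : ℂ} : starRingEnd ℂ z ∈ kite (cconj c) ↔ z ∈ kite c := by
  rw [mem_kite_iff, pull_cconj, mem_kite_iff (z := z), mem_kite_zero, mem_kite_zero, cX_conj, cY_conj]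
  constructor <;> rintro ⟨h1, h2, h3, h4⟩ <;> refine ⟨?_, ?_, ?_, ?_⟩ <;> linarith

theorem conj_mem_hat {m : Bool} {z : ℂ} : starRingEnd ℂ z ∈ hat (!m) ↔ z ∈ hat m := by
  have h : ∀ m, hatCells (!m) = (hatCells m).map cconj := by decide
  simp only [hat, mem_cellUnion, h, List.mem_map]
  constructor
  · rintro ⟨_, ⟨c, hc, rfl⟩, hz⟩
    exact ⟨c, hc, conj_mem_kite.1 hz⟩
  · rintro ⟨c, hc, hz⟩
    exact ⟨_, ⟨c, hc, rfl⟩, conj_mem_kite.2 hz⟩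

/-- The isometry `z ↦ a * z + b`, following the conjugation if `r` holds. -/
structure Motion where
  r : Bool
  a : ℂ
  b : ℂ
  norm_a : ‖a‖ = 1

/-- The conjugation if `r` holds, and the identity otherwise. -/
def cj (r : Bool) : ℂ ≃+* ℂ := bif r then starRingAut else RingEquiv.refl ℂ

@[simp] theorem cj_false (z : ℂ) : cj false z = z := rfl
@[simp] theorem cj_true (z : ℂ) : cj true z = starRingEnd ℂ z := rfl

theorem norm_cj (r : Bool) (z : ℂ) : ‖cj r z‖ = ‖z‖ := by cases r <;> simp

theorem cj_mem_hat {r m : Bool} {z : ℂ} : cj r z ∈ hat (xor r m) ↔ z ∈ hat m := by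
  cases r
  · simp
  · simpa using conj_mem_hat

def Motion.app (f : Motion) (z : ℂ) : ℂ := f.a * cj f.r z + f.b

/-- The image of a placement. -/
def Motion.act (f : Motion) (X : Pose) : Pose :=
  ⟨xor f.r X.m, f.a * cj f.r X.u, f.app X.t, by rw [norm_mul, norm_cj, f.norm_a, X.norm_u, one_mul]⟩

theorem Motion.homeo_act (f : Motion) (X : Pose) (z : ℂ) :
    (f.act X).homeo (cj f.r z) = f.app (X.homeo z) := by
  simp only [Pose.homeo_apply, act, app, map_add, map_mul]; ring

theorem Motion.image_body (f : Motion) (X : Pose) : f.app '' X.body = (f.act X).body := by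
  ext z
  simp only [Pose.body, Set.mem_image, exists_exists_and_eq_and]
  constructor
  · rintro ⟨z, hz, rfl⟩
    exact ⟨cj f.r z, cj_mem_hat.2 hz, f.homeo_act X z⟩
  · rintro ⟨z, hz, rfl⟩
    obtain ⟨z, rfl⟩ := (cj f.r).surjective z
    exact ⟨z, cj_mem_hat.1 hz, (f.homeo_act X z).symm⟩

theorem exists_motion (g : ℂ ≃ᵢ ℂ) : ∃ f : Motion, ∀ z, g z = f.app z := by
  have key (z : ℂ) : g z = g.toRealAffineIsometryEquiv.linearIsometryEquiv z + g 0 := by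
    have := g.toRealAffineIsometryEquiv.map_vadd 0 z
    simpa using this
  obtain ⟨a, h | h⟩ := linear_isometry_complex g.toRealAffineIsometryEquiv.linearIsometryEquiv
  · exact ⟨⟨false, a, g 0, a.norm_coe⟩, fun z => by rw [key, h]; simp [Motion.app]⟩
  · exact ⟨⟨true, a, g 0, a.norm_coe⟩, fun z => by rw [key, h]; simp [Motion.app]⟩

theorem Pose.std_body : Pose.std.body = hat false := by
  have : ⇑Pose.std.homeo = id := funext Pose.std_homeo
  rw [Pose.body, this, Set.image_id]
  rfl

/-- The placement as an isometry of the whole plane: the image of the standard hat. -/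
theorem exists_isometry (X : Pose) : ∃ g : ℂ ≃ᵢ ℂ, g '' hat false = X.body := by
  let f : Motion := ⟨X.m, X.u, X.t, X.norm_u⟩
  have hf : Isometry f.app := Isometry.of_dist_eq fun z w => by
    simp only [Motion.app, dist_eq_norm]
    rw [add_sub_add_right_eq_sub, ← mul_sub, ← map_sub, norm_mul, f.norm_a, norm_cj, one_mul]
  have hs : Function.Surjective f.app := fun z => by
    obtain ⟨w, hw⟩ := (cj X.m).surjective (X.homeo.symm z)
    refine ⟨w, ?_⟩
    change X.homeo (cj X.m w) = z
    rw [hw, Homeomorph.apply_symm_apply]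
  refine ⟨IsometryEquiv.mk' f.app (Function.surjInv hs) (Function.surjInv_eq hs) hf, ?_⟩
  change f.app '' _ = _
  rw [← Pose.std_body, f.image_body]
  congr 1
  simp [Motion.act, Pose.std, Motion.app, f]

/-! ### Symmetries of tilings -/

theorem eq_of_cells_subset {m m' : Bool} {k : Fin 6} {q : Eis}
    (h : ∀ x, x ∈ cells (q, k, m') ↔ x ∈ cells (0, 0, m)) : q = 0 ∧ k = 0 ∧ m' = m := by
  have key : ∀ m m' k, ∀ c ∈ hatCells m',
      (∀ x ∈ cells (-rotn k c.1, k, m'), x ∈ cells (0, 0, m)) →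
        -rotn k c.1 = 0 ∧ k = 0 ∧ m' = m := by
    decide +kernel
  have h0 : ∀ m, ∃ j, ((0, j) : Cell) ∈ cells (0, 0, m) := by decide
  obtain ⟨j, hj⟩ := h0 m
  obtain ⟨c, hc, e⟩ := mem_cells_iff.1 ((h _).2 hj)
  obtain rfl : q = -rotn k c.1 := eq_neg_of_add_eq_zero_left (congrArg Prod.fst e)
  exact key m m' k c hc fun x => (h x).1

theorem Pose.ext_iff' {X Y : Pose} : X = Y ↔ X.m = Y.m ∧ X.u = Y.u ∧ X.t = Y.t := by
  cases X; cases Y; simp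

theorem Pose.isCompact_body (X : Pose) : IsCompact X.body :=
  (isCompact_cellUnion _).image X.homeo.continuous

/-- The placements in a tiling are determined by the regions they cover. -/
theorem PoseTiling.eq_of_body_eq {S : Set Pose} (hS : PoseTiling S) {X Y : Pose} (hY : Y ∈ S)
    (h : X.body = Y.body) : X = Y := by
  obtain ⟨Z, hZ, hZY⟩ : ∃ Z ∈ S, Z ≠ Y := by
    by_contra! hc
    refine noncompact_univ ℂ ?_
    convert Y.isCompact_body
    refine (Set.eq_univ_of_forall fun z => ?_).symm
    obtain ⟨Z, hZ, hz⟩ := hS.cover z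
    rwa [← hc Z hZ]
  have hS' : PoseTiling (insert X (S \ {Y})) := by
    constructor
    · intro z
      obtain ⟨Z, hZ, hz⟩ := hS.cover z
      rcases eq_or_ne Z Y with rfl | hne
      · exact ⟨X, Set.mem_insert _ _, h ▸ hz⟩
      · exact ⟨Z, Set.mem_insert_of_mem _ ⟨hZ, hne⟩, hz⟩
    · refine (Set.pairwise_insert).2 ⟨hS.disj.mono Set.sdiff_subset, fun W hW _ => ?_⟩
      rw [h]
      have := hS.disj hY hW.1 (Ne.symm hW.2)
      exact ⟨this, this.symm⟩
  obtain ⟨k, q, hr⟩ := (hS'.rel (Set.mem_insert _ _) (Set.mem_insert_of_mem _ ⟨hZ, hZY⟩)).trans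
    (hS.rel hZ hY)
  obtain ⟨rfl, rfl, hm⟩ : q = 0 ∧ k = 0 ∧ Y.m = X.m := by
    refine eq_of_cells_subset fun x => ?_
    obtain ⟨p, w, hw, ho⟩ := exists_own_cell x
    exact ⟨fun hx => (RelBy.refl X).mem_cells hw one_ne_zero ho
        (h ▸ RelBy.inside (X := X) hr hw one_ne_zero ho hx),
      fun hx => RelBy.mem_cells (X := X) hr hw one_ne_zero ho
        (h ▸ (RelBy.refl X).inside hw one_ne_zero ho hx)⟩
  refine Pose.ext_iff'.2 ⟨hm.symm, ?_, ?_⟩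
  · simp [hr.1]
  · simp [hr.2]

/-- A motion mapping the regions of a set of placements to those of a tiling maps the placements
to those of the tiling. -/
theorem PoseTiling.image_act {S T : Set Pose} (hT : PoseTiling T) {f : Motion}
    (h : (fun X : Pose => f.app '' X.body) '' S = Pose.body '' T) : f.act '' S = T := by
  ext Y
  constructor
  · rintro ⟨X, hX, rfl⟩
    obtain ⟨Y, hY, e⟩ : f.app '' X.body ∈ Pose.body '' T := h ▸ ⟨X, hX, rfl⟩
    rw [f.image_body] at e
    rwa [hT.eq_of_body_eq hY e.symm]
  · intro hY
    obtain ⟨X, hX, e⟩ : Y.body ∈ (fun X : Pose => f.app '' X.body) '' S := h ▸ ⟨Y, hY, rfl⟩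
    exact ⟨X, hX, hT.eq_of_body_eq hY (by rw [← f.image_body]; exact e)⟩

/-- The translation by `v`. -/
def Motion.trans (v : ℂ) : Motion := ⟨false, 1, v, by simp⟩

theorem Motion.trans_act (v : ℂ) (X : Pose) : (Motion.trans v).act X = ⟨X.m, X.u, X.t + v, X.norm_u⟩ := by
  simp [act, trans, app]

theorem Motion.trans_act_injective (v : ℂ) : Function.Injective (Motion.trans v).act := by
  intro X Y h
  simpa [trans_act, Pose.ext_iff'] using h

theorem PoseTiling.eq_zero_of_trans {S : Set Pose} (hS : PoseTiling S) {v : ℂ}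
    (h : (Motion.trans v).act '' S = S) : v = 0 := by
  obtain ⟨X, hX, -⟩ := hS.cover 0
  have hmem (Y : Pose) : Y ∈ S ↔ (Motion.trans v).act Y ∈ S := by
    conv_rhs => rw [← h]
    exact ((Motion.trans_act_injective v).mem_set_image).symm
  obtain ⟨k, q, -, hq⟩ := hS.rel hX ((hmem X).1 hX)
  rw [Motion.trans_act] at hq
  replace hq : v = X.u * em (latHom q) := add_left_cancel hq
  have key (Y : Pose) (k : Fin 6) (p : Eis) :
      RelBy X Y k p ↔ RelBy X ((Motion.trans v).act Y) k (q + p) := by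
    rw [Motion.trans_act, RelBy, RelBy, map_add, em_add, hq]
    refine and_congr_right fun _ => ⟨fun h => ?_, fun h => ?_⟩
    · dsimp only; rw [h]; ring
    · dsimp only at h; linear_combination h
  have := (hS.exactCover hX).eq_zero_of_shift (v := q) fun t => by
    constructor
    · rintro ⟨Y, hY, hr, hm⟩
      exact ⟨_, (hmem Y).1 hY, (key Y _ _).1 hr, by simpa [Motion.trans_act, Tile.shift] using hm⟩
    · rintro ⟨Z, hZ, hr, hm⟩
      rw [← h] at hZ
      obtain ⟨Y, hY, rfl⟩ := hZ
      exact ⟨Y, hY, (key Y _ _).2 hr, by simpa [Motion.trans_act, Tile.shift] using hm⟩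
  simp [hq, this]

theorem poseOf_injective : Function.Injective poseOf := by
  rintro ⟨q, k, m⟩ ⟨q', k', m'⟩ h
  obtain ⟨h1, h2, h3⟩ := Pose.ext_iff'.1 h
  simp only [poseOf] at h1 h2 h3
  rw [h1, zr_injective h2, latHom_injective (em_injective h3)]

theorem Motion.eq_of_act {f g : Motion} {X : Pose} (hr : f.r = g.r) (h : f.act X = g.act X) :
    f = g := by
  obtain ⟨-, h1, h2⟩ := Pose.ext_iff'.1 h
  obtain ⟨r, a, b, ha⟩ := f
  obtain ⟨r', a', b', ha'⟩ := g
  obtain rfl : r = r' := hr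
  have : cj r X.u ≠ 0 := by simpa using X.u_ne_zero
  obtain rfl := mul_right_cancel₀ this h1
  obtain rfl := add_left_cancel h2
  rfl

/-- Only countably many coverings are congruent to a given one. -/
theorem countable_congruent {T : Set Tile} (hT : T.Nonempty) :
    {s : Config | ∃ f : Motion, f.act '' (poseOf '' T) = poseOf '' s.tiles}.Countable := by
  obtain ⟨t₀, ht₀⟩ := hT
  let A (p : Bool × Tile) : Set Config := {s | ∃ f : Motion, f.r = p.1 ∧
    f.act (poseOf t₀) = poseOf p.2 ∧ f.act '' (poseOf '' T) = poseOf '' s.tiles}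
  refine (Set.countable_iUnion (t := A) fun p => ?_).mono ?_
  · refine Set.Subsingleton.countable ?_
    rintro s ⟨f, hr, hf, h⟩ s' ⟨f', hr', hf', h'⟩
    obtain rfl := Motion.eq_of_act (hr.trans hr'.symm) (hf.trans hf'.symm)
    have e := poseOf_injective.image_injective (h.symm.trans h')
    funext t
    rw [Bool.eq_iff_iff]
    exact Set.ext_iff.1 e t
  · rintro s ⟨f, h⟩
    obtain ⟨t, -, ht⟩ : f.act (poseOf t₀) ∈ poseOf '' s.tiles := h ▸ ⟨_, ⟨t₀, ht₀, rfl⟩, rfl⟩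
    exact Set.mem_iUnion.2 ⟨(f.r, t), f, rfl, ht.symm, h⟩

/-! ### The prototile in the Euclidean plane -/

/-- The identification of the complex numbers with the plane. -/
def plane : ℂ ≃ₗᵢ[ℝ] Plane := Complex.orthonormalBasisOneI.repr

/-- The hat. -/
def prototile : Set Plane := plane '' hat false

/-- The tile in the plane given by a placement. -/
def tile (X : Pose) : Set Plane := plane '' X.body

theorem exists_motion_plane (g : Plane ≃ᵢ Plane) :
    ∃ f : Motion, ∀ z, g (plane z) = plane (f.app z) := by
  obtain ⟨f, hf⟩ := exists_motion
    ((plane.toIsometryEquiv.trans g).trans plane.symm.toIsometryEquiv)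
  exact ⟨f, fun z => by rw [← hf]; simp⟩

theorem exists_pose (g : Plane ≃ᵢ Plane) : ∃ X : Pose, g '' prototile = tile X := by
  obtain ⟨f, hf⟩ := exists_motion_plane g
  refine ⟨f.act Pose.std, ?_⟩
  rw [prototile, tile, ← f.image_body, ← Pose.std_body, Set.image_image, Set.image_image]
  simp only [hf]

theorem exists_isometry_tile (X : Pose) : ∃ g : Plane ≃ᵢ Plane, g '' prototile = tile X := by
  obtain ⟨g, hg⟩ := exists_isometry X
  refine ⟨(plane.symm.toIsometryEquiv.trans g).trans plane.toIsometryEquiv, ?_⟩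
  rw [tile, prototile, ← hg, Set.image_image, Set.image_image]
  simp

/-- The placement of the hat by an isometry of the plane. -/
def poseBy (g : Plane ≃ᵢ Plane) : Pose := (exists_pose g).choose

theorem tile_poseBy (g : Plane ≃ᵢ Plane) : tile (poseBy g) = g '' prototile :=
  (exists_pose g).choose_spec.symm

/-- An isometry of the plane giving the placement. -/
def isoOf (X : Pose) : Plane ≃ᵢ Plane := (exists_isometry_tile X).choose

theorem image_isoOf (X : Pose) : isoOf X '' prototile = tile X :=
  (exists_isometry_tile X).choose_spec

theorem disjoint_interior_tile {X Y : Pose} : Disjoint (interior (tile X)) (interior (tile Y)) ↔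
    Disjoint (interior X.body) (interior Y.body) := by
  have h (X : Pose) : interior (tile X) = plane '' interior X.body :=
    (plane.toHomeomorph.image_interior X.body).symm
  rw [h, h, Set.disjoint_image_iff plane.injective]

theorem image_prototile (S : Set (Plane ≃ᵢ Plane)) :
    (fun g : Plane ≃ᵢ Plane => g '' prototile) '' S = tile '' (poseBy '' S) := by
  simp only [Set.image_image, tile_poseBy]

theorem poseTiling_poseBy {S : Set (Plane ≃ᵢ Plane)} (hS : IsTiling prototile S) :
    PoseTiling (poseBy '' S) where
  cover z := by
    have : plane z ∈ ⋃ g ∈ S, g '' prototile := by rw [hS.1]; trivial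
    simp only [Set.mem_iUnion] at this
    obtain ⟨g, hg, hz⟩ := this
    rw [← tile_poseBy] at hz
    exact ⟨_, ⟨g, hg, rfl⟩, plane.injective.mem_set_image.1 hz⟩
  disj := by
    rintro _ ⟨g, hg, rfl⟩ _ ⟨h, hh, rfl⟩ hne
    have := hS.2 hg hh (by rintro rfl; exact hne rfl)
    dsimp only at this
    rwa [← tile_poseBy, ← tile_poseBy, disjoint_interior_tile] at this

theorem isTiling_isoOf {S : Set Pose} (hS : PoseTiling S) : IsTiling prototile (isoOf '' S) := by
  constructor
  · refine Set.eq_univ_of_forall fun z => ?_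
    obtain ⟨X, hX, hz⟩ := hS.cover (plane.symm z)
    refine Set.mem_biUnion ⟨X, hX, rfl⟩ ?_
    rw [image_isoOf]
    exact ⟨_, hz, by simp⟩
  · rintro _ ⟨X, hX, rfl⟩ _ ⟨Y, hY, rfl⟩ hne
    rw [image_isoOf, image_isoOf, disjoint_interior_tile]
    exact hS.disj hX hY (by rintro rfl; exact hne rfl)

/-- A map of the plane carrying the tiles of `S` to the tiles of the tiling `T`, as a motion. -/
theorem PoseTiling.image_act_plane {S T : Set Pose} (hT : PoseTiling T) {F : Plane → Plane}
    {f : Motion} (hF : ∀ z, F (plane z) = plane (f.app z))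
    (h : (fun A => F '' A) '' (tile '' S) = tile '' T) : f.act '' S = T := by
  refine hT.image_act (plane.injective.image_injective.image_injective ?_)
  have (B : Set ℂ) : F '' (plane '' B) = plane '' (f.app '' B) := by
    simp only [Set.image_image, hF]
  have ht : tile = fun X => plane '' X.body := rfl
  simpa only [Set.image_image, ht, this] using h

theorem not_tilingTransInvariant {S : Set (Plane ≃ᵢ Plane)} (hS : IsTiling prototile S) {v : Plane}
    (hv : v ≠ 0) : ¬ TilingTransInvariant prototile S v := fun h => by
  have hT := poseTiling_poseBy hS
  rw [TilingTransInvariant, image_prototile] at h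
  have := hT.eq_zero_of_trans <| hT.image_act_plane (f := Motion.trans (plane.symm v))
    (fun z => by simp [Motion.app, Motion.trans, add_comm]) h
  exact hv (by simpa using this)

/-- The tiling of the plane given by a covering. -/
def planeTiling (s : Config) : Set (Plane ≃ᵢ Plane) := isoOf '' (poseOf '' s.tiles)

theorem isTiling_planeTiling {s : Config} (hs : s ∈ coverings) :
    IsTiling prototile (planeTiling s) :=
  isTiling_isoOf (ExactCover.poseTiling hs)

theorem image_planeTiling (s : Config) :
    (fun g : Plane ≃ᵢ Plane => g '' prototile) '' planeTiling s = tile '' (poseOf '' s.tiles) := by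
  rw [planeTiling, Set.image_image]
  simp only [image_isoOf]

theorem exists_act_of_congruent {s s' : Config} (hs' : s' ∈ coverings)
    (h : TilingsCongruent prototile (planeTiling s) (planeTiling s')) :
    ∃ f : Motion, f.act '' (poseOf '' s.tiles) = poseOf '' s'.tiles := by
  obtain ⟨g, hg⟩ := h
  rw [image_planeTiling, image_planeTiling] at hg
  obtain ⟨f, hf⟩ := exists_motion_plane g
  exact ⟨f, (ExactCover.poseTiling hs').image_act_plane hf hg⟩

theorem tilingsCongruent_equivalence (P : Set Plane) : Equivalence (TilingsCongruent P) where
  refl S := ⟨IsometryEquiv.refl Plane, by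
    have : ⇑(IsometryEquiv.refl Plane) = id := rfl
    simp only [this, Set.image_id, Set.image_id']⟩
  symm := by
    rintro S T ⟨f, h⟩
    refine ⟨f.symm, ?_⟩
    rw [← h]
    simp only [Set.image_image, IsometryEquiv.symm_apply_apply]
  trans := by
    rintro S T U ⟨f, h⟩ ⟨g, h'⟩
    refine ⟨f.trans g, ?_⟩
    rw [← h', ← h, Set.image_image (fun A => g '' A)]
    simp only [Set.image_image, IsometryEquiv.trans_apply]

theorem exists_uncountable_family : ∃ Fam : Set (Set (Plane ≃ᵢ Plane)), ¬ Fam.Countable ∧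
    (∀ S ∈ Fam, IsTiling prototile S) ∧
    (∀ S₁ ∈ Fam, ∀ S₂ ∈ Fam, S₁ ≠ S₂ → ¬ TilingsCongruent prototile S₁ S₂) := by
  let r : Setoid coverings :=
    Setoid.comap (fun s => planeTiling s) ⟨_, tilingsCongruent_equivalence prototile⟩
  have hr (s t : coverings) :
      (⟦s⟧ : Quotient r) = ⟦t⟧ ↔ TilingsCongruent prototile (planeTiling s) (planeTiling t) :=
    Quotient.eq
  refine ⟨Set.range fun q : Quotient r => planeTiling q.out, fun hc => ?_, ?_, ?_⟩
  · have inj : Function.Injective fun q : Quotient r => planeTiling q.out := fun q q' h => by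
      rw [← q.out_eq, ← q'.out_eq, hr]
      dsimp only at h
      rw [h]
      exact (tilingsCongruent_equivalence prototile).refl _
    have : Countable (Quotient r) := by
      rw [← Set.countable_univ_iff]
      exact (Set.countable_of_injective_of_countable_image inj.injOn (by rwa [Set.image_univ]))
    refine not_countable_coverings (fun v s hs h => ?_) ?_
    · refine ExactCover.eq_zero_of_shift (v := v) hs fun t => ?_
      conv_rhs => rw [← h, Config.mem_tiles_shift]
      simp [Tile.shift]
    · refine (Set.countable_iUnion (t := fun q : Quotient r =>
        {s : Config | ∃ f : Motion, f.act '' (poseOf '' (q.out : Config).tiles) =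
          poseOf '' s.tiles}) fun q => countable_congruent ?_).mono fun s hs => ?_
      · obtain ⟨t, ht, -⟩ := (q.out.2 : ExactCover _) (0, 0)
        exact ⟨t, ht.1⟩
      · refine Set.mem_iUnion.2 ⟨⟦⟨s, hs⟩⟧, exists_act_of_congruent hs ?_⟩
        exact (hr _ ⟨s, hs⟩).1 (Quotient.out_eq _)
  · rintro _ ⟨q, rfl⟩
    exact isTiling_planeTiling q.out.2
  · rintro _ ⟨q, rfl⟩ _ ⟨q', rfl⟩ hne h
    rw [← hr, Quotient.out_eq, Quotient.out_eq] at h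
    exact hne (by rw [h])

/-! ### The hat is a topological disc -/

theorem exists_homeo_closedBall {G : ℂ → ℝ} (hc : Continuous G)
    (hh : ∀ r : ℝ, 0 ≤ r → ∀ z, G (r * z) = r * G z) (hp : ∀ z ≠ 0, 0 < G z) {K : Set ℂ}
    (hK : IsCompact K) (h : ∀ z, z ∈ K ↔ G z ≤ 1) :
    Nonempty (K ≃ₜ Metric.closedBall (0 : ℂ) 1) := by
  have h0 : G 0 = 0 := by simpa using hh 0 le_rfl 0
  have hn (z : ℂ) : 0 ≤ G z := by
    rcases eq_or_ne z 0 with rfl | hz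
    · exact h0.ge
    · exact (hp z hz).le
  let f (z : ℂ) : ℂ := (G z / ‖z‖ : ℝ) * z
  let g (z : ℂ) : ℂ := (‖z‖ / G z : ℝ) * z
  have nf (z : ℂ) : ‖f z‖ = G z := by
    rcases eq_or_ne z 0 with rfl | hz
    · simp [f, h0]
    · have := norm_pos_iff.2 hz
      rw [norm_mul, norm_real, Real.norm_of_nonneg (div_nonneg (hn z) this.le),
        div_mul_cancel₀ _ this.ne']
  have Gg (z : ℂ) : G (g z) = ‖z‖ := by
    rcases eq_or_ne z 0 with rfl | hz
    · simp [g, h0]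
    · rw [hh _ (div_nonneg (norm_nonneg z) (hn z)), div_mul_cancel₀ _ (hp z hz).ne']
  have gf (z : ℂ) : g (f z) = z := by
    rcases eq_or_ne z 0 with rfl | hz
    · simp [f, g]
    · have h1 := norm_pos_iff.2 hz
      have h2 := hp z hz
      have e : G (f z) = G z / ‖z‖ * G z := hh _ (div_nonneg h2.le h1.le) z
      simp only [g]
      rw [nf, e]
      simp only [f]
      rw [← mul_assoc, ← ofReal_mul]
      have : G z / (G z / ‖z‖ * G z) * (G z / ‖z‖) = 1 := by field_simp
      rw [this, ofReal_one, one_mul]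
  have fg (z : ℂ) : f (g z) = z := by
    rcases eq_or_ne z 0 with rfl | hz
    · simp [f, g]
    · have h1 := norm_pos_iff.2 hz
      have h2 := hp z hz
      have e : ‖g z‖ = ‖z‖ / G z * ‖z‖ := by
        rw [norm_mul, norm_real, Real.norm_of_nonneg (div_nonneg h1.le h2.le)]
      simp only [f]
      rw [Gg, e]
      simp only [g]
      rw [← mul_assoc, ← ofReal_mul]
      have : ‖z‖ / (‖z‖ / G z * ‖z‖) * (‖z‖ / G z) = 1 := by field_simp
      rw [this, ofReal_one, one_mul]
  have cf : Continuous f := by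
    refine continuous_iff_continuousAt.2 fun z => ?_
    rcases eq_or_ne z 0 with rfl | hz
    · have e : f 0 = 0 := by simp [f]
      rw [ContinuousAt, e, tendsto_zero_iff_norm_tendsto_zero]
      simp only [nf]
      simpa [h0] using hc.tendsto 0
    · have := norm_ne_zero_iff.2 hz
      exact (continuous_ofReal.continuousAt.comp
        (hc.continuousAt.div continuous_norm.continuousAt this)).mul continuousAt_id
  let e : K ≃ Metric.closedBall (0 : ℂ) 1 :=
    { toFun := fun z => ⟨f z, by rw [mem_closedBall_zero_iff, nf]; exact (h z).1 z.2⟩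
      invFun := fun z => ⟨g z, by rw [h, Gg]; exact mem_closedBall_zero_iff.1 z.2⟩
      left_inv := fun z => Subtype.ext (gf z)
      right_inv := fun z => Subtype.ext (fg z) }
  have : CompactSpace K := isCompact_iff_compactSpace.1 hK
  have ce : Continuous e := (cf.comp continuous_subtype_val).subtype_mk _
  exact ⟨ce.homeoOfEquivCompactToT2⟩

/-- The gauge of the hat about an interior point, in lattice coordinates. -/
def gauge (X Y : ℝ) : ℝ :=
  max (max (max (max (-(X + Y) / 3) (-3 / 5 * Y)) (max (3 / 13 * (X - Y)) ((X + Y) / 3)))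
    (3 / 16 * X + 3 / 8 * Y)) (max (max (min (-6 / 7 * X - 3 / 7 * Y) (-3 / 5 * X + 3 / 5 * Y))
    (min (3 / 2 * X) (-3 / 2 * X - 3 * Y))) (max (min (3 * Y) (6 / 11 * X + 3 / 11 * Y))
    (min (-3 / 4 * X) (3 / 7 * Y))))

theorem gauge_le_iff {X Y r : ℝ} : gauge X Y ≤ r ↔
    ((((-(X + Y) / 3) ≤ r ∧ (-3 / 5 * Y) ≤ r) ∧ (3 / 13 * (X - Y)) ≤ r ∧ ((X + Y) / 3) ≤ r) ∧
      (3 / 16 * X + 3 / 8 * Y) ≤ r) ∧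
    (((-6 / 7 * X - 3 / 7 * Y) ≤ r ∨ (-3 / 5 * X + 3 / 5 * Y) ≤ r) ∧
      ((3 / 2 * X) ≤ r ∨ (-3 / 2 * X - 3 * Y) ≤ r)) ∧
    ((3 * Y) ≤ r ∨ (6 / 11 * X + 3 / 11 * Y) ≤ r) ∧ ((-3 / 4 * X) ≤ r ∨ (3 / 7 * Y) ≤ r) := by
  simp only [gauge, max_le_iff, min_le_iff]

theorem gauge_mul {r : ℝ} (hr : 0 ≤ r) (X Y : ℝ) : gauge (r * X) (r * Y) = r * gauge X Y := by
  simp only [gauge, mul_max_of_nonneg _ _ hr, mul_min_of_nonneg _ _ hr]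
  ring_nf

theorem gauge_pos {X Y : ℝ} (h : gauge X Y ≤ 0) : X = 0 ∧ Y = 0 := by
  obtain ⟨⟨⟨⟨h1, h2⟩, h3, h4⟩, h5⟩, -⟩ := gauge_le_iff.1 h
  constructor <;> linarith

theorem continuous_gauge : Continuous fun z : ℂ => gauge (cX z) (cY z) := by
  unfold gauge; fun_prop

theorem mem_hat_iff_gauge {z : ℂ} :
    z ∈ hat false ↔ gauge (cX z - 4 / 3) (cY z + 1 / 3) ≤ 1 := by
  rw [gauge_le_iff, hat, mem_cellUnion]
  set x := cX z with hx
  set y := cY z with hy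
  obtain ⟨k0, k1, -, -, k4, k5⟩ := mem_kite_coords (0, 0) z (a := x) (b := y)
    (by simp [hx]) (by simp [hy])
  obtain ⟨-, k1', k2', -⟩ := mem_kite_coords (1, -1) z (a := x - 4) (b := y + 2)
    (by simp [hx]; ring) (by simp [hy]; ring)
  obtain ⟨-, -, -, k3'', k4'', -⟩ := mem_kite_coords (1, 0) z (a := x - 2) (b := y - 2)
    (by simp [hx]) (by simp [hy])
  constructor
  · rintro ⟨c, hc, hz⟩
    simp only [hatCells, List.mem_cons, List.not_mem_nil, or_false] at hc
    rcases hc with rfl | rfl | rfl | rfl | rfl | rfl | rfl | rfl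
    · obtain ⟨h1, h2, h3, h4⟩ := k1.1 hz
      refine ⟨⟨⟨⟨?_, ?_⟩, ?_, ?_⟩, ?_⟩, ⟨.inl ?_, .inl ?_⟩, .inr ?_, .inr ?_⟩ <;> linarith
    · obtain ⟨h1, h2, h3, h4⟩ := k4.1 hz
      refine ⟨⟨⟨⟨?_, ?_⟩, ?_, ?_⟩, ?_⟩, ⟨.inr ?_, .inl ?_⟩, .inl ?_, .inr ?_⟩ <;> linarith
    · obtain ⟨h1, h2, h3, h4⟩ := k5.1 hz
      refine ⟨⟨⟨⟨?_, ?_⟩, ?_, ?_⟩, ?_⟩, ⟨.inl ?_, .inl ?_⟩, .inl ?_, .inl ?_⟩ <;> linarith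
    · obtain ⟨h1, h2, h3, h4⟩ := k0.1 hz
      refine ⟨⟨⟨⟨?_, ?_⟩, ?_, ?_⟩, ?_⟩, ⟨.inl ?_, .inl ?_⟩, .inr ?_, .inl ?_⟩ <;> linarith
    · obtain ⟨h1, h2, h3, h4⟩ := k1'.1 hz
      refine ⟨⟨⟨⟨?_, ?_⟩, ?_, ?_⟩, ?_⟩, ⟨.inl ?_, .inr ?_⟩, .inl ?_, .inl ?_⟩ <;> linarith
    · obtain ⟨h1, h2, h3, h4⟩ := k2'.1 hz
      refine ⟨⟨⟨⟨?_, ?_⟩, ?_, ?_⟩, ?_⟩, ⟨.inl ?_, .inr ?_⟩, .inl ?_, .inl ?_⟩ <;> linarith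
    · obtain ⟨h1, h2, h3, h4⟩ := k3''.1 hz
      refine ⟨⟨⟨⟨?_, ?_⟩, ?_, ?_⟩, ?_⟩, ⟨.inl ?_, .inl ?_⟩, .inr ?_, .inl ?_⟩ <;> linarith
    · obtain ⟨h1, h2, h3, h4⟩ := k4''.1 hz
      refine ⟨⟨⟨⟨?_, ?_⟩, ?_, ?_⟩, ?_⟩, ⟨.inl ?_, .inr ?_⟩, .inr ?_, .inl ?_⟩ <;> linarith
  · rintro ⟨⟨⟨⟨h1, h2⟩, h3, h4⟩, h5⟩, ⟨p0, p1⟩, p2, p3⟩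
    rcases le_total 0 (-x + y) with h | h
    · rcases le_total 0 (x) with h | h
      · rcases le_total 0 (2 - x - y) with h | h
        · exact ⟨(((0, 0), 1) : Cell), by decide, k1.2 (by refine ⟨?_, ?_, ?_, ?_⟩ <;> linarith)⟩
        · exact ⟨(((1, 0), 3) : Cell), by decide, k3''.2 (by refine ⟨?_, ?_, ?_, ?_⟩ <;> linarith)⟩
      · rcases p0 with h | h
        · rcases le_total 0 (2 - y) with h | h
          · exact ⟨(((0, 0), 1) : Cell), by decide, k1.2 (by refine ⟨?_, ?_, ?_, ?_⟩ <;> linarith)⟩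
          · rcases p3 with h | h
            · exact ⟨(((1, 0), 3) : Cell), by decide, k3''.2 (by refine ⟨?_, ?_, ?_, ?_⟩ <;> linarith)⟩
            · exact ⟨(((0, 0), 1) : Cell), by decide, k1.2 (by refine ⟨?_, ?_, ?_, ?_⟩ <;> linarith)⟩
        · exact ⟨(((0, 0), 4) : Cell), by decide, k4.2 (by refine ⟨?_, ?_, ?_, ?_⟩ <;> linarith)⟩
    · rcases le_total 0 (2 * x + y) with h | h
      · rcases le_total 0 (2 - x - y) with h | h
        · rcases p1 with h | h
          · rcases le_total 0 (-x - 2 * y) with h | h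
            · exact ⟨(((0, 0), 5) : Cell), by decide, k5.2 (by refine ⟨?_, ?_, ?_, ?_⟩ <;> linarith)⟩
            · exact ⟨(((0, 0), 0) : Cell), by decide, k0.2 (by refine ⟨?_, ?_, ?_, ?_⟩ <;> linarith)⟩
          · rcases le_total 0 (2 - x) with h | h
            · exact ⟨(((0, 0), 0) : Cell), by decide, k0.2 (by refine ⟨?_, ?_, ?_, ?_⟩ <;> linarith)⟩
            · exact ⟨(((1, -1), 2) : Cell), by decide, k2'.2 (by refine ⟨?_, ?_, ?_, ?_⟩ <;> linarith)⟩
        · rcases p2 with h | h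
          · rcases le_total 0 (-6 + 2 * x + y) with h | h
            · exact ⟨(((1, -1), 1) : Cell), by decide, k1'.2 (by refine ⟨?_, ?_, ?_, ?_⟩ <;> linarith)⟩
            · exact ⟨(((1, -1), 2) : Cell), by decide, k2'.2 (by refine ⟨?_, ?_, ?_, ?_⟩ <;> linarith)⟩
          · rcases le_total 0 (-y) with h | h
            · exact ⟨(((1, -1), 2) : Cell), by decide, k2'.2 (by refine ⟨?_, ?_, ?_, ?_⟩ <;> linarith)⟩
            · exact ⟨(((1, 0), 4) : Cell), by decide, k4''.2 (by refine ⟨?_, ?_, ?_, ?_⟩ <;> linarith)⟩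
      · exact ⟨(((0, 0), 4) : Cell), by decide, k4.2 (by refine ⟨?_, ?_, ?_, ?_⟩ <;> linarith)⟩

theorem hat_homeo_closedBall : Nonempty (prototile ≃ₜ Metric.closedBall (0 : Plane) 1) := by
  let o : ℂ := (4 / 3 : ℝ) * em (1, 0) + (-1 / 3 : ℝ) * em (0, 1)
  have ho : cX o = 4 / 3 ∧ cY o = -1 / 3 := by
    simp only [o, cX_add, cY_add, cX_real_mul, cY_real_mul, cX_em, cY_em]
    constructor <;> norm_num
  let τ : ℂ ≃ₜ ℂ := Homeomorph.addRight o
  obtain ⟨e⟩ := exists_homeo_closedBall (G := fun z => gauge (cX z) (cY z)) continuous_gauge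
    (fun r hr z => by simp only [cX_real_mul, cY_real_mul, gauge_mul hr])
    (fun z hz => by
      by_contra! h
      obtain ⟨h1, h2⟩ := gauge_pos h
      exact hz (eq_of_coords (h1.trans (by simp [cX])) (h2.trans (by simp [cY]))))
    (K := τ ⁻¹' hat false) (τ.isCompact_preimage.2 (isCompact_cellUnion _)) fun z => by
      have : τ z = z + o := rfl
      rw [Set.mem_preimage, mem_hat_iff_gauge, this, cX_add, cY_add, ho.1, ho.2]
      ring_nf
  have e₁ : (τ ⁻¹' hat false) ≃ₜ hat false := τ.sets (by rfl)
  have e₂ : hat false ≃ₜ prototile := plane.toHomeomorph.image (hat false)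
  have e₃ : Metric.closedBall (0 : ℂ) 1 ≃ₜ Metric.closedBall (0 : Plane) 1 :=
    (plane.toHomeomorph.image _).trans <| Homeomorph.setCongr <| by
      simp
  exact ⟨(e₂.symm.trans e₁.symm).trans (e.trans e₃)⟩

theorem isCompact_prototile : IsCompact prototile :=
  (isCompact_cellUnion _).image plane.continuous

theorem kite_subset_closure (c : Cell) : kite c ⊆ closure (okite c) := by
  intro z hz
  let w : ℂ := zr c.2 * em (1, 0) + em (latHom c.1)
  have hw (e : Fin 4) : 0 < form e (pull c w) := by
    have : pull c w = em (1, 0) := by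
      rw [← act_self c, show w = zr c.2 * em (1, 0) + em (latHom c.1) from rfl, pull_act, pull_zero]
    rw [this]
    revert e
    rw [forall_form (P := fun x => 0 < x)]
    simp
  have hlin (t : ℝ) (e : Fin 4) : form e (pull c (z + t * (w - z))) =
      (1 - t) * form e (pull c z) + t * form e (pull c w) := by
    have : pull c (z + t * (w - z)) = pull c z + t * (pull c w - pull c z) := by
      simp only [pull]; ring
    rw [this, form, form, form, cX_add, cY_add, cX_real_mul, cY_real_mul, cX_sub, cY_sub]
    ring
  have hc : Tendsto (fun t : ℝ => z + t * (w - z)) (𝓝[>] 0) (𝓝 z) := by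
    have : Continuous fun t : ℝ => z + t * (w - z) := by fun_prop
    simpa using (this.tendsto 0).mono_left nhdsWithin_le_nhds
  refine mem_closure_of_tendsto hc ?_
  filter_upwards [Ioo_mem_nhdsGT (zero_lt_one (α := ℝ))] with t ht e
  rw [hlin]
  have := hz e
  have := mul_pos ht.1 (hw e)
  nlinarith [mul_nonneg (sub_nonneg.2 ht.2.le) (hz e)]

theorem hat_eq_closure (m : Bool) : hat m = closure (interior (hat m)) := by
  refine subset_antisymm (fun z hz => ?_)
    (closure_minimal interior_subset (isCompact_cellUnion _).isClosed)
  obtain ⟨c, hc, hz⟩ := mem_cellUnion.1 hz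
  exact closure_mono (okite_subset_interior hc) (kite_subset_closure c hz)

theorem prototile_eq_closure : prototile = closure (interior prototile) := by
  have h1 := plane.toHomeomorph.image_interior (hat false)
  have h2 := plane.toHomeomorph.image_closure (interior (hat false))
  change plane '' _ = closure (interior (plane.toHomeomorph '' hat false))
  rw [← h1, ← h2, ← hat_eq_closure]
  rfl

end

end HatTiling

/-- There is a closed topological disk none of whose tilings of the plane is
invariant under a nonzero translation, admitting an uncountable family of
pairwise non-congruent tilings. -/
theorem monotile_with_uncountably_many_tilings_exists :
    ∃ P : Set Plane,
      IsCompact P ∧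
      P = closure (interior P) ∧
      Nonempty (P ≃ₜ (Metric.closedBall (0 : Plane) 1)) ∧
      (∀ S : Set (Plane ≃ᵢ Plane), IsTiling P S →
        ∀ v : Plane, v ≠ 0 → ¬ TilingTransInvariant P S v) ∧
      (∃ Fam : Set (Set (Plane ≃ᵢ Plane)),
        ¬ Fam.Countable ∧
        (∀ S ∈ Fam, IsTiling P S) ∧
        (∀ S₁ ∈ Fam, ∀ S₂ ∈ Fam, S₁ ≠ S₂ → ¬ TilingsCongruent P S₁ S₂)) :=
  ⟨HatTiling.prototile, HatTiling.isCompact_prototile, HatTiling.prototile_eq_closure,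
    HatTiling.hat_homeo_closedBall, fun _ hS _ hv => HatTiling.not_tilingTransInvariant hS hv,
    HatTiling.exists_uncountable_family⟩
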